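/- Let N = 3, let a, b > −2 and p, q > 0. Then there exists no positive solution (u, v) of the Hardy–Hénon system on ℝ³ with both u and v bounded on ℝ³ if and only if (3+a)/(p+1) + (3+b)/(q+1) > 1. -/

import Mathlib

open MeasureTheory Metric Set Filter

/-- The Euclidean Laplacian of `u : ℝ^N → ℝ`, as the sum of the second derivatives
along the standard coordinate directions. -/
noncomputable def lap {N : ℕ} (u : EuclideanSpace ℝ (Fin N) → ℝ)
    (x : EuclideanSpace ℝ (Fin N)) : ℝ :=
  ∑ i : Fin N, iteratedFDeriv ℝ 2 u x ![EuclideanSpace.single i 1, EuclideanSpace.single i 1]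

/-- `(u, v)` is a positive solution of the Hardy–Hénon system
`-Δu = |x|^a v^p`, `-Δv = |x|^b u^q` on the set `Ω`:
`u, v` are continuous on `Ω`, `C²` on `Ω \ {0}`, positive on `Ω`, and
the equations hold on `Ω \ {0}`. -/
def IsHHSol {N : ℕ} (a b p q : ℝ) (Ω : Set (EuclideanSpace ℝ (Fin N)))
    (u v : EuclideanSpace ℝ (Fin N) → ℝ) : Prop :=
  ContinuousOn u Ω ∧ ContinuousOn v Ω ∧
  ContDiffOn ℝ 2 u (Ω \ {0}) ∧ ContDiffOn ℝ 2 v (Ω \ {0}) ∧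
  (∀ x ∈ Ω, 0 < u x) ∧ (∀ x ∈ Ω, 0 < v x) ∧
  (∀ x ∈ Ω \ {0}, -lap u x = ‖x‖ ^ a * v x ^ p) ∧
  (∀ x ∈ Ω \ {0}, -lap v x = ‖x‖ ^ b * u x ^ q)

open scoped Topology

local notation "E3" => EuclideanSpace ℝ (Fin 3)

/-! ### The Laplacian -/

lemma lap_eq_sum_fderiv (u : E3 → ℝ) (x : E3) :
    lap u x = ∑ i : Fin 3, fderiv ℝ (fderiv ℝ u) x (EuclideanSpace.single i 1)
      (EuclideanSpace.single i 1) := by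
  simp [lap, iteratedFDeriv_two_apply]

lemma lap_eq_sum_fderiv_apply {u : E3 → ℝ} {x : E3} (h : ContDiffAt ℝ 2 u x) :
    lap u x = ∑ i : Fin 3, fderiv ℝ (fun y => fderiv ℝ u y (EuclideanSpace.single i 1)) x
      (EuclideanSpace.single i 1) := by
  rw [lap_eq_sum_fderiv]
  refine Finset.sum_congr rfl fun i _ => ?_
  have hd : DifferentiableAt ℝ (fderiv ℝ u) x :=
    (h.fderiv_right (m := 1) (by norm_num)).differentiableAt (by norm_num)
  rw [fderiv_clm_apply hd (differentiableAt_const _)]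
  simp

lemma lap_radial {F F' : ℝ → ℝ} {F'' : ℝ} {x₀ x : E3}
    (h1 : ∀ᶠ s in 𝓝 (‖x - x₀‖ ^ 2), HasDerivAt F (F' s) s)
    (h2 : HasDerivAt F' F'' (‖x - x₀‖ ^ 2)) :
    lap (fun y => F (‖y - x₀‖ ^ 2)) x = 4 * ‖x - x₀‖ ^ 2 * F'' + 6 * F' (‖x - x₀‖ ^ 2) := by
  have hsq : ∀ y : E3, HasFDerivAt (fun y : E3 => ‖y - x₀‖ ^ 2)
      (2 • (innerSL ℝ (y - x₀))) y := by
    intro y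
    have := (hasFDerivAt_id (𝕜 := ℝ) y).sub_const x₀ |>.norm_sq
    convert! this using 1
  have hfd : ∀ᶠ y in 𝓝 x, fderiv ℝ (fun y => F (‖y - x₀‖ ^ 2)) y
      = F' (‖y - x₀‖ ^ 2) • (2 • (innerSL ℝ (y - x₀))) := by
    have hc : Tendsto (fun y : E3 => ‖y - x₀‖ ^ 2) (𝓝 x) (𝓝 (‖x - x₀‖ ^ 2)) :=
      (hsq x).continuousAt
    filter_upwards [hc.eventually h1] with y hy
    exact (hy.comp_hasFDerivAt y (hsq y)).fderiv
  have hL : HasFDerivAt (fun y : E3 => (2 • (innerSL ℝ (y - x₀)) : E3 →L[ℝ] ℝ))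
      (2 • (innerSL ℝ : E3 →L[ℝ] E3 →L[ℝ] ℝ)) x := by
    have h0 := ((innerSL ℝ : E3 →L[ℝ] E3 →L[ℝ] ℝ).hasFDerivAt (x := x - x₀)).comp x
      ((hasFDerivAt_id (𝕜 := ℝ) x).sub_const x₀)
    convert! h0.const_smul (2 : ℕ) using 1
  have hfd2 := (h2.comp_hasFDerivAt x (hsq x)).fun_smul hL
  rw [lap_eq_sum_fderiv, EventuallyEq.fderiv_eq hfd]
  have hfd2' := hfd2.fderiv
  simp only [Function.comp_def] at hfd2'
  rw [hfd2']
  have hn : ‖x - x₀‖ ^ 2 = ∑ i, (x i - x₀ i) ^ 2 := by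
    rw [EuclideanSpace.real_norm_sq_eq]; simp
  have h11 : ∀ i : Fin 3, innerSL ℝ (EuclideanSpace.single i (1 : ℝ))
      (EuclideanSpace.single i (1 : ℝ)) = (1 : ℝ) := by
    intro i
    rw [innerSL_apply_apply]
    simp
  simp only [Fin.sum_univ_three] at hn ⊢
  simp [EuclideanSpace.inner_single_right, h11]
  linear_combination (-4 * F'') * hn

lemma lap_mul {φ ψ : E3 → ℝ} (hφ : ContDiff ℝ 2 φ) (hψ : ContDiff ℝ 2 ψ) (x : E3) :
    lap (fun y => φ y * ψ y) x = ψ x * lap φ x + φ x * lap ψ x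
      + 2 * ∑ i : Fin 3, fderiv ℝ φ x (EuclideanSpace.single i 1)
          * fderiv ℝ ψ x (EuclideanSpace.single i 1) := by
  have h2 : ∀ {χ : E3 → ℝ}, ContDiff ℝ 2 χ → Differentiable ℝ χ :=
    fun h => h.differentiable (by norm_num)
  have h3 : ∀ {χ : E3 → ℝ}, ContDiff ℝ 2 χ → Differentiable ℝ (fderiv ℝ χ) :=
    fun h => (h.fderiv_right (m := 1) (by norm_num)).differentiable (by norm_num)
  have hfd : fderiv ℝ (fun y => φ y * ψ y) = fun y => φ y • fderiv ℝ ψ y + ψ y • fderiv ℝ φ y := by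
    funext y
    exact fderiv_fun_mul (h2 hφ y) (h2 hψ y)
  rw [lap_eq_sum_fderiv, lap_eq_sum_fderiv, lap_eq_sum_fderiv, hfd]
  rw [fderiv_fun_add ((h2 hφ x).fun_smul (h3 hψ x)) ((h2 hψ x).fun_smul (h3 hφ x)),
    fderiv_fun_smul (h2 hφ x) (h3 hψ x), fderiv_fun_smul (h2 hψ x) (h3 hφ x)]
  simp [Fin.sum_univ_three]
  ring

/-! ### Integration by parts -/

lemma integrable_mul_of_tsupport_subset {φ h : E3 → ℝ} {O : Set E3} (hO : IsOpen O)
    (hφ : Continuous φ) (hc : HasCompactSupport φ) (hs : tsupport φ ⊆ O)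
    (hh : ContinuousOn h O) : Integrable (fun x => φ x * h x) := by
  have hcont : Continuous (fun x => φ x * h x) := by
    refine continuous_of_tsupport fun x hx => ?_
    have hx' : x ∈ O := hs (closure_mono (by
      intro y hy
      simp only [Function.mem_support] at hy ⊢
      exact left_ne_zero_of_mul hy) hx)
    exact hφ.continuousAt.mul (hh.continuousAt (hO.mem_nhds hx'))
  exact hcont.integrable_of_hasCompactSupport hc.mul_right

lemma integral_mul_lap_comm {φ u : E3 → ℝ} {O : Set E3} (hO : IsOpen O)
    (hφ : ContDiff ℝ 2 φ) (hc : HasCompactSupport φ) (hs : tsupport φ ⊆ O)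
    (hu : ContDiffOn ℝ 2 u O) :
    ∫ x, φ x * lap u x = ∫ x, lap φ x * u x := by
  have hu' : ∀ x ∈ O, ContDiffAt ℝ 2 u x := fun x hx => hu.contDiffAt (hO.mem_nhds hx)
  have hfu : ContDiffOn ℝ 1 (fderiv ℝ u) O := hu.fderiv_of_isOpen hO (by norm_num)
  let e : Fin 3 → E3 := fun i => EuclideanSpace.single i 1
  have hui : ∀ i, ContDiffOn ℝ 1 (fun y => fderiv ℝ u y (e i)) O :=
    fun i => hfu.clm_apply contDiffOn_const
  have huii : ∀ i, ContinuousOn (fun y => fderiv ℝ (fun z => fderiv ℝ u z (e i)) y (e i)) O :=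
    fun i => ((hui i).continuousOn_fderiv_of_isOpen hO le_rfl).clm_apply continuousOn_const
  have hfφ : ContDiff ℝ 1 (fderiv ℝ φ) := hφ.fderiv_right (by norm_num)
  have hφi : ∀ i, ContDiff ℝ 1 (fun y => fderiv ℝ φ y (e i)) :=
    fun i => hfφ.clm_apply contDiff_const
  have hφii : ∀ i, Continuous (fun y => fderiv ℝ (fun z => fderiv ℝ φ z (e i)) y (e i)) :=
    fun i => ((hφi i).continuous_fderiv one_ne_zero).clm_apply continuous_const
  have hsi : ∀ i, tsupport (fun y => fderiv ℝ φ y (e i)) ⊆ tsupport φ :=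
    fun i => tsupport_fderiv_apply_subset ℝ (e i)
  have hsii : ∀ i, tsupport (fun y => fderiv ℝ (fun z => fderiv ℝ φ z (e i)) y (e i))
      ⊆ tsupport φ := fun i => (tsupport_fderiv_apply_subset ℝ (e i)).trans (hsi i)
  have hci : ∀ i, HasCompactSupport (fun y => fderiv ℝ φ y (e i)) :=
    fun i => hc.fderiv_apply (𝕜 := ℝ) (e i)
  have hcii : ∀ i, HasCompactSupport
      (fun y => fderiv ℝ (fun z => fderiv ℝ φ z (e i)) y (e i)) :=
    fun i => (hci i).fderiv_apply (𝕜 := ℝ) (e i)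
  have I1 : ∀ i, Integrable (fun x => φ x * fderiv ℝ (fun z => fderiv ℝ u z (e i)) x (e i)) :=
    fun i => integrable_mul_of_tsupport_subset hO hφ.continuous hc hs (huii i)
  have I2 : ∀ i, Integrable (fun x => fderiv ℝ φ x (e i) * fderiv ℝ u x (e i)) :=
    fun i => integrable_mul_of_tsupport_subset hO (hφi i).continuous (hci i)
      ((hsi i).trans hs) (hui i).continuousOn
  have I3 : ∀ i, Integrable (fun x => fderiv ℝ (fun z => fderiv ℝ φ z (e i)) x (e i) * u x) :=
    fun i => integrable_mul_of_tsupport_subset hO (hφii i) (hcii i)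
      ((hsii i).trans hs) hu.continuousOn
  have key : ∀ i, ∫ x, φ x * fderiv ℝ (fun z => fderiv ℝ u z (e i)) x (e i)
      = ∫ x, fderiv ℝ (fun z => fderiv ℝ φ z (e i)) x (e i) * u x := by
    intro i
    have k1 := integral_mul_fderiv_eq_neg_fderiv_mul_of_integrable (μ := volume) (f := φ)
      (g := fun z => fderiv ℝ u z (e i)) (v := e i) (I2 i) (I1 i)
      (integrable_mul_of_tsupport_subset hO hφ.continuous hc hs (hui i).continuousOn)
      (fun x _ => hφ.differentiable (by norm_num) x)
      (fun x hx => ((hui i).contDiffAt (hO.mem_nhds (hs hx))).differentiableAt (by norm_num))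
    have k2 := integral_mul_fderiv_eq_neg_fderiv_mul_of_integrable (μ := volume)
      (f := fun z => fderiv ℝ φ z (e i)) (g := u) (v := e i) (I3 i) (I2 i)
      (integrable_mul_of_tsupport_subset hO (hφi i).continuous (hci i)
        ((hsi i).trans hs) hu.continuousOn)
      (fun x _ => (hφi i).differentiable (by norm_num) x)
      (fun x hx => (hu' x (hs (hsi i hx))).differentiableAt (by norm_num))
    rw [k1, k2, neg_neg]
  have e1 : (fun x => φ x * lap u x) = fun x => ∑ i, φ x *
      fderiv ℝ (fun z => fderiv ℝ u z (e i)) x (e i) := by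
    funext x
    by_cases hx : x ∈ tsupport φ
    · rw [lap_eq_sum_fderiv_apply (hu' x (hs hx)), Finset.mul_sum]
    · simp [image_eq_zero_of_notMem_tsupport hx]
  have e2 : (fun x => lap φ x * u x) = fun x => ∑ i,
      fderiv ℝ (fun z => fderiv ℝ φ z (e i)) x (e i) * u x := by
    funext x
    rw [lap_eq_sum_fderiv_apply hφ.contDiffAt, Finset.sum_mul]
  rw [e1, e2, integral_finsetSum _ fun i _ => I1 i, integral_finsetSum _ fun i _ => I3 i]
  exact Finset.sum_congr rfl fun i _ => key i

/-! ### Limits of integrals -/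

lemma integrable_and_integral_eq_of_tendsto {α : Type*} [MeasurableSpace α] {μ : Measure α}
    {G : ℕ → α → ℝ} {F : α → ℝ} {L : ℝ} (hG : ∀ n, Integrable (G n) μ)
    (h0 : ∀ n, ∀ᵐ x ∂μ, 0 ≤ G n x) (hle : ∀ n, ∀ᵐ x ∂μ, G n x ≤ F x)
    (ht : ∀ᵐ x ∂μ, Tendsto (fun n => G n x) atTop (𝓝 (F x)))
    (hL : Tendsto (fun n => ∫ x, G n x ∂μ) atTop (𝓝 L)) :
    Integrable F μ ∧ ∫ x, F x ∂μ = L := by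
  have hmeas : AEStronglyMeasurable F μ :=
    aestronglyMeasurable_of_tendsto_ae atTop (fun n => (hG n).1) ht
  have hF0 : ∀ᵐ x ∂μ, 0 ≤ F x := by
    filter_upwards [h0 0, hle 0] with x h1 h2 using h1.trans h2
  have hintg : Integrable F μ := by
    refine ⟨hmeas, ?_⟩
    rw [hasFiniteIntegral_iff_ofReal hF0]
    have h1 : ∫⁻ x, ENNReal.ofReal (F x) ∂μ
        ≤ liminf (fun n => ∫⁻ x, ENNReal.ofReal (G n x) ∂μ) atTop := by
      calc ∫⁻ x, ENNReal.ofReal (F x) ∂μ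
          = ∫⁻ x, liminf (fun n => ENNReal.ofReal (G n x)) atTop ∂μ := by
            refine lintegral_congr_ae ?_
            filter_upwards [ht] with x hx
            exact ((ENNReal.continuous_ofReal.tendsto _).comp hx).liminf_eq.symm
        _ ≤ _ := lintegral_liminf_le' fun n => (hG n).1.aemeasurable.ennreal_ofReal
    have h2 : Tendsto (fun n => ∫⁻ x, ENNReal.ofReal (G n x) ∂μ) atTop (𝓝 (ENNReal.ofReal L)) := by
      have : (fun n => ∫⁻ x, ENNReal.ofReal (G n x) ∂μ)
          = fun n => ENNReal.ofReal (∫ x, G n x ∂μ) := by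
        funext n
        rw [ofReal_integral_eq_lintegral_ofReal (hG n) (h0 n)]
      rw [this]
      exact (ENNReal.continuous_ofReal.tendsto _).comp hL
    rw [h2.liminf_eq] at h1
    exact h1.trans_lt ENNReal.ofReal_lt_top
  refine ⟨hintg, ?_⟩
  refine tendsto_nhds_unique (tendsto_integral_of_dominated_convergence F (fun n => (hG n).1)
    hintg (fun n => ?_) ht) hL
  filter_upwards [h0 n, hle n] with x h1 h2
  rwa [Real.norm_of_nonneg h1]

/-! ### Cut-off functions and the weak form of the equation -/

lemma exists_cutoff : ∃ χ : E3 → ℝ, ContDiff ℝ 2 χ ∧ (∀ x, 0 ≤ χ x) ∧ (∀ x, χ x ≤ 1) ∧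
    (∀ x, ‖x‖ ≤ 1 → χ x = 1) ∧ (∀ x, 2 ≤ ‖x‖ → χ x = 0) := by
  let f : ContDiffBump (0 : E3) := ⟨1, 2, by norm_num, by norm_num⟩
  refine ⟨f, f.contDiff, fun x => f.nonneg, fun x => f.le_one, fun x hx => ?_, fun x hx => ?_⟩
  · exact f.one_of_mem_closedBall (by simpa using hx)
  · exact f.zero_of_le_dist (by simpa using hx)

lemma lap_comp_smul {χ : E3 → ℝ} (hχ : ContDiff ℝ 2 χ) (s : ℝ) (x : E3) :
    lap (fun y => χ (s • y)) x = s ^ 2 * lap χ (s • x) := by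
  have := congrFun (iteratedFDeriv_comp_const_smul (i := 2) s hχ) x
  simp only [lap, this, Finset.mul_sum]
  simp

lemma continuous_lap {χ : E3 → ℝ} (hχ : ContDiff ℝ 2 χ) : Continuous (lap χ) := by
  unfold lap
  refine continuous_finsetSum _ fun i _ => ?_
  exact (hχ.continuous_iteratedFDeriv (m := 2) le_rfl).eval_const _

lemma lap_congr {φ ψ : E3 → ℝ} {x : E3} (h : φ =ᶠ[𝓝 x] ψ) : lap φ x = lap ψ x := by
  simp only [lap_eq_sum_fderiv]
  rw [h.fderiv.fderiv_eq]

lemma lap_const (c : ℝ) (x : E3) : lap (fun _ : E3 => c) x = 0 := by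
  simp [lap_eq_sum_fderiv]

lemma lap_sub {φ ψ : E3 → ℝ} (hφ : ContDiff ℝ 2 φ) (hψ : ContDiff ℝ 2 ψ) (x : E3) :
    lap (fun y => φ y - ψ y) x = lap φ x - lap ψ x := by
  have := iteratedFDeriv_sub_apply (i := 2) (x := x) hφ.contDiffAt hψ.contDiffAt
  have h : iteratedFDeriv ℝ 2 (fun y => φ y - ψ y) x
    = iteratedFDeriv ℝ 2 φ x - iteratedFDeriv ℝ 2 ψ x := this
  simp [lap, h]

/-- Scale-invariant bounds for the derivatives of the rescalings of a cut-off function. -/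
lemma exists_cutoff_bound {χ : E3 → ℝ} (hχ : ContDiff ℝ 2 χ) (h2 : ∀ x, 2 ≤ ‖x‖ → χ x = 0) :
    ∃ C, 0 ≤ C ∧ (∀ s : ℝ, ∀ y : E3, |lap (fun y => χ (s • y)) y| * ‖y‖ ^ 2 ≤ C) ∧
      (∀ s : ℝ, ∀ y : E3, ‖fderiv ℝ (fun y => χ (s • y)) y‖ * ‖y‖ ≤ C) := by
  have hzero : ∀ x, 3 ≤ ‖x‖ → χ =ᶠ[𝓝 x] fun _ => 0 := by
    intro x hx
    have : ∀ᶠ y in 𝓝 x, 2 < ‖y‖ :=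
      continuous_norm.continuousAt.eventually (lt_mem_nhds (by simp; linarith))
    filter_upwards [this] with y hy using h2 y hy.le
  have hK : ∀ g : E3 → ℝ, Continuous g → (∀ x, 3 ≤ ‖x‖ → g x = 0) → ∃ C, 0 ≤ C ∧ ∀ x, g x ≤ C := by
    intro g hg hg0
    have : HasCompactSupport g := by
      refine HasCompactSupport.intro (isCompact_closedBall (0 : E3) 3) fun x hx => hg0 x ?_
      simp at hx
      exact hx.le
    obtain ⟨C, hC⟩ := this.exists_bound_of_continuous hg
    exact ⟨C, (norm_nonneg _).trans (hC 0), fun x => (le_abs_self _).trans (hC x)⟩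
  obtain ⟨C1, hC10, hC1⟩ := hK (fun z => |lap χ z| * ‖z‖ ^ 2)
    ((continuous_lap hχ).abs.mul (continuous_norm.pow 2)) (by
      intro x hx
      simp [lap_congr (hzero x hx), lap_const])
  obtain ⟨C2, hC20, hC2⟩ := hK (fun z => ‖fderiv ℝ χ z‖ * ‖z‖)
    ((hχ.continuous_fderiv (by norm_num)).norm.mul continuous_norm) (by
      intro x hx
      simp [(hzero x hx).fderiv_eq])
  refine ⟨C1 + C2, by positivity, fun s y => ?_, fun s y => ?_⟩
  · rw [lap_comp_smul hχ]
    have := hC1 (s • y)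
    simp only [norm_smul, Real.norm_eq_abs, mul_pow, sq_abs] at this
    rw [abs_mul, abs_of_nonneg (sq_nonneg s)]
    linarith
  · rw [fderiv_comp_smul]
    have := hC2 (s • y)
    simp only [norm_smul, Real.norm_eq_abs] at this ⊢
    linarith

/-- Weak form of a superharmonicity relation: a bounded function which is `C²` and superharmonic
away from the origin can be tested against functions of sufficient decay. -/
lemma integral_mul_neg_lap {u Φ : E3 → ℝ} {M : ℝ} (hu : Continuous u) (hM : ∀ x, |u x| ≤ M)
    (hu2 : ContDiffOn ℝ 2 u {0}ᶜ) (hf : ∀ x ≠ 0, 0 ≤ -lap u x)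
    (hΦ : ContDiff ℝ 2 Φ) (hΦ0 : ∀ x, 0 ≤ Φ x)
    (h1 : Integrable (fun y : E3 => Φ y * (‖y‖ ^ 2)⁻¹))
    (h2 : Integrable (fun y : E3 => ‖fderiv ℝ Φ y‖ * ‖y‖⁻¹))
    (h3 : Integrable (lap Φ)) :
    Integrable (fun y => Φ y * -lap u y) ∧ ∫ y, Φ y * -lap u y = ∫ y, -lap Φ y * u y := by
  obtain ⟨χ, hχ, hχ0, hχ1, hχe1, hχe0⟩ := exists_cutoff
  obtain ⟨C, hC0, hCl, hCd⟩ := exists_cutoff_bound hχ hχe0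
  have hM0 : 0 ≤ M := (abs_nonneg _).trans (hM 0)
  let s : ℕ → ℝ := fun n => n + 2
  have hs2 : ∀ n, 2 ≤ s n := fun n => by simp [s]
  have hs0 : ∀ n, 0 < s n := fun n => by linarith [hs2 n]
  let c1 : ℕ → E3 → ℝ := fun n y => χ ((s n)⁻¹ • y)
  let c2 : ℕ → E3 → ℝ := fun n y => χ (s n • y)
  let c : ℕ → E3 → ℝ := fun n y => c1 n y - c2 n y
  have hc1 : ∀ n, ContDiff ℝ 2 (c1 n) := fun n => hχ.comp (contDiff_const_smul _)
  have hc2 : ∀ n, ContDiff ℝ 2 (c2 n) := fun n => hχ.comp (contDiff_const_smul _)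
  have hc : ∀ n, ContDiff ℝ 2 (c n) := fun n => (hc1 n).sub (hc2 n)
  have hnorm1 : ∀ n (y : E3), ‖(s n)⁻¹ • y‖ = ‖y‖ / s n := fun n y => by
    rw [norm_smul, Real.norm_of_nonneg (inv_nonneg.2 (hs0 n).le), div_eq_inv_mul]
  have hnorm2 : ∀ n (y : E3), ‖s n • y‖ = s n * ‖y‖ := fun n y => by
    rw [norm_smul, Real.norm_of_nonneg (hs0 n).le]
  have hc_one : ∀ n y, c n y ≤ 1 := fun n y => by
    have := hχ1 ((s n)⁻¹ • y); have := hχ0 (s n • y)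
    simp only [c, c1, c2]; linarith
  have hc_nonneg : ∀ n y, 0 ≤ c n y := fun n y => by
    simp only [c, c1, c2]
    by_cases h : 2 ≤ ‖s n • y‖
    · rw [hχe0 _ h]; simpa using hχ0 _
    · rw [hχe1 ((s n)⁻¹ • y)]
      · linarith [hχ1 (s n • y)]
      · push Not at h
        rw [hnorm2] at h
        rw [hnorm1, div_le_one (hs0 n)]
        nlinarith [hs2 n, norm_nonneg y]
  have hc_supp : ∀ n, HasCompactSupport (c n) := fun n => by
    refine HasCompactSupport.intro (isCompact_closedBall (0 : E3) (2 * s n)) fun x hx => ?_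
    simp only [mem_closedBall, dist_zero_right, not_le] at hx
    simp only [c, c1, c2]
    rw [hχe0, hχe0, sub_zero]
    · rw [hnorm2]; nlinarith [hs2 n]
    · rw [hnorm1, le_div_iff₀ (hs0 n)]; exact hx.le
  have hc_zero : ∀ n, ∀ y : E3, ‖y‖ ≤ (s n)⁻¹ → c n y = 0 := fun n y hy => by
    simp only [c, c1, c2]
    have h5 : s n * ‖y‖ ≤ 1 := by
      calc s n * ‖y‖ ≤ s n * (s n)⁻¹ := by gcongr
        _ = 1 := mul_inv_cancel₀ (hs0 n).ne'
    rw [hχe1, hχe1, sub_self]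
    · rw [hnorm2]; exact h5
    · rw [hnorm1, div_le_one (hs0 n)]; nlinarith [hs2 n, norm_nonneg y]
  -- near a point different from the origin the cut-offs are eventually constant
  have hev : ∀ y : E3, y ≠ 0 → ∀ᶠ n in atTop, c n =ᶠ[𝓝 y] fun _ => 1 := by
    intro y hy
    have hy0 : 0 < ‖y‖ := norm_pos_iff.2 hy
    have hst : Tendsto s atTop atTop :=
      tendsto_atTop_add_const_right _ _ tendsto_natCast_atTop_atTop
    filter_upwards [hst.eventually_gt_atTop (2 * ‖y‖), hst.eventually_gt_atTop (4 / ‖y‖)] with n h5 h6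
    have e1 : ∀ᶠ z in 𝓝 y, ‖z‖ < 2 * ‖y‖ :=
      continuous_norm.continuousAt.eventually (gt_mem_nhds (by linarith))
    have e2 : ∀ᶠ z in 𝓝 y, ‖y‖ / 2 < ‖z‖ :=
      continuous_norm.continuousAt.eventually (lt_mem_nhds (by linarith))
    filter_upwards [e1, e2] with z hz1 hz2
    simp only [c, c1, c2]
    rw [hχe1, hχe0, sub_zero]
    · rw [hnorm2]
      rw [div_lt_iff₀ hy0] at h6
      nlinarith [hs0 n]
    · rw [hnorm1, div_le_one (hs0 n)]; linarith
  have hae : ∀ᵐ y : E3, y ≠ 0 := by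
    simp [ae_iff, measure_singleton]
  let φ : ℕ → E3 → ℝ := fun n y => Φ y * c n y
  have hφ : ∀ n, ContDiff ℝ 2 (φ n) := fun n => hΦ.mul (hc n)
  have hφs : ∀ n, HasCompactSupport (φ n) := fun n => (hc_supp n).mul_left
  have hφt : ∀ n, tsupport (φ n) ⊆ {0}ᶜ := fun n y hy h0 => by
    rw [mem_singleton_iff] at h0
    subst h0
    refine (notMem_tsupport_iff_eventuallyEq.2 ?_) hy
    have : ∀ᶠ z : E3 in 𝓝 0, ‖z‖ < (s n)⁻¹ :=
      continuous_norm.continuousAt.eventually (gt_mem_nhds (by simpa using hs0 n))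
    filter_upwards [this] with z hz
    simp [φ, hc_zero n z hz.le]
  have hparts : ∀ n, ∫ y, φ n y * lap u y = ∫ y, lap (φ n) y * u y := fun n =>
    integral_mul_lap_comm isOpen_compl_singleton (hφ n) (hφs n) (hφt n) hu2
  have hlapφ : ∀ n y, lap (φ n) y = c n y * lap Φ y + Φ y * lap (c n) y
      + 2 * ∑ i : Fin 3, fderiv ℝ Φ y (EuclideanSpace.single i 1)
          * fderiv ℝ (c n) y (EuclideanSpace.single i 1) := fun n y => lap_mul hΦ (hc n) y
  have hlimR : Tendsto (fun n => ∫ y, lap (φ n) y * u y) atTop (𝓝 (∫ y, lap Φ y * u y)) := by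
    refine tendsto_integral_of_dominated_convergence
      (fun y => (|lap Φ y| + 2 * C * (Φ y * (‖y‖ ^ 2)⁻¹)
        + 12 * C * (‖fderiv ℝ Φ y‖ * ‖y‖⁻¹)) * M) (fun n => ?_) ?_ (fun n => ?_) ?_
    · exact ((continuous_lap (hφ n)).mul hu).aestronglyMeasurable
    · exact ((h3.abs.add (h1.const_mul _)).add (h2.const_mul _)).mul_const _
    · filter_upwards [hae] with y hy
      have hy0 : 0 < ‖y‖ := norm_pos_iff.2 hy
      rw [norm_mul]
      refine mul_le_mul ?_ (hM y) (norm_nonneg _) (by have := hΦ0 y; positivity)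
      rw [hlapφ n y]
      have b1 : |lap (c n) y| ≤ 2 * C * (‖y‖ ^ 2)⁻¹ := by
        rw [lap_sub (hc1 n) (hc2 n), ← div_eq_mul_inv, le_div_iff₀ (by positivity)]
        have p1 := hCl (s n)⁻¹ y
        have p2 := hCl (s n) y
        have p3 := abs_sub (lap (c1 n) y) (lap (c2 n) y)
        nlinarith [sq_nonneg ‖y‖]
      have b2 : ‖fderiv ℝ (c n) y‖ ≤ 2 * C * ‖y‖⁻¹ := by
        have hfs : fderiv ℝ (c n) y = fderiv ℝ (c1 n) y - fderiv ℝ (c2 n) y :=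
          fderiv_fun_sub ((hc1 n).differentiable (by norm_num) y)
            ((hc2 n).differentiable (by norm_num) y)
        rw [hfs, ← div_eq_mul_inv, le_div_iff₀ (by positivity)]
        have p1 := hCd (s n)⁻¹ y
        have p2 := hCd (s n) y
        have p3 := norm_sub_le (fderiv ℝ (c1 n) y) (fderiv ℝ (c2 n) y)
        nlinarith
      have b3 : ∀ i : Fin 3, |fderiv ℝ Φ y (EuclideanSpace.single i 1)
          * fderiv ℝ (c n) y (EuclideanSpace.single i 1)|
          ≤ ‖fderiv ℝ Φ y‖ * (2 * C * ‖y‖⁻¹) := by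
        intro i
        rw [abs_mul]
        have hle : ∀ l : E3 →L[ℝ] ℝ, |l (EuclideanSpace.single i 1)| ≤ ‖l‖ := fun l => by
          simpa using l.le_opNorm (EuclideanSpace.single i 1)
        exact mul_le_mul (hle _) ((hle _).trans b2) (abs_nonneg _) (norm_nonneg _)
      have b4 : |∑ i : Fin 3, fderiv ℝ Φ y (EuclideanSpace.single i 1)
          * fderiv ℝ (c n) y (EuclideanSpace.single i 1)|
          ≤ 3 * (‖fderiv ℝ Φ y‖ * (2 * C * ‖y‖⁻¹)) := by
        refine (Finset.abs_sum_le_sum_abs _ _).trans ((Finset.sum_le_sum fun i _ => b3 i).trans ?_)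
        simp
      have b5 : |c n y * lap Φ y| ≤ |lap Φ y| := by
        rw [abs_mul, abs_of_nonneg (hc_nonneg n y)]
        nlinarith [hc_one n y, abs_nonneg (lap Φ y)]
      have b6 : |Φ y * lap (c n) y| ≤ Φ y * (2 * C * (‖y‖ ^ 2)⁻¹) := by
        rw [abs_mul, abs_of_nonneg (hΦ0 y)]
        exact mul_le_mul_of_nonneg_left b1 (hΦ0 y)
      rw [Real.norm_eq_abs]
      refine (abs_add_le _ _).trans ?_
      have b7 := abs_add_le (c n y * lap Φ y) (Φ y * lap (c n) y)
      rw [abs_mul, abs_of_nonneg (by norm_num : (0 : ℝ) ≤ 2)]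
      nlinarith
    · filter_upwards [hae] with y hy
      refine tendsto_const_nhds.congr' ?_
      filter_upwards [hev y hy] with n hn
      rw [hlapφ n y, lap_congr hn, hn.fderiv_eq, lap_const, hn.eq_of_nhds]
      simp
  have hIφ : ∀ n, Integrable (fun y => φ n y * -lap u y) := fun n => by
    refine integrable_mul_of_tsupport_subset isOpen_compl_singleton (hφ n).continuous (hφs n)
      (hφt n) ?_
    intro y hy
    have hcd : ContDiffAt ℝ 2 u y := hu2.contDiffAt (isOpen_compl_singleton.mem_nhds hy)
    refine ContinuousAt.continuousWithinAt ?_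
    have : ContinuousAt (iteratedFDeriv ℝ 2 u) y :=
      hcd.continuousAt_iteratedFDeriv (k := 2) le_rfl
    unfold lap
    refine ContinuousAt.neg (tendsto_finsetSum _ fun i _ => ?_)
    exact this.eval_const _
  have key := integrable_and_integral_eq_of_tendsto (μ := volume)
    (G := fun n y => φ n y * -lap u y) (F := fun y => Φ y * -lap u y)
    (L := ∫ y, -lap Φ y * u y) hIφ
    (fun n => by
      filter_upwards [hae] with y hy
      exact mul_nonneg (mul_nonneg (hΦ0 y) (hc_nonneg n y)) (hf y hy))
    (fun n => by
      filter_upwards [hae] with y hy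
      refine mul_le_mul_of_nonneg_right ?_ (hf y hy)
      exact mul_le_of_le_one_right (hΦ0 y) (hc_one n y))
    (by
      filter_upwards [hae] with y hy
      refine tendsto_const_nhds.congr' ?_
      filter_upwards [hev y hy] with n hn
      simp [φ, hn.eq_of_nhds])
    (by
      simp only [mul_neg, neg_mul, integral_neg, hparts]
      exact hlimR.neg)
  exact key

/-! ### The regularised Newtonian kernel -/

/-- The regularised Newtonian kernel `(|y - x|² + e)^(-1/2)`. -/
noncomputable def regKer (e : ℝ) (x y : E3) : ℝ := (‖y - x‖ ^ 2 + e) ^ (-1 / 2 : ℝ)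

/-- The profile `3 (1 + |z|²)^(-5/2)` of minus the Laplacian of the regularised kernel. -/
noncomputable def bump (z : E3) : ℝ := 3 * (1 + ‖z‖ ^ 2) ^ (-5 / 2 : ℝ)

lemma contDiff_regKer {e : ℝ} (he : 0 < e) (x : E3) : ContDiff ℝ 2 (regKer e x) := by
  refine ContDiff.rpow_const_of_ne ?_ fun y => by positivity
  exact ((contDiff_id.sub contDiff_const).norm_sq ℝ).add contDiff_const

lemma hasDerivAt_add_rpow {e s : ℝ} (r : ℝ) (h : 0 < s + e) :
    HasDerivAt (fun s => (s + e) ^ r) (r * (s + e) ^ (r - 1)) s := by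
  simpa using ((hasDerivAt_id s).add_const e).rpow_const (p := r) (Or.inl h.ne')

lemma lap_regKer {e : ℝ} (he : 0 < e) (x y : E3) :
    lap (regKer e x) y = -(3 * e * (‖y - x‖ ^ 2 + e) ^ (-5 / 2 : ℝ)) := by
  have hpos : 0 < ‖y - x‖ ^ 2 + e := by positivity
  have h1 : ∀ᶠ s in 𝓝 (‖y - x‖ ^ 2), HasDerivAt (fun s => (s + e) ^ (-1 / 2 : ℝ))
      ((fun s => (-1 / 2 : ℝ) * (s + e) ^ (-1 / 2 - 1 : ℝ)) s) s := by
    have : ∀ᶠ s in 𝓝 (‖y - x‖ ^ 2), 0 < s + e :=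
      (continuous_id.add continuous_const).continuousAt.eventually (lt_mem_nhds hpos)
    filter_upwards [this] with s hs using hasDerivAt_add_rpow _ hs
  have h2 := (hasDerivAt_add_rpow (-1 / 2 - 1 : ℝ) hpos).const_mul (-1 / 2 : ℝ)
  have := lap_radial h1 h2
  have e1 : (‖y - x‖ ^ 2 + e) ^ (-1 / 2 - 1 : ℝ)
      = (‖y - x‖ ^ 2 + e) * (‖y - x‖ ^ 2 + e) ^ (-5 / 2 : ℝ) := by
    rw [← Real.rpow_one_add' hpos.le (by norm_num)]; norm_num
  have e2 : (-1 / 2 - 1 - 1 : ℝ) = -5 / 2 := by norm_num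
  change lap (fun y => (‖y - x‖ ^ 2 + e) ^ (-1 / 2 : ℝ)) y = _
  rw [this, e2]
  simp only [e1]
  ring

lemma norm_fderiv_sub_regKer {e r : ℝ} (he : 0 < e) (her : e ≤ r) (x y : E3) :
    ‖fderiv ℝ (fun y => regKer e x y - regKer r x y) y‖
      ≤ 2 * (r - e) * (‖y - x‖ ^ 2 + e) ^ (-2 : ℝ) := by
  set A := ‖y - x‖ ^ 2 + e with hA
  set B := ‖y - x‖ ^ 2 + r with hB
  have hA0 : 0 < A := by positivity
  have hAB : A ≤ B := by linarith
  have hB0 : 0 < B := hA0.trans_le hAB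
  have hn : HasFDerivAt (fun y : E3 => ‖y - x‖ ^ 2)
      (2 • (innerSL ℝ (y - x)).comp (ContinuousLinearMap.id ℝ E3)) y :=
    ((hasFDerivAt_id y).sub_const x).norm_sq
  have d : ∀ t : ℝ, 0 < ‖y - x‖ ^ 2 + t → HasFDerivAt (regKer t x)
      (((-1 / 2 : ℝ) * (‖y - x‖ ^ 2 + t) ^ (-1 / 2 - 1 : ℝ)) •
        (2 • (innerSL ℝ (y - x)).comp (ContinuousLinearMap.id ℝ E3))) y := fun t ht =>
    HasDerivAt.comp_hasFDerivAt y (hasDerivAt_add_rpow (-1 / 2 : ℝ) ht) hn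
  have hd := (d e hA0).sub (d r hB0)
  have hfd : fderiv ℝ (fun y => regKer e x y - regKer r x y) y = _ := hd.fderiv
  rw [hfd, ← sub_smul, norm_smul]
  have hin : ‖2 • (innerSL ℝ (y - x)).comp (ContinuousLinearMap.id ℝ E3)‖ = 2 * ‖y - x‖ := by
    rw [ContinuousLinearMap.comp_id, ← Nat.cast_smul_eq_nsmul ℝ, norm_smul, innerSL_apply_norm]
    simp
  rw [hin, ← hA, ← hB]
  have hs : ‖y - x‖ ≤ A ^ (1 / 2 : ℝ) := by
    rw [← Real.sqrt_eq_rpow]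
    refine Real.le_sqrt_of_sq_le (by linarith)
  set α := A ^ (1 / 2 : ℝ) with hα
  set β := B ^ (1 / 2 : ℝ) with hβ
  have hα0 : 0 < α := by positivity
  have hαβ : α ≤ β := Real.rpow_le_rpow hA0.le hAB (by norm_num)
  have hβ0 : 0 < β := hα0.trans_le hαβ
  have hα2 : α ^ 2 = A := by rw [hα, ← Real.sqrt_eq_rpow, Real.sq_sqrt hA0.le]
  have hβ2 : β ^ 2 = B := by rw [hβ, ← Real.sqrt_eq_rpow, Real.sq_sqrt hB0.le]
  have pw : ∀ {T τ : ℝ}, 0 < T → τ = T ^ (1 / 2 : ℝ) → ∀ k : ℕ, T ^ (-(k : ℝ) / 2) = (τ ^ k)⁻¹ := by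
    intro T τ hT hτ k
    rw [hτ, ← Real.rpow_natCast, ← Real.rpow_mul hT.le, ← Real.rpow_neg hT.le]
    congr 1; ring
  have pA3 : A ^ (-1 / 2 - 1 : ℝ) = (α ^ 3)⁻¹ := by rw [← pw hA0 hα 3]; norm_num
  have pB3 : B ^ (-1 / 2 - 1 : ℝ) = (β ^ 3)⁻¹ := by rw [← pw hB0 hβ 3]; norm_num
  have pA4 : A ^ (-2 : ℝ) = (α ^ 4)⁻¹ := by rw [← pw hA0 hα 4]; norm_num
  rw [pA3, pB3, pA4]
  have hre : r - e = β ^ 2 - α ^ 2 := by rw [hα2, hβ2]; ring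
  have hi : (β ^ 3)⁻¹ ≤ (α ^ 3)⁻¹ := by gcongr
  have e1 : ‖(-1 / 2 : ℝ) * (α ^ 3)⁻¹ - -1 / 2 * (β ^ 3)⁻¹‖ = ((α ^ 3)⁻¹ - (β ^ 3)⁻¹) / 2 := by
    rw [Real.norm_eq_abs, abs_of_nonpos] <;> linarith
  rw [e1, hre]
  have key : (α ^ 3)⁻¹ - (β ^ 3)⁻¹ ≤ 2 * (β ^ 2 - α ^ 2) * (α ^ 5)⁻¹ := by
    have : (α ^ 3)⁻¹ - (β ^ 3)⁻¹ = (β - α) * ((α ^ 2 + α * β + β ^ 2) * (α ^ 2)) * (α ^ 5 * β ^ 3)⁻¹ := by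
      field_simp; ring
    rw [this]
    have h2 : 2 * (β ^ 2 - α ^ 2) * (α ^ 5)⁻¹ = (β - α) * (2 * (β + α) * β ^ 3) * (α ^ 5 * β ^ 3)⁻¹ := by
      field_simp; ring
    rw [h2]
    have h3 : (α ^ 2 + α * β + β ^ 2) * α ^ 2 ≤ 2 * (β + α) * β ^ 3 := by
      have : α ^ 2 ≤ β ^ 2 := by gcongr
      calc (α ^ 2 + α * β + β ^ 2) * α ^ 2 ≤ (2 * (β + α) * β) * β ^ 2 := by
            gcongr ?_ * ?_
            nlinarith
        _ = _ := by ring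
    have h4 : 0 ≤ β - α := by linarith
    gcongr
  calc ((α ^ 3)⁻¹ - (β ^ 3)⁻¹) / 2 * (2 * ‖y - x‖) ≤ (2 * (β ^ 2 - α ^ 2) * (α ^ 5)⁻¹) / 2 * (2 * α) := by
        have h0 : 0 ≤ (α ^ 3)⁻¹ - (β ^ 3)⁻¹ := by linarith
        have h5 := h0.trans key
        gcongr
    _ = 2 * (β ^ 2 - α ^ 2) * (α ^ 4)⁻¹ := by field_simp

lemma regKer_sub_nonneg {e r : ℝ} (he : 0 < e) (her : e ≤ r) (x y : E3) :
    0 ≤ regKer e x y - regKer r x y := by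
  rw [sub_nonneg]
  exact Real.rpow_le_rpow_of_nonpos (by positivity) (by linarith) (by norm_num)

lemma regKer_sub_le {e r : ℝ} (he : 0 < e) (her : e ≤ r) (x y : E3) :
    regKer e x y - regKer r x y ≤ (r - e) * (‖y - x‖ ^ 2 + e) ^ (-3 / 2 : ℝ) := by
  unfold regKer
  set A := ‖y - x‖ ^ 2 + e with hA
  set B := ‖y - x‖ ^ 2 + r with hB
  have hA0 : 0 < A := by positivity
  have hAB : A ≤ B := by linarith
  have hB0 : 0 < B := hA0.trans_le hAB
  set α := A ^ (1 / 2 : ℝ) with hα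
  set β := B ^ (1 / 2 : ℝ) with hβ
  have hα0 : 0 < α := by positivity
  have hαβ : α ≤ β := Real.rpow_le_rpow hA0.le hAB (by norm_num)
  have hβ0 : 0 < β := hα0.trans_le hαβ
  have hα2 : α ^ 2 = A := by rw [hα, ← Real.sqrt_eq_rpow, Real.sq_sqrt hA0.le]
  have hβ2 : β ^ 2 = B := by rw [hβ, ← Real.sqrt_eq_rpow, Real.sq_sqrt hB0.le]
  have pw : ∀ {T τ : ℝ}, 0 < T → τ = T ^ (1 / 2 : ℝ) → ∀ k : ℕ, T ^ (-(k : ℝ) / 2) = (τ ^ k)⁻¹ := by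
    intro T τ hT hτ k
    rw [hτ, ← Real.rpow_natCast, ← Real.rpow_mul hT.le, ← Real.rpow_neg hT.le]
    congr 1; ring
  have pA1 : A ^ (-1 / 2 : ℝ) = α⁻¹ := by have := pw hA0 hα 1; norm_num at this ⊢; exact this
  have pB1 : B ^ (-1 / 2 : ℝ) = β⁻¹ := by have := pw hB0 hβ 1; norm_num at this ⊢; exact this
  have pA3 : A ^ (-3 / 2 : ℝ) = (α ^ 3)⁻¹ := by rw [← pw hA0 hα 3]; norm_num
  have hre : r - e = β ^ 2 - α ^ 2 := by rw [hα2, hβ2]; ring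
  rw [pA1, pB1, pA3, hre]
  have h1 : α⁻¹ - β⁻¹ = (β - α) * α ^ 2 * (α ^ 3 * β)⁻¹ := by field_simp
  have h2 : (β ^ 2 - α ^ 2) * (α ^ 3)⁻¹ = (β - α) * ((β + α) * β) * (α ^ 3 * β)⁻¹ := by
    field_simp; ring
  rw [h1, h2]
  have h4 : 0 ≤ β - α := by linarith
  gcongr
  nlinarith

/-! ### Integrability of the weights -/

lemma bump_pos (z : E3) : 0 < bump z := by unfold bump; positivity

lemma continuous_bump : Continuous bump := by
  unfold bump
  refine continuous_const.mul (Continuous.rpow_const (by fun_prop) fun z => Or.inl (by positivity))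

lemma integrable_bump : Integrable bump := by
  have := integrable_rpow_neg_one_add_norm_sq (E := E3) (μ := volume) (r := 5) (by simp; norm_num)
  exact this.const_mul 3

lemma integrable_one_add_sq_rpow :
    IntegrableOn (fun r : ℝ => (1 + r ^ 2) ^ (-3 / 2 : ℝ)) (Ioi 0) := by
  have := integrable_rpow_neg_one_add_norm_sq (E := ℝ) (μ := volume) (r := 3) (by simp)
  simpa using this.integrableOn (s := Ioi 0)

lemma integrable_weight_two :
    Integrable (fun y : E3 => (1 + ‖y‖ ^ 2) ^ (-3 / 2 : ℝ) * (‖y‖ ^ 2)⁻¹) := by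
  rw [integrable_fun_norm_addHaar volume (f := fun r => (1 + r ^ 2) ^ (-3 / 2 : ℝ) * (r ^ 2)⁻¹)]
  refine integrable_one_add_sq_rpow.congr_fun (fun r hr => ?_) measurableSet_Ioi
  have : r ≠ 0 := (mem_Ioi.1 hr).ne'
  simp
  field_simp

lemma integrable_weight_one :
    Integrable (fun y : E3 => (1 + ‖y‖ ^ 2) ^ (-2 : ℝ) * ‖y‖⁻¹) := by
  rw [integrable_fun_norm_addHaar volume (f := fun r => (1 + r ^ 2) ^ (-2 : ℝ) * r⁻¹)]
  refine Integrable.mono' integrable_one_add_sq_rpow ?_ ?_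
  · refine Measurable.aestronglyMeasurable ?_
    fun_prop
  · filter_upwards [ae_restrict_mem measurableSet_Ioi] with r hr
    have hr0 : 0 < r := hr
    have e1 : r ^ (Module.finrank ℝ E3 - 1) • ((1 + r ^ 2) ^ (-2 : ℝ) * r⁻¹)
        = r * (1 + r ^ 2) ^ (-2 : ℝ) := by
      simp; field_simp
    rw [e1, Real.norm_of_nonneg (by positivity)]
    have e2 : (1 + r ^ 2) ^ (-3 / 2 : ℝ) = (1 + r ^ 2) ^ (1 / 2 : ℝ) * (1 + r ^ 2) ^ (-2 : ℝ) := by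
      rw [← Real.rpow_add (by positivity)]; norm_num
    rw [e2]
    gcongr
    rw [← Real.sqrt_eq_rpow]
    exact Real.le_sqrt_of_sq_le (by linarith)

lemma exists_mul_one_add_le {e : ℝ} (he : 0 < e) (x : E3) :
    ∃ c, 0 < c ∧ ∀ y : E3, c * (1 + ‖y‖ ^ 2) ≤ ‖y - x‖ ^ 2 + e := by
  set K := max 2 ((1 + 2 * ‖x‖ ^ 2) / e) with hK
  have hK0 : 0 < K := by positivity
  refine ⟨K⁻¹, by positivity, fun y => ?_⟩
  rw [inv_mul_le_iff₀ hK0]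
  have h1 : ‖y‖ ≤ ‖y - x‖ + ‖x‖ := by simpa using norm_add_le (y - x) x
  have h2 : ‖y‖ ^ 2 ≤ 2 * ‖y - x‖ ^ 2 + 2 * ‖x‖ ^ 2 := by
    nlinarith [sq_nonneg (‖y - x‖ - ‖x‖), norm_nonneg y]
  have h3 : 1 + 2 * ‖x‖ ^ 2 ≤ K * e := by
    rw [← div_le_iff₀ he]; exact le_max_right _ _
  have h4 : 2 ≤ K := le_max_left _ _
  nlinarith [sq_nonneg ‖y - x‖]

lemma regKer_rpow_le {e c k : ℝ} (hc : 0 < c) {x y : E3} (hk : k ≤ 0)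
    (h : c * (1 + ‖y‖ ^ 2) ≤ ‖y - x‖ ^ 2 + e) :
    (‖y - x‖ ^ 2 + e) ^ k ≤ c ^ k * (1 + ‖y‖ ^ 2) ^ k := by
  rw [← Real.mul_rpow hc.le (by positivity)]
  exact Real.rpow_le_rpow_of_nonpos (by positivity) h hk

lemma neg_lap_regKer {n : ℝ} (hn : 0 < n) (x y : E3) :
    -lap (regKer (n ^ 2) x) y = (n ^ 3)⁻¹ * bump (n⁻¹ • (y - x)) := by
  rw [lap_regKer (by positivity), bump, norm_smul, Real.norm_of_nonneg (by positivity)]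
  have : ‖y - x‖ ^ 2 + n ^ 2 = n ^ 2 * (1 + (n⁻¹ * ‖y - x‖) ^ 2) := by field_simp; ring
  rw [this, Real.mul_rpow (by positivity) (by positivity)]
  have h2 : (n ^ 2) ^ (-5 / 2 : ℝ) = (n ^ 5)⁻¹ := by
    rw [← Real.rpow_natCast, ← Real.rpow_natCast, ← Real.rpow_mul hn.le, ← Real.rpow_neg hn.le]
    norm_num
  rw [h2]
  field_simp

lemma integrable_lap_regKer {n : ℝ} (hn : 0 < n) (x : E3) :
    Integrable (lap (regKer (n ^ 2) x)) := by
  have h1 : Integrable (fun y : E3 => (n ^ 3)⁻¹ * bump (n⁻¹ • (y - x))) := by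
    refine Integrable.const_mul ?_ _
    have := (integrable_comp_smul_iff (μ := volume) bump (inv_ne_zero hn.ne')).2 integrable_bump
    exact this.comp_sub_right x
  refine (h1.neg).congr (Eventually.of_forall fun y => ?_)
  simp only [Pi.neg_apply]
  rw [← neg_lap_regKer hn, neg_neg]

/-- Averages of `u` against the rescaled bump. -/
noncomputable def avg (u : E3 → ℝ) (n : ℝ) (x : E3) : ℝ := ∫ z, bump z * u (x + n • z)

lemma integral_neg_lap_regKer_mul {u : E3 → ℝ} {n : ℝ} (hn : 0 < n) (x : E3) :
    ∫ y, -lap (regKer (n ^ 2) x) y * u y = avg u n x := by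
  have h1 : ∀ y, -lap (regKer (n ^ 2) x) y * u y
      = (fun w : E3 => (fun z => (n ^ 3)⁻¹ * (bump z * u (x + n • z))) (n⁻¹ • w)) (y - x) := by
    intro y
    simp only [neg_lap_regKer hn, smul_smul, mul_inv_cancel₀ hn.ne', one_smul]
    rw [add_sub_cancel]; ring
  simp_rw [h1]
  rw [integral_sub_right_eq_self (fun w : E3 =>
    (fun z => (n ^ 3)⁻¹ * (bump z * u (x + n • z))) (n⁻¹ • w)) x,
    Measure.integral_comp_inv_smul volume (fun z => (n ^ 3)⁻¹ * (bump z * u (x + n • z))) n,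
    integral_const_mul]
  simp only [finrank_euclideanSpace, Fintype.card_fin, smul_eq_mul, avg]
  rw [abs_of_pos (by positivity), ← mul_assoc, mul_inv_cancel₀ (by positivity), one_mul]

/-! ### The integral representation -/

/-- The mass of the bump function. -/
noncomputable def bumpMass : ℝ := ∫ z, bump z

lemma bumpMass_pos : 0 < bumpMass := by
  refine (integral_pos_iff_support_of_nonneg (fun z => (bump_pos z).le) integrable_bump).2 ?_
  have : Function.support bump = univ := by
    ext z; simpa using (bump_pos z).ne'
  rw [this]; simp

lemma integral_mul_neg_lap_regKer {u : E3 → ℝ} {M : ℝ} (hu : Continuous u) (hM : ∀ x, |u x| ≤ M)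
    (hu2 : ContDiffOn ℝ 2 u {0}ᶜ) (hf : ∀ x ≠ 0, 0 ≤ -lap u x) (x : E3) {m n : ℝ} (hm : 0 < m)
    (hmn : m ≤ n) :
    Integrable (fun y => (regKer (m ^ 2) x y - regKer (n ^ 2) x y) * -lap u y) ∧
      ∫ y, (regKer (m ^ 2) x y - regKer (n ^ 2) x y) * -lap u y = avg u m x - avg u n x := by
  have hn : 0 < n := hm.trans_le hmn
  have he : 0 < m ^ 2 := by positivity
  have hr : 0 < n ^ 2 := by positivity
  have her : m ^ 2 ≤ n ^ 2 := by gcongr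
  obtain ⟨c, hc, hcy⟩ := exists_mul_one_add_le he x
  have hC : ContDiff ℝ 2 (fun y => regKer (m ^ 2) x y - regKer (n ^ 2) x y) :=
    (contDiff_regKer he x).sub (contDiff_regKer hr x)
  have hlap : ∀ y, lap (fun y => regKer (m ^ 2) x y - regKer (n ^ 2) x y) y
      = lap (regKer (m ^ 2) x) y - lap (regKer (n ^ 2) x) y := fun y =>
    lap_sub (contDiff_regKer he x) (contDiff_regKer hr x) y
  have hre : 0 ≤ n ^ 2 - m ^ 2 := by linarith
  have key := integral_mul_neg_lap hu hM hu2 hf hC (fun y => regKer_sub_nonneg he her x y)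
    (by
      refine (integrable_weight_two.const_mul ((n ^ 2 - m ^ 2) * c ^ (-3 / 2 : ℝ))).mono'
        ?_ (Eventually.of_forall fun y => ?_)
      · exact (hC.continuous.measurable.mul (by fun_prop)).aestronglyMeasurable
      · have h0 := regKer_sub_nonneg he her x y
        rw [Real.norm_of_nonneg (by positivity), ← mul_assoc]
        gcongr
        refine (regKer_sub_le he her x y).trans ?_
        rw [mul_assoc]
        gcongr
        exact regKer_rpow_le hc (by norm_num) (hcy y))
    (by
      refine (integrable_weight_one.const_mul (2 * (n ^ 2 - m ^ 2) * c ^ (-2 : ℝ))).mono'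
        ?_ (Eventually.of_forall fun y => ?_)
      · exact ((hC.continuous_fderiv (by norm_num)).norm.measurable.mul
          (by fun_prop)).aestronglyMeasurable
      · rw [Real.norm_of_nonneg (by positivity), ← mul_assoc]
        gcongr
        refine (norm_fderiv_sub_regKer he her x y).trans ?_
        rw [mul_assoc _ (c ^ _)]
        gcongr
        exact regKer_rpow_le hc (by norm_num) (hcy y))
    (by
      refine ((integrable_lap_regKer hm x).sub (integrable_lap_regKer hn x)).congr
        (Eventually.of_forall fun y => ?_)
      simp [hlap])
  refine ⟨key.1, ?_⟩
  have hintg : ∀ {k : ℝ}, 0 < k → Integrable (fun y => -lap (regKer (k ^ 2) x) y * u y) := by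
    intro k hk
    have := (integrable_lap_regKer hk x).neg.bdd_mul (f := u) (c := M) hu.aestronglyMeasurable
      (Eventually.of_forall fun y => by simpa using hM y)
    refine this.congr (Eventually.of_forall fun y => ?_)
    simp [mul_comm]
  rw [key.2, ← integral_neg_lap_regKer_mul hm, ← integral_neg_lap_regKer_mul hn,
    ← integral_sub (hintg hm) (hintg hn)]
  refine integral_congr_ae (Eventually.of_forall fun y => ?_)
  simp only [hlap]; ring

lemma tendsto_avg_inv {u : E3 → ℝ} {M : ℝ} (hu : Continuous u) (hM : ∀ x, |u x| ≤ M) (x : E3) :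
    Tendsto (fun n : ℕ => avg u ((n : ℝ) + 1)⁻¹ x) atTop (𝓝 (bumpMass * u x)) := by
  have : bumpMass * u x = ∫ z, bump z * u x := by rw [integral_mul_const]; rfl
  rw [this]
  refine tendsto_integral_of_dominated_convergence (fun z => bump z * M) (fun n => ?_)
    (integrable_bump.mul_const _) (fun n => Eventually.of_forall fun z => ?_)
    (Eventually.of_forall fun z => ?_)
  · exact (continuous_bump.mul (by fun_prop)).aestronglyMeasurable
  · rw [norm_mul, Real.norm_of_nonneg (bump_pos z).le]
    exact mul_le_mul_of_nonneg_left (hM _) (bump_pos z).le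
  · refine Tendsto.const_mul _ ?_
    have h1 : Tendsto (fun n : ℕ => ((n : ℝ) + 1)⁻¹) atTop (𝓝 0) := by
      simpa using tendsto_one_div_add_atTop_nhds_zero_nat (𝕜 := ℝ)
    have h2 : Tendsto (fun n : ℕ => x + ((n : ℝ) + 1)⁻¹ • z) atTop (𝓝 (x + (0 : ℝ) • z)) :=
      tendsto_const_nhds.add (h1.smul_const z)
    rw [zero_smul, add_zero] at h2
    exact (hu.tendsto x).comp h2

lemma bump_sub_le {z w : E3} (hw : ‖w‖ ≤ 1) : bump (z - w) ≤ 3 ^ (5 / 2 : ℝ) * bump z := by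
  unfold bump
  have h1 : ‖z‖ ≤ ‖z - w‖ + 1 := by
    have := norm_add_le (z - w) w
    simp only [sub_add_cancel] at this
    linarith
  have h2 : (1 / 3) * (1 + ‖z‖ ^ 2) ≤ 1 + ‖z - w‖ ^ 2 := by
    nlinarith [sq_nonneg (‖z - w‖ - 1), norm_nonneg z, norm_nonneg (z - w)]
  have h3 := Real.rpow_le_rpow_of_nonpos (by positivity) h2 (by norm_num : (-5 / 2 : ℝ) ≤ 0)
  rw [Real.mul_rpow (by norm_num) (by positivity)] at h3
  have h4 : (1 / 3 : ℝ) ^ (-5 / 2 : ℝ) = 3 ^ (5 / 2 : ℝ) := by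
    rw [one_div, Real.inv_rpow (by norm_num), ← Real.rpow_neg (by norm_num)]; norm_num
  rw [h4] at h3
  linarith

lemma tendsto_avg_sub {u : E3 → ℝ} {M : ℝ} (hu : Continuous u) (hM : ∀ x, |u x| ≤ M) (x : E3) :
    Tendsto (fun n : ℕ => avg u ((n : ℝ) + 1) x - avg u ((n : ℝ) + 1) 0) atTop (𝓝 0) := by
  have hM0 : 0 ≤ M := (abs_nonneg _).trans (hM 0)
  let w : ℕ → E3 := fun n => ((n : ℝ) + 1)⁻¹ • x
  have hw : Tendsto w atTop (𝓝 0) := by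
    have h1 : Tendsto (fun n : ℕ => ((n : ℝ) + 1)⁻¹) atTop (𝓝 0) := by
      simpa using tendsto_one_div_add_atTop_nhds_zero_nat (𝕜 := ℝ)
    simpa using h1.smul_const x
  have hw1 : ∀ᶠ n in atTop, ‖w n‖ ≤ 1 :=
    (hw.norm.eventually (ge_mem_nhds (by simp : ‖(0 : E3)‖ < 1)))
  have hb : ∀ {φ : E3 → ℝ}, Integrable φ → ∀ n : ℕ,
      Integrable (fun z => φ z * u (((n : ℝ) + 1) • z)) := by
    intro φ hφ n
    have := hφ.mul_bdd (g := fun z => u (((n : ℝ) + 1) • z)) (c := M)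
      (by fun_prop) (Eventually.of_forall fun y => by simpa using hM _)
    exact this
  have heq : ∀ n : ℕ, avg u ((n : ℝ) + 1) x - avg u ((n : ℝ) + 1) 0
      = ∫ z, (bump (z - w n) - bump z) * u (((n : ℝ) + 1) • z) := by
    intro n
    have hn : (n : ℝ) + 1 ≠ 0 := by positivity
    have e1 : avg u ((n : ℝ) + 1) x = ∫ z, bump (z - w n) * u (((n : ℝ) + 1) • z) := by
      rw [← integral_add_right_eq_self (fun z => bump (z - w n) * u (((n : ℝ) + 1) • z)) (w n)]
      unfold avg
      refine integral_congr_ae (Eventually.of_forall fun z => ?_)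
      simp only [w, add_sub_cancel_right, smul_add, smul_smul, mul_inv_cancel₀ hn, one_smul]
      rw [add_comm x]
    have e2 : avg u ((n : ℝ) + 1) 0 = ∫ z, bump z * u (((n : ℝ) + 1) • z) := by simp [avg]
    rw [e1, e2, ← integral_sub (hb (integrable_bump.comp_sub_right _) n) (hb integrable_bump n)]
    simp only [sub_mul]
  simp_rw [heq]
  have h0 : (0 : ℝ) = ∫ z : E3, 0 := by simp
  rw [h0]
  refine tendsto_integral_filter_of_dominated_convergence
    (fun z => ((3 : ℝ) ^ (5 / 2 : ℝ) + 1) * M * bump z) (Eventually.of_forall fun n => ?_) ?_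
    (integrable_bump.const_mul _) (Eventually.of_forall fun z => ?_)
  · exact (hb ((integrable_bump.comp_sub_right _).sub integrable_bump) n).1
  · filter_upwards [hw1] with n hn
    refine Eventually.of_forall fun z => ?_
    rw [norm_mul]
    have h1 := bump_sub_le (z := z) hn
    have h2 := bump_pos z
    have h3 := bump_pos (z - w n)
    have h4 : ‖bump (z - w n) - bump z‖ ≤ ((3 : ℝ) ^ (5 / 2 : ℝ) + 1) * bump z := by
      rw [Real.norm_eq_abs, abs_le]; constructor <;> nlinarith [Real.rpow_pos_of_pos (by norm_num : (0:ℝ) < 3) (5/2)]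
    calc _ ≤ (((3 : ℝ) ^ (5 / 2 : ℝ) + 1) * bump z) * M := by
          gcongr; exact hM _
      _ = _ := by ring
  · have h1 : Tendsto (fun n => bump (z - w n) - bump z) atTop (𝓝 0) := by
      have : Tendsto (fun n => z - w n) atTop (𝓝 z) := by
        simpa using (tendsto_const_nhds (x := z)).sub hw
      simpa using ((continuous_bump.tendsto z).comp this).sub_const (bump z)
    refine squeeze_zero_norm (a := fun n => |bump (z - w n) - bump z| * M) (fun n => ?_) ?_
    · rw [norm_mul]
      exact mul_le_mul_of_nonneg_left (hM _) (abs_nonneg _)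
    · simpa using h1.abs.mul_const M

lemma regKer_le_inv {e : ℝ} (he : 0 < e) {x y : E3} (h : y ≠ x) : regKer e x y ≤ ‖x - y‖⁻¹ := by
  have h0 : 0 < ‖x - y‖ := norm_pos_iff.2 (sub_ne_zero.2 h.symm)
  unfold regKer
  rw [norm_sub_rev]
  have : ‖x - y‖⁻¹ = (‖x - y‖ ^ 2) ^ (-1 / 2 : ℝ) := by
    rw [← Real.rpow_natCast, ← Real.rpow_mul h0.le, ← Real.rpow_neg_one]; norm_num
  rw [this]
  exact Real.rpow_le_rpow_of_nonpos (by positivity) (by linarith) (by norm_num)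

lemma regKer_antitone {e r : ℝ} (he : 0 < e) (her : e ≤ r) (x y : E3) :
    regKer r x y ≤ regKer e x y := by
  have := regKer_sub_nonneg he her x y
  linarith

/-- A bounded function which is superharmonic away from the origin is, up to a nonnegative
constant, the Newtonian potential of minus its Laplacian. -/
theorem exists_potential_representation {u : E3 → ℝ} {M : ℝ} (hu : Continuous u)
    (hu0 : ∀ x, 0 ≤ u x) (hM : ∀ x, u x ≤ M)
    (hu2 : ContDiffOn ℝ 2 u {0}ᶜ) (hf : ∀ x ≠ 0, 0 ≤ -lap u x) :
    ∃ c, 0 ≤ c ∧ ∀ x, Integrable (fun y => ‖x - y‖⁻¹ * -lap u y) ∧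
      bumpMass * u x = c + ∫ y, ‖x - y‖⁻¹ * -lap u y := by
  have hMa : ∀ x, |u x| ≤ M := fun x => by rw [abs_of_nonneg (hu0 x)]; exact hM x
  have hM0 : 0 ≤ M := (abs_nonneg _).trans (hMa 0)
  have hae : ∀ z : E3, ∀ᵐ y : E3, y ≠ z := by
    intro z; simp [ae_iff, measure_singleton]
  have hnpos : ∀ n : ℕ, (0 : ℝ) < (n : ℝ) + 1 := fun n => by positivity
  have hle1 : ∀ n : ℕ, ((n : ℝ) + 1)⁻¹ ≤ (n : ℝ) + 1 := fun n => by
    have h1 : (1 : ℝ) ≤ (n : ℝ) + 1 := by linarith [Nat.cast_nonneg (α := ℝ) n]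
    exact (inv_le_one_of_one_le₀ h1).trans h1
  have havg0 : ∀ t x, 0 ≤ avg u t x := fun t x =>
    integral_nonneg fun z => mul_nonneg (bump_pos z).le (hu0 _)
  have havgM : ∀ t x, avg u t x ≤ bumpMass * M := fun t x => by
    have : bumpMass * M = ∫ z, bump z * M := by rw [integral_mul_const]; rfl
    rw [this]
    refine integral_mono_of_nonneg (Eventually.of_forall fun z =>
      mul_nonneg (bump_pos z).le (hu0 _)) (integrable_bump.mul_const _)
      (Eventually.of_forall fun z => mul_le_mul_of_nonneg_left (hM _) (bump_pos z).le)
  let Φ : ℕ → E3 → E3 → ℝ := fun n x y =>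
    regKer (((n : ℝ) + 1)⁻¹ ^ 2) x y - regKer (((n : ℝ) + 1) ^ 2) x y
  have hI : ∀ n x, Integrable (fun y => Φ n x y * -lap u y) ∧ ∫ y, Φ n x y * -lap u y
      = avg u ((n : ℝ) + 1)⁻¹ x - avg u ((n : ℝ) + 1) x := fun n x =>
    integral_mul_neg_lap_regKer hu hMa hu2 hf x (inv_pos.2 (hnpos n)) (hle1 n)
  have hmono : ∀ x y, Monotone fun n => Φ n x y := by
    intro x y m n hmn
    have hmn' : (m : ℝ) + 1 ≤ (n : ℝ) + 1 := by gcongr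
    have h1 : (((n : ℝ) + 1)⁻¹) ^ 2 ≤ (((m : ℝ) + 1)⁻¹) ^ 2 := by
      have := hnpos m
      gcongr
    have h2 : ((m : ℝ) + 1) ^ 2 ≤ ((n : ℝ) + 1) ^ 2 := by gcongr
    exact sub_le_sub (regKer_antitone (by have := hnpos n; positivity) h1 x y)
      (regKer_antitone (by have := hnpos m; positivity) h2 x y)
  have hrep : ∀ x, ∃ c, 0 ≤ c ∧ Tendsto (fun n : ℕ => avg u ((n : ℝ) + 1) x) atTop (𝓝 c) ∧
      Integrable (fun y => ‖x - y‖⁻¹ * -lap u y) ∧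
      bumpMass * u x = c + ∫ y, ‖x - y‖⁻¹ * -lap u y := by
    intro x
    have hmon : Monotone (fun n => ∫ y, Φ n x y * -lap u y) := by
      intro m n hmn
      refine integral_mono_ae (hI m x).1 (hI n x).1 ?_
      filter_upwards [hae 0] with y hy
      exact mul_le_mul_of_nonneg_right (hmono x y hmn) (hf y hy)
    have hbdd : BddAbove (range fun n => ∫ y, Φ n x y * -lap u y) := by
      refine ⟨bumpMass * M, ?_⟩
      rintro _ ⟨n, rfl⟩
      simp only [(hI n x).2]
      linarith [havg0 ((n : ℝ) + 1) x, havgM ((n : ℝ) + 1)⁻¹ x]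
    have hL := tendsto_atTop_ciSup hmon hbdd
    set L := ⨆ n, ∫ y, Φ n x y * -lap u y
    have h1 := integrable_and_integral_eq_of_tendsto (μ := volume)
      (G := fun n y => Φ n x y * -lap u y) (F := fun y => ‖x - y‖⁻¹ * -lap u y)
      (fun n => (hI n x).1)
      (fun n => by
        filter_upwards [hae 0] with y hy
        refine mul_nonneg (regKer_sub_nonneg ?_ ?_ x y) (hf y hy)
        · have := hnpos n; positivity
        · have := hle1 n; have := hnpos n; gcongr)
      (fun n => by
        filter_upwards [hae 0, hae x] with y hy hyx
        refine mul_le_mul_of_nonneg_right ?_ (hf y hy)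
        have h3 := regKer_le_inv (e := ((n : ℝ) + 1)⁻¹ ^ 2) (by have := hnpos n; positivity) hyx
        have h4 : 0 ≤ regKer (((n : ℝ) + 1) ^ 2) x y := by unfold regKer; positivity
        linarith)
      (by
        filter_upwards [hae x] with y hyx
        refine Tendsto.mul_const _ ?_
        have h0 : 0 < ‖y - x‖ := norm_pos_iff.2 (sub_ne_zero.2 hyx)
        have ht : Tendsto (fun n : ℕ => (n : ℝ) + 1) atTop atTop :=
          tendsto_atTop_add_const_right _ _ tendsto_natCast_atTop_atTop
        have hp2 : Tendsto (fun n : ℕ => ((n : ℝ) + 1) ^ 2) atTop atTop :=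
          (tendsto_pow_atTop (by norm_num)).comp ht
        have p1 : Tendsto (fun n : ℕ => regKer (((n : ℝ) + 1)⁻¹ ^ 2) x y) atTop (𝓝 ‖x - y‖⁻¹) := by
          have h5 : Tendsto (fun n : ℕ => ‖y - x‖ ^ 2 + (((n : ℝ) + 1)⁻¹ ^ 2)) atTop
              (𝓝 (‖y - x‖ ^ 2)) := by
            simpa using (ht.inv_tendsto_atTop.pow 2).const_add (‖y - x‖ ^ 2)
          have h6 := h5.rpow_const (p := (-1 / 2 : ℝ)) (Or.inl (by positivity))
          have h7 : ‖x - y‖⁻¹ = (‖y - x‖ ^ 2) ^ (-1 / 2 : ℝ) := by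
            rw [← Real.rpow_natCast, ← Real.rpow_mul h0.le, ← Real.rpow_neg_one, norm_sub_rev]
            norm_num
          rw [h7]
          exact h6
        have p2 : Tendsto (fun n : ℕ => regKer (((n : ℝ) + 1) ^ 2) x y) atTop (𝓝 0) := by
          have h5 : Tendsto (fun n : ℕ => ‖y - x‖ ^ 2 + (((n : ℝ) + 1) ^ 2)) atTop atTop :=
            tendsto_atTop_add_const_left _ _ hp2
          have h6 := (tendsto_rpow_neg_atTop (by norm_num : (0 : ℝ) < 1 / 2)).comp h5
          refine h6.congr fun n => ?_
          simp only [Function.comp, regKer]; norm_num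
        have p3 := p1.sub p2
        rwa [sub_zero] at p3)
      hL
    have hc : Tendsto (fun n : ℕ => avg u ((n : ℝ) + 1) x) atTop (𝓝 (bumpMass * u x - L)) := by
      have := (tendsto_avg_inv hu hMa x).sub hL
      refine this.congr fun n => ?_
      rw [(hI n x).2]; ring
    refine ⟨bumpMass * u x - L, ?_, hc, h1.1, ?_⟩
    · exact ge_of_tendsto' hc fun n => havg0 _ _
    · rw [h1.2]; ring
  choose c hc0 hct hintg hcr using hrep
  refine ⟨c 0, hc0 0, fun x => ⟨hintg x, ?_⟩⟩
  have : c x - c 0 = 0 :=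
    tendsto_nhds_unique ((hct x).sub (hct 0)) (tendsto_avg_sub hu hMa x)
  rw [hcr x]; linarith

/-! ### Powers of the norm on balls -/

lemma integrableOn_ball_norm_rpow {s : ℝ} (hs : -3 < s) (R : ℝ) :
    IntegrableOn (fun y : E3 => ‖y‖ ^ s) (ball 0 R) := by
  rw [integrableOn_fun_norm_addHaar volume (f := fun r => r ^ s)]
  have h1 : IntegrableOn (fun r : ℝ => r ^ (2 + s)) (Ioo 0 R) := by
    rcases le_or_gt R 0 with h | h
    · simp [Ioo_eq_empty_of_le h]
    · exact (intervalIntegral.integrableOn_Ioo_rpow_iff h).2 (by linarith)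
  refine h1.congr_fun (fun r hr => ?_) measurableSet_Ioo
  have hr0 : 0 < r := hr.1
  simp only [finrank_euclideanSpace, Fintype.card_fin, smul_eq_mul]
  rw [Real.rpow_add hr0]; norm_num

/-- The integral of `|y|^s` over the unit ball. -/
noncomputable def ballMoment (s : ℝ) : ℝ := ∫ y in ball (0 : E3) 1, ‖y‖ ^ s

lemma ballMoment_pos {s : ℝ} (hs : -3 < s) : 0 < ballMoment s := by
  unfold ballMoment
  rw [setIntegral_pos_iff_support_of_nonneg_ae (Eventually.of_forall fun y => by positivity)
    (integrableOn_ball_norm_rpow hs 1)]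
  have : ball (0 : E3) 1 \ {0} ⊆ Function.support (fun y : E3 => ‖y‖ ^ s) ∩ ball 0 1 := by
    intro y hy
    have : 0 < ‖y‖ := norm_pos_iff.2 hy.2
    exact ⟨(Real.rpow_pos_of_pos this s).ne', hy.1⟩
  refine lt_of_lt_of_le ?_ (measure_mono this)
  rw [measure_sdiff_null (measure_singleton _)]
  exact measure_ball_pos _ _ one_pos

lemma setIntegral_ball_norm_rpow (s : ℝ) {R : ℝ} (hR : 0 < R) :
    ∫ y in ball (0 : E3) R, ‖y‖ ^ s = R ^ (3 + s) * ballMoment s := by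
  have h := Measure.setIntegral_comp_smul_of_pos (volume : Measure E3) (fun y : E3 => ‖y‖ ^ s)
    (ball (0 : E3) 1) hR
  rw [smul_unitBall_of_pos hR] at h
  have h2 : ∀ y : E3, ‖R • y‖ ^ s = R ^ s * ‖y‖ ^ s := fun y => by
    rw [norm_smul, Real.norm_of_nonneg hR.le, Real.mul_rpow hR.le (norm_nonneg _)]
  simp only [h2, finrank_euclideanSpace, Fintype.card_fin, smul_eq_mul] at h
  rw [integral_const_mul] at h
  rw [Real.rpow_add hR]
  unfold ballMoment
  rw [mul_assoc, h]
  norm_num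
  field_simp

/-! ### Averaged potentials -/

/-- The averaged potential `∫ w(y) / (|y| + R) dy`. -/
noncomputable def avgPot (w : E3 → ℝ) (R : ℝ) : ℝ := ∫ y, (‖y‖ + R)⁻¹ * w y

lemma ae_ne_point (z : E3) : ∀ᵐ y : E3, y ≠ z := by
  simp [ae_iff, measure_singleton]

lemma integrable_avgPot {w : E3 → ℝ} (hwm : Measurable w) (hw : ∀ y, 0 ≤ w y)
    (hi : Integrable fun y => ‖0 - y‖⁻¹ * w y) {R : ℝ} (hR : 0 ≤ R) :
    Integrable fun y => (‖y‖ + R)⁻¹ * w y := by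
  refine hi.mono' (by fun_prop) ?_
  filter_upwards [ae_ne_point 0] with y hy
  have h0 : 0 < ‖y‖ := norm_pos_iff.2 hy
  rw [Real.norm_of_nonneg (mul_nonneg (by positivity) (hw y)), zero_sub, norm_neg]
  refine mul_le_mul_of_nonneg_right ?_ (hw y)
  gcongr
  linarith

lemma avgPot_nonneg {w : E3 → ℝ} (hw : ∀ y, 0 ≤ w y) {R : ℝ} (hR : 0 ≤ R) : 0 ≤ avgPot w R :=
  integral_nonneg fun y => mul_nonneg (by positivity) (hw y)

lemma avgPot_le_potential {w : E3 → ℝ} (hwm : Measurable w) (hw : ∀ y, 0 ≤ w y)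
    (hi : ∀ x, Integrable fun y => ‖x - y‖⁻¹ * w y) {R : ℝ} {x : E3} (hx : ‖x‖ ≤ R) :
    avgPot w R ≤ ∫ y, ‖x - y‖⁻¹ * w y := by
  have hR : 0 ≤ R := (norm_nonneg x).trans hx
  refine integral_mono_ae (integrable_avgPot hwm hw (hi 0) hR) (hi x) ?_
  filter_upwards [ae_ne_point x] with y hy
  have h0 : 0 < ‖x - y‖ := norm_pos_iff.2 (sub_ne_zero.2 hy.symm)
  refine mul_le_mul_of_nonneg_right ?_ (hw y)
  have := norm_sub_le x y
  gcongr
  linarith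

lemma rpow_mul_le_avgPot {w : E3 → ℝ} (hwm : Measurable w) (hw : ∀ y, 0 ≤ w y)
    (hi : Integrable fun y => ‖0 - y‖⁻¹ * w y) {s : ℝ} (hs : -3 < s) {R m : ℝ} (hR : 0 < R)
    (hm : ∀ y ∈ ball (0 : E3) R, ‖y‖ ^ s * m ≤ w y) :
    R ^ (2 + s) * (ballMoment s / 2) * m ≤ avgPot w R := by
  have h1 : ∫ y in ball (0 : E3) R, (2 * R)⁻¹ * m * ‖y‖ ^ s
      = R ^ (2 + s) * (ballMoment s / 2) * m := by
    rw [integral_const_mul, setIntegral_ball_norm_rpow s hR,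
      show (3 + s) = 1 + (2 + s) by ring, Real.rpow_add hR 1, Real.rpow_one]
    field_simp
  rw [← h1]
  have hintg := integrable_avgPot hwm hw hi hR.le
  refine le_trans ?_ (setIntegral_le_integral (s := ball (0 : E3) R) hintg
    (Eventually.of_forall fun y => mul_nonneg (by positivity) (hw y)))
  refine setIntegral_mono_on ((integrableOn_ball_norm_rpow hs R).const_mul _) hintg.integrableOn
    measurableSet_ball fun y hy => ?_
  have hy' : ‖y‖ < R := by simpa using hy
  have h2 : (2 * R)⁻¹ ≤ (‖y‖ + R)⁻¹ := by gcongr; linarith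
  calc (2 * R)⁻¹ * m * ‖y‖ ^ s = (2 * R)⁻¹ * (‖y‖ ^ s * m) := by ring
    _ ≤ (2 * R)⁻¹ * w y := by have := hm y hy; gcongr
    _ ≤ (‖y‖ + R)⁻¹ * w y := mul_le_mul_of_nonneg_right h2 (hw y)

/-! ### Reduction to a system of integral equations -/

/-- Bounded positive solutions of the integral form of the Hardy–Hénon system. -/
structure PotSys (κ a b p q M : ℝ) (u v : E3 → ℝ) : Prop where
  κ_pos : 0 < κ
  ha : -2 < a
  hb : -2 < b
  hp : 0 < p
  hq : 0 < q
  hu : Continuous u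
  hv : Continuous v
  u_pos : ∀ x, 0 < u x
  v_pos : ∀ x, 0 < v x
  u_le : ∀ x, u x ≤ M
  v_le : ∀ x, v x ≤ M
  int_u : ∀ x, Integrable fun y => ‖x - y‖⁻¹ * (‖y‖ ^ a * v y ^ p)
  int_v : ∀ x, Integrable fun y => ‖x - y‖⁻¹ * (‖y‖ ^ b * u y ^ q)
  rep_u : ∀ x, κ * u x = ∫ y, ‖x - y‖⁻¹ * (‖y‖ ^ a * v y ^ p)
  rep_v : ∀ x, κ * v x = ∫ y, ‖x - y‖⁻¹ * (‖y‖ ^ b * u y ^ q)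

lemma PotSys.symm {κ a b p q M : ℝ} {u v : E3 → ℝ} (h : PotSys κ a b p q M u v) :
    PotSys κ b a q p M v u :=
  ⟨h.κ_pos, h.hb, h.ha, h.hq, h.hp, h.hv, h.hu, h.v_pos, h.u_pos, h.v_le, h.u_le, h.int_v, h.int_u,
    h.rep_v, h.rep_u⟩

lemma measurable_norm_rpow_mul {w : E3 → ℝ} (hw : Continuous w) (s r : ℝ) :
    Measurable fun y : E3 => ‖y‖ ^ s * w y ^ r := by
  have := hw.measurable
  fun_prop

lemma exists_rep {a p M : ℝ} {u v : E3 → ℝ} (hu : Continuous u) (hu0 : ∀ x, 0 < u x)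
    (hM : ∀ x, u x ≤ M) (hu2 : ContDiffOn ℝ 2 u {0}ᶜ) (hv0 : ∀ x, 0 < v x)
    (heq : ∀ x ≠ 0, -lap u x = ‖x‖ ^ a * v x ^ p) :
    ∃ c, 0 ≤ c ∧ ∀ x, Integrable (fun y => ‖x - y‖⁻¹ * (‖y‖ ^ a * v y ^ p)) ∧
      bumpMass * u x = c + ∫ y, ‖x - y‖⁻¹ * (‖y‖ ^ a * v y ^ p) := by
  obtain ⟨c, hc, h⟩ := exists_potential_representation hu (fun x => (hu0 x).le) hM hu2
    (fun x hx => by rw [heq x hx]; have := hv0 x; positivity)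
  have hae : ∀ x, (fun y => ‖x - y‖⁻¹ * -lap u y) =ᵐ[volume]
      fun y => ‖x - y‖⁻¹ * (‖y‖ ^ a * v y ^ p) := fun x => by
    filter_upwards [ae_ne_point 0] with y hy
    rw [heq y hy]
  refine ⟨c, hc, fun x => ⟨(h x).1.congr (hae x), ?_⟩⟩
  rw [(h x).2, integral_congr_ae (hae x)]

lemma rep_const_eq_zero {κ b q c : ℝ} {u : E3 → ℝ} (hκ : 0 < κ) (hb : -2 < b) (hq : 0 < q)
    (hu : Continuous u) (hu0 : ∀ x, 0 < u x) (hc : 0 ≤ c) (hcu : ∀ x, c ≤ κ * u x)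
    (hintg : Integrable fun y => ‖0 - y‖⁻¹ * (‖y‖ ^ b * u y ^ q)) : c = 0 := by
  by_contra hne
  have hc0 : 0 < c := lt_of_le_of_ne hc (Ne.symm hne)
  have hbound : ∀ R : ℝ, 0 < R → R ^ (2 + b) * (ballMoment b / 2) * (c / κ) ^ q
      ≤ ∫ y, ‖0 - y‖⁻¹ * (‖y‖ ^ b * u y ^ q) := by
    intro R hR
    have hg0 : ∀ y : E3, 0 ≤ ‖y‖ ^ b * u y ^ q := fun y => by have := hu0 y; positivity
    refine (rpow_mul_le_avgPot (measurable_norm_rpow_mul hu b q) hg0 hintg (by linarith) hR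
      fun y _ => ?_).trans ?_
    · have : c / κ ≤ u y := by rw [div_le_iff₀ hκ, mul_comm]; exact hcu y
      gcongr
    · refine integral_mono_ae (integrable_avgPot (measurable_norm_rpow_mul hu b q) hg0 hintg hR.le)
        hintg ?_
      filter_upwards [ae_ne_point 0] with y hy
      have h0 : 0 < ‖y‖ := norm_pos_iff.2 hy
      rw [zero_sub, norm_neg]
      refine mul_le_mul_of_nonneg_right ?_ (hg0 y)
      gcongr
      linarith
  have ht : Tendsto (fun R : ℝ => R ^ (2 + b) * (ballMoment b / 2) * (c / κ) ^ q) atTop atTop := by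
    have h1 := ballMoment_pos (s := b) (by linarith)
    refine Tendsto.atTop_mul_const (by positivity) ?_
    exact Tendsto.atTop_mul_const (by positivity) (tendsto_rpow_atTop (by linarith))
  obtain ⟨R, hR, hR0⟩ := ((ht.eventually_gt_atTop _).and (eventually_gt_atTop 0)).exists
  exact absurd (hbound R hR0) (not_le.2 hR)

theorem IsHHSol.potSys {a b p q M : ℝ} {u v : E3 → ℝ} (h : IsHHSol a b p q univ u v)
    (ha : -2 < a) (hb : -2 < b) (hp : 0 < p) (hq : 0 < q)
    (huM : ∀ x, u x ≤ M) (hvM : ∀ x, v x ≤ M) : PotSys bumpMass a b p q M u v := by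
  obtain ⟨hu, hv, hu2, hv2, hu0, hv0, hequ, heqv⟩ := h
  rw [continuousOn_univ] at hu hv
  have hset : (univ \ {0} : Set E3) = {0}ᶜ := by ext; simp
  rw [hset] at hu2 hv2 hequ heqv
  have hu0' : ∀ x, 0 < u x := fun x => hu0 x (mem_univ x)
  have hv0' : ∀ x, 0 < v x := fun x => hv0 x (mem_univ x)
  obtain ⟨c, hc, hcu⟩ := exists_rep hu hu0' huM hu2 hv0' hequ
  obtain ⟨d, hd, hdv⟩ := exists_rep hv hv0' hvM hv2 hu0' heqv
  have hnn : ∀ (s r : ℝ) (w : E3 → ℝ), (∀ x, 0 < w x) → ∀ x : E3,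
      0 ≤ ∫ y, ‖x - y‖⁻¹ * (‖y‖ ^ s * w y ^ r) := fun s r w hw x =>
    integral_nonneg fun y => by have := hw y; positivity
  have hc0 : c = 0 := rep_const_eq_zero bumpMass_pos hb hq hu hu0' hc
    (fun x => by rw [(hcu x).2]; linarith [hnn a p v hv0' x]) (hdv 0).1
  have hd0 : d = 0 := rep_const_eq_zero bumpMass_pos ha hp hv hv0' hd
    (fun x => by rw [(hdv x).2]; linarith [hnn b q u hu0' x]) (hcu 0).1
  subst hc0 hd0
  exact ⟨bumpMass_pos, ha, hb, hp, hq, hu, hv, hu0', hv0', huM, hvM, fun x => (hcu x).1,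
    fun x => (hdv x).1, fun x => by simpa using (hcu x).2, fun x => by simpa using (hdv x).2⟩

/-! ### Decay of the averaged potentials -/

section
variable {κ a b p q M : ℝ} {u v : E3 → ℝ}

lemma PotSys.src_nonneg (h : PotSys κ a b p q M u v) (y : E3) : 0 ≤ ‖y‖ ^ a * v y ^ p := by
  have := h.v_pos y
  positivity

lemma PotSys.src_measurable (h : PotSys κ a b p q M u v) :
    Measurable fun y : E3 => ‖y‖ ^ a * v y ^ p := measurable_norm_rpow_mul h.hv a p

lemma PotSys.avgPot_le_mul (h : PotSys κ a b p q M u v) {R : ℝ} {x : E3} (hx : ‖x‖ ≤ R) :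
    avgPot (fun y => ‖y‖ ^ a * v y ^ p) R ≤ κ * u x := by
  rw [h.rep_u]
  exact avgPot_le_potential h.src_measurable h.src_nonneg h.int_u hx

lemma PotSys.avgPot_pos (h : PotSys κ a b p q M u v) {R : ℝ} (hR : 0 < R) :
    0 < avgPot (fun y => ‖y‖ ^ a * v y ^ p) R := by
  refine (integral_pos_iff_support_of_nonneg
    (fun y => mul_nonneg (by positivity) (h.src_nonneg y))
    (integrable_avgPot h.src_measurable h.src_nonneg (h.int_u 0) hR.le)).2 ?_
  have : ({0}ᶜ : Set E3) ⊆ Function.support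
      (fun y : E3 => (‖y‖ + R)⁻¹ * (‖y‖ ^ a * v y ^ p)) := by
    intro y hy
    have h1 : 0 < ‖y‖ := norm_pos_iff.2 hy
    have h2 := h.v_pos y
    exact (by positivity : (0 : ℝ) < (‖y‖ + R)⁻¹ * (‖y‖ ^ a * v y ^ p)).ne'
  refine lt_of_lt_of_le ?_ (measure_mono this)
  rw [measure_compl (measurableSet_singleton _) (by simp)]
  simp

lemma PotSys.mul_rpow_le_avgPot (h : PotSys κ a b p q M u v) : ∃ C, 0 < C ∧ ∀ R, 0 < R →
    C * R ^ (2 + b) * avgPot (fun y => ‖y‖ ^ a * v y ^ p) R ^ q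
      ≤ avgPot (fun y => ‖y‖ ^ b * u y ^ q) R := by
  have hκ := h.κ_pos
  have hB := ballMoment_pos (s := b) (by linarith [h.hb])
  refine ⟨ballMoment b / 2 * (κ ^ q)⁻¹, by positivity, fun R hR => ?_⟩
  set U := avgPot (fun y => ‖y‖ ^ a * v y ^ p) R with hU
  have hU0 : 0 ≤ U := avgPot_nonneg h.src_nonneg hR.le
  have hq := h.hq
  have := rpow_mul_le_avgPot h.symm.src_measurable h.symm.src_nonneg (h.int_v 0)
    (s := b) (by linarith [h.hb]) hR (m := (U / κ) ^ q) (fun y hy => by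
      have h1 : ‖y‖ ≤ R := by simpa using (mem_ball.1 hy).le
      have h2 : U / κ ≤ u y := by
        rw [div_le_iff₀ hκ, mul_comm]
        exact h.avgPot_le_mul h1
      gcongr)
  refine le_trans (le_of_eq ?_) this
  rw [Real.div_rpow hU0 hκ.le]
  ring

lemma PotSys.self_bound (h : PotSys κ a b p q M u v) : ∃ C, 0 < C ∧ ∀ R, 0 < R →
    C * R ^ (2 + a + p * (2 + b)) * avgPot (fun y => ‖y‖ ^ a * v y ^ p) R ^ (p * q)
      ≤ avgPot (fun y => ‖y‖ ^ a * v y ^ p) R := by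
  obtain ⟨C, hC, h1⟩ := h.mul_rpow_le_avgPot
  obtain ⟨D, hD, h2⟩ := h.symm.mul_rpow_le_avgPot
  refine ⟨D * C ^ p, by positivity, fun R hR => ?_⟩
  refine le_trans ?_ (h2 R hR)
  have hU0 : 0 ≤ avgPot (fun y => ‖y‖ ^ a * v y ^ p) R := avgPot_nonneg h.src_nonneg hR.le
  set U := avgPot (fun y => ‖y‖ ^ a * v y ^ p) R with hU
  have h3 := Real.rpow_le_rpow (by positivity) (h1 R hR) h.hp.le
  rw [Real.mul_rpow (by positivity) (by positivity), Real.mul_rpow hC.le (by positivity),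
    ← Real.rpow_mul hR.le, ← Real.rpow_mul hU0] at h3
  calc D * C ^ p * R ^ (2 + a + p * (2 + b)) * U ^ (p * q)
      = D * R ^ (2 + a) * (C ^ p * R ^ ((2 + b) * p) * U ^ (q * p)) := by
        rw [Real.rpow_add hR, mul_comm p q, mul_comm p (2 + b)]; ring
    _ ≤ _ := by gcongr

lemma PotSys.avgPot_le_const (h : PotSys κ a b p q M u v) {R : ℝ} (hR : 0 < R) :
    avgPot (fun y => ‖y‖ ^ a * v y ^ p) R ≤ κ * M :=
  (h.avgPot_le_mul (x := 0) (by simpa using hR.le)).trans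
    (mul_le_mul_of_nonneg_left (h.u_le 0) h.κ_pos.le)

lemma PotSys.one_lt_mul (h : PotSys κ a b p q M u v) : 1 < p * q := by
  by_contra! hle
  obtain ⟨C, hC, h1⟩ := h.self_bound
  have he : 0 < 2 + a + p * (2 + b) := by
    have := h.ha; have := mul_pos h.hp (by linarith [h.hb] : 0 < 2 + b); linarith
  have ht : Tendsto (fun R : ℝ => C * R ^ (2 + a + p * (2 + b))) atTop atTop :=
    Tendsto.const_mul_atTop hC (tendsto_rpow_atTop he)
  obtain ⟨R, hR, hR0⟩ := ((ht.eventually_gt_atTop ((κ * M) ^ (1 - p * q))).and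
    (eventually_gt_atTop 0)).exists
  have hU := h.avgPot_pos hR0
  have h2 := h1 R hR0
  have h3 := h.avgPot_le_const hR0
  set U := avgPot (fun y => ‖y‖ ^ a * v y ^ p) R
  have h4 : U = U ^ (1 - p * q) * U ^ (p * q) := by
    rw [← Real.rpow_add hU]; simp
  have h5 : C * R ^ (2 + a + p * (2 + b)) ≤ U ^ (1 - p * q) := by
    rw [h4] at h2
    conv_lhs at h2 => rw [← h4]
    exact le_of_mul_le_mul_right h2 (by positivity)
  have h6 : U ^ (1 - p * q) ≤ (κ * M) ^ (1 - p * q) :=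
    Real.rpow_le_rpow hU.le h3 (by linarith)
  linarith

/-- The decay exponent of the averaged potential of the first component. -/
noncomputable def decayExp (a b p q : ℝ) : ℝ := (2 + a + p * (2 + b)) / (p * q - 1)

lemma PotSys.avgPot_le_rpow (h : PotSys κ a b p q M u v) : ∃ C, 0 < C ∧ ∀ R, 0 < R →
    avgPot (fun y => ‖y‖ ^ a * v y ^ p) R ≤ C * R ^ (-decayExp a b p q) := by
  have hpq := h.one_lt_mul
  obtain ⟨C, hC, h1⟩ := h.self_bound
  refine ⟨(C⁻¹) ^ (1 / (p * q - 1)), by positivity, fun R hR => ?_⟩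
  have hU := h.avgPot_pos hR
  have h2 := h1 R hR
  set U := avgPot (fun y => ‖y‖ ^ a * v y ^ p) R
  have h4 : U ^ (p * q) = U ^ (p * q - 1) * U := by
    rw [← Real.rpow_add_one hU.ne']; simp
  set e := 2 + a + p * (2 + b) with he
  have h5 : U ^ (p * q - 1) ≤ C⁻¹ * R ^ (-e) := by
    rw [h4, ← mul_assoc] at h2
    have h6 : C * R ^ e * U ^ (p * q - 1) ≤ 1 := by
      by_contra! h7
      nlinarith
    rw [Real.rpow_neg hR.le, ← mul_inv, ← one_div, le_div_iff₀ (by positivity)]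
    linarith
  have h6 := Real.rpow_le_rpow (by positivity) h5 (by
    have : 0 < p * q - 1 := by linarith
    positivity : 0 ≤ 1 / (p * q - 1))
  rw [← Real.rpow_mul hU.le, mul_one_div_cancel (by linarith), Real.rpow_one,
    Real.mul_rpow (by positivity) (by positivity), ← Real.rpow_mul hR.le] at h6
  refine h6.trans (le_of_eq ?_)
  congr 2
  rw [decayExp]; ring

end

/-! ### Good radii -/

lemma integral_inv_abs_sub_add_le {s R δ : ℝ} (hs : 0 ≤ s) (hR : 0 < R) (hδ : 0 < δ) :
    ∫ r in R..(2 * R), (|s - r| + δ)⁻¹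
      ≤ (10 * Real.log ((4 * R + δ) / δ) + 3) * R * (s + R)⁻¹ := by
  have hlog : 0 ≤ Real.log ((4 * R + δ) / δ) :=
    Real.log_nonneg (by rw [le_div_iff₀ hδ]; linarith)
  have hcont : Continuous fun r : ℝ => (|s - r| + δ)⁻¹ :=
    Continuous.inv₀ (by fun_prop) fun r => by positivity
  rcases le_or_gt (4 * R) s with h | h
  · have h1 : ∫ r in R..(2 * R), (|s - r| + δ)⁻¹ ≤ ∫ r in R..(2 * R), (2 * s⁻¹) := by
      refine intervalIntegral.integral_mono_on (by linarith) (hcont.intervalIntegrable _ _)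
        (by simp) fun r hr => ?_
      have hs0 : 0 < s := by linarith
      rw [← inv_inv (2 * s⁻¹)]
      refine inv_anti₀ (by positivity) ?_
      rw [abs_of_nonneg (by linarith [hr.2]), mul_inv, inv_inv]
      linarith [hr.2]
    refine h1.trans ?_
    rw [intervalIntegral.integral_const, smul_eq_mul]
    have hs0 : 0 < s := by linarith
    have : 2 * s⁻¹ ≤ 3 * (s + R)⁻¹ := by
      rw [← div_eq_mul_inv, ← div_eq_mul_inv, div_le_div_iff₀ hs0 (by linarith)]; linarith
    calc (2 * R - R) * (2 * s⁻¹) ≤ (2 * R - R) * (3 * (s + R)⁻¹) := by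
          gcongr; linarith
      _ = 3 * R * (s + R)⁻¹ := by ring
      _ ≤ _ := by gcongr; linarith
  · have half1 : ∫ r in s..(s + 4 * R), (|s - r| + δ)⁻¹ = Real.log ((4 * R + δ) / δ) := by
      have e1 : ∫ r in s..(s + 4 * R), (|s - r| + δ)⁻¹
          = ∫ r in s..(s + 4 * R), (fun t => t⁻¹) (r - (s - δ)) := by
        refine intervalIntegral.integral_congr fun r hr => ?_
        rw [uIcc_of_le (by linarith)] at hr
        simp only
        rw [abs_of_nonpos (by linarith [hr.1])]
        congr 1; ring
      rw [e1, intervalIntegral.integral_comp_sub_right, integral_inv_of_pos (by linarith)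
        (by linarith)]
      congr 2 <;> ring
    have half2 : ∫ r in (s - 4 * R)..s, (|s - r| + δ)⁻¹ = Real.log ((4 * R + δ) / δ) := by
      have e1 : ∫ r in (s - 4 * R)..s, (|s - r| + δ)⁻¹
          = ∫ r in (s - 4 * R)..s, (fun t => t⁻¹) ((s + δ) - r) := by
        refine intervalIntegral.integral_congr fun r hr => ?_
        rw [uIcc_of_le (by linarith)] at hr
        simp only
        rw [abs_of_nonneg (by linarith [hr.2])]
        congr 1; ring
      rw [e1, intervalIntegral.integral_comp_sub_left, integral_inv_of_pos (by linarith)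
        (by linarith)]
      congr 2 <;> ring
    have h1 : ∫ r in R..(2 * R), (|s - r| + δ)⁻¹
        ≤ ∫ r in (s - 4 * R)..(s + 4 * R), (|s - r| + δ)⁻¹ :=
      intervalIntegral.integral_mono_interval (by linarith) (by linarith) (by linarith)
        (Eventually.of_forall fun r => by simp only [Pi.zero_apply]; positivity)
        (hcont.intervalIntegrable _ _)
    rw [← intervalIntegral.integral_add_adjacent_intervals (a := s - 4 * R) (b := s)
      (hcont.intervalIntegrable _ _) (hcont.intervalIntegrable _ _), half1, half2] at h1
    refine h1.trans ?_
    rw [← div_eq_mul_inv, le_div_iff₀ (by linarith)]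
    nlinarith

lemma exists_good_radius {w : E3 → ℝ} (hwm : Measurable w) (hw : ∀ y, 0 ≤ w y)
    (hi : Integrable fun y => ‖0 - y‖⁻¹ * w y) {R δ : ℝ} (hR : 0 < R) (hδ : 0 < δ) :
    ∃ r ∈ Icc R (2 * R), Integrable (fun y => (|‖y‖ - r| + δ)⁻¹ * w y) ∧
      ∫ y, (|‖y‖ - r| + δ)⁻¹ * w y ≤ (10 * Real.log ((4 * R + δ) / δ) + 3) * avgPot w R := by
  set Λ := 10 * Real.log ((4 * R + δ) / δ) + 3 with hΛ
  have hΛ0 : 0 ≤ Λ := by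
    have := Real.log_nonneg (by rw [le_div_iff₀ hδ]; linarith : (1 : ℝ) ≤ (4 * R + δ) / δ)
    linarith
  let F : ℝ → ENNReal := fun r => ∫⁻ y, ENNReal.ofReal ((|‖y‖ - r| + δ)⁻¹ * w y)
  have hmeas : Measurable fun z : ℝ × E3 => ENNReal.ofReal ((|‖z.2‖ - z.1| + δ)⁻¹ * w z.2) := by
    fun_prop
  have hFint : ∫⁻ r in Icc R (2 * R), F r ≤ ENNReal.ofReal (Λ * R * avgPot w R) := by
    have h1 : ∫⁻ r in Icc R (2 * R), F r
        = ∫⁻ y, ∫⁻ r in Icc R (2 * R), ENNReal.ofReal ((|‖y‖ - r| + δ)⁻¹ * w y) :=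
      lintegral_lintegral_swap hmeas.aemeasurable
    rw [h1]
    have h2 : ∀ y : E3, ∫⁻ r in Icc R (2 * R), ENNReal.ofReal ((|‖y‖ - r| + δ)⁻¹ * w y)
        ≤ ENNReal.ofReal (Λ * R * ((‖y‖ + R)⁻¹ * w y)) := by
      intro y
      have hcont : Continuous fun r : ℝ => (|‖y‖ - r| + δ)⁻¹ * w y :=
        (Continuous.inv₀ (by fun_prop) fun r => by positivity).mul continuous_const
      rw [← ofReal_integral_eq_lintegral_ofReal (hcont.integrableOn_Icc)
        (Eventually.of_forall fun r => mul_nonneg (by positivity) (hw y))]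
      refine ENNReal.ofReal_le_ofReal ?_
      rw [integral_mul_const, integral_Icc_eq_integral_Ioc,
        ← intervalIntegral.integral_of_le (by linarith)]
      calc _ ≤ (Λ * R * (‖y‖ + R)⁻¹) * w y :=
            mul_le_mul_of_nonneg_right (integral_inv_abs_sub_add_le (norm_nonneg y) hR hδ) (hw y)
        _ = _ := by ring
    refine (lintegral_mono h2).trans (le_of_eq ?_)
    rw [← ofReal_integral_eq_lintegral_ofReal
      ((integrable_avgPot hwm hw hi hR.le).const_mul _)
      (Eventually.of_forall fun y => mul_nonneg (by positivity)
        (mul_nonneg (by positivity) (hw y))), integral_const_mul]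
    rfl
  have hvol : volume (Icc R (2 * R)) = ENNReal.ofReal R := by
    rw [Real.volume_Icc]; congr 1; ring
  obtain ⟨r, hr, hFr⟩ := exists_le_setLAverage (μ := volume) (s := Icc R (2 * R)) (f := F)
    (by rw [hvol]; simpa using hR) (by rw [hvol]; exact ENNReal.ofReal_ne_top)
    (hmeas.lintegral_prod_right').aemeasurable
  have hle : F r ≤ ENNReal.ofReal (Λ * avgPot w R) := by
    refine hFr.trans ?_
    rw [setLAverage_eq, hvol]
    refine (ENNReal.div_le_div_right hFint _).trans (le_of_eq ?_)
    rw [← ENNReal.ofReal_div_of_pos hR]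
    congr 1; field_simp
  have hm : Measurable fun y : E3 => (|‖y‖ - r| + δ)⁻¹ * w y := by fun_prop
  have hnn : ∀ y : E3, 0 ≤ (|‖y‖ - r| + δ)⁻¹ * w y := fun y => mul_nonneg (by positivity) (hw y)
  refine ⟨r, hr, ⟨hm.aestronglyMeasurable, ?_⟩, ?_⟩
  · rw [hasFiniteIntegral_iff_ofReal (Eventually.of_forall hnn)]
    exact hle.trans_lt ENNReal.ofReal_lt_top
  · rw [integral_eq_lintegral_of_nonneg_ae (Eventually.of_forall hnn) hm.aestronglyMeasurable]
    exact ENNReal.toReal_le_of_le_ofReal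
      (mul_nonneg hΛ0 (avgPot_nonneg hw hR.le)) hle

/-! ### Pointwise inequalities for dilated kernels -/

lemma inv_sub_inv_dilate_le {x y : E3} {h : ℝ} (hh : 0 < h) (hD : x ≠ y)
    (hA : (1 + h) • x ≠ y) (hA' : (1 + h) • y ≠ x) :
    (‖x - y‖⁻¹ - ‖(1 + h) • x - y‖⁻¹) + (‖y - x‖⁻¹ - ‖(1 + h) • y - x‖⁻¹)
      ≤ h * ‖x - y‖⁻¹ +
        2 * ‖x - y‖⁻¹ * min 1 (h ^ 2 * (‖x‖ ^ 2 + ‖y‖ ^ 2) / (4 * ‖x - y‖ ^ 2)) := by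
  rw [norm_sub_rev y x]
  have hD0 : 0 < ‖x - y‖ := norm_pos_iff.2 (sub_ne_zero.2 hD)
  have hA0 : 0 < ‖(1 + h) • x - y‖ := norm_pos_iff.2 (sub_ne_zero.2 hA)
  have hA'0 : 0 < ‖(1 + h) • y - x‖ := norm_pos_iff.2 (sub_ne_zero.2 hA')
  have hsum : ‖(1 + h) • x - y‖ ^ 2 + ‖(1 + h) • y - x‖ ^ 2
      = 2 * (1 + h) * ‖x - y‖ ^ 2 + h ^ 2 * (‖x‖ ^ 2 + ‖y‖ ^ 2) := by
    simp only [norm_sub_sq_real, norm_smul, inner_smul_left, real_inner_comm x y,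
      Real.norm_of_nonneg (by linarith : 0 ≤ 1 + h)]
    simp
    ring
  set D := ‖x - y‖
  set A := ‖(1 + h) • x - y‖
  set A' := ‖(1 + h) • y - x‖
  set ρ := ‖x‖ ^ 2 + ‖y‖ ^ 2 with hρ
  have hρ0 : 0 ≤ ρ := by positivity
  set r := Real.sqrt ((A ^ 2 + A' ^ 2) / 2) with hr
  have hr0 : 0 < r := Real.sqrt_pos.2 (by positivity)
  have hr2 : r ^ 2 = (A ^ 2 + A' ^ 2) / 2 := Real.sq_sqrt (by positivity)
  have h1 : 2 * r⁻¹ ≤ A⁻¹ + A'⁻¹ := by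
    have e : A⁻¹ + A'⁻¹ = (A + A') / (A * A') := by field_simp; ring
    rw [e, ← div_eq_mul_inv, div_le_div_iff₀ hr0 (by positivity)]
    have : (A + A') / 2 ≤ r := by
      refine Real.le_sqrt_of_sq_le ?_
      nlinarith [sq_nonneg (A - A')]
    nlinarith [sq_nonneg (A - A')]
  set σ := r / D with hσ
  have hσ0 : 0 < σ := by positivity
  have hσ2 : σ ^ 2 = 1 + h + h ^ 2 * ρ / (2 * D ^ 2) := by
    rw [hσ, div_pow, hr2, hsum]; field_simp
  have hrD : r⁻¹ = D⁻¹ * σ⁻¹ := by rw [hσ]; field_simp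
  have hz : 0 ≤ h ^ 2 * ρ / (2 * D ^ 2) := by positivity
  have h2 : 1 - σ⁻¹ ≤ h / 2 + min 1 (h ^ 2 * ρ / (4 * D ^ 2)) := by
    have hσi : 0 < σ⁻¹ := by positivity
    have e4 : h ^ 2 * ρ / (4 * D ^ 2) = h ^ 2 * ρ / (2 * D ^ 2) / 2 := by field_simp; norm_num
    rw [← sub_le_iff_le_add']
    refine le_min (by linarith) ?_
    rw [e4]
    have h3 : 1 ≤ σ := by
      by_contra! hlt
      nlinarith
    have h4 : 1 - σ⁻¹ ≤ (σ ^ 2 - 1) / 2 := by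
      have e5 : 1 - σ⁻¹ = (σ - 1) / σ := by field_simp
      rw [e5, div_le_iff₀ hσ0]
      nlinarith [mul_nonneg (by linarith : 0 ≤ σ - 1) (by nlinarith : 0 ≤ σ * (σ + 1) - 2)]
    linarith
  have hDi : 0 < D⁻¹ := by positivity
  calc D⁻¹ - A⁻¹ + (D⁻¹ - A'⁻¹) ≤ 2 * D⁻¹ - 2 * r⁻¹ := by linarith
    _ = 2 * D⁻¹ * (1 - σ⁻¹) := by rw [hrD]; ring
    _ ≤ 2 * D⁻¹ * (h / 2 + min 1 (h ^ 2 * ρ / (4 * D ^ 2))) := by gcongr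
    _ = _ := by ring

/-- The truncated inverse square. -/
noncomputable def truncInvSq (ρ : ℝ) : E3 → ℝ := (ball 0 ρ).indicator fun z => ‖z‖ ^ (-2 : ℝ)

lemma truncInvSq_nonneg (ρ : ℝ) (z : E3) : 0 ≤ truncInvSq ρ z :=
  indicator_nonneg (fun z _ => by positivity) z

lemma integrable_truncInvSq (ρ : ℝ) : Integrable (truncInvSq ρ) :=
  (integrable_indicator_iff measurableSet_ball).2 (integrableOn_ball_norm_rpow (by norm_num) ρ)

lemma integral_truncInvSq {ρ : ℝ} (hρ : 0 < ρ) : ∫ z, truncInvSq ρ z = ρ * ballMoment (-2) := by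
  unfold truncInvSq
  rw [integral_indicator measurableSet_ball, setIntegral_ball_norm_rpow _ hρ]
  norm_num

lemma inv_sub_inv_cross_le {x y : E3} {h R δ : ℝ} (hh : 0 ≤ h) (hδ : 0 < δ) (hhR : h * R ≤ δ)
    (hx : ‖x‖ < R) (hy : R ≤ ‖y‖) (hA : (1 + h) • x ≠ y) {f F : ℝ} (hf : 0 ≤ f)
    (hF : ‖y‖ ≤ R + 2 * δ → f ≤ F) (hF0 : 0 ≤ F) :
    f * (‖x - y‖⁻¹ - ‖(1 + h) • x - y‖⁻¹)
      ≤ 8 * (h * R) * (|‖x‖ - R| + δ)⁻¹ * ((|‖y‖ - R| + δ)⁻¹ * f)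
        + h * R / 2 * F * (truncInvSq (3 * δ) ((1 + h) • x - y) + truncInvSq (3 * δ) (x - y)) := by
  have hR : 0 < R := (norm_nonneg x).trans_lt hx
  have hhR0 : 0 ≤ h * R := by positivity
  have hD : x ≠ y := by rintro rfl; linarith
  have hD0 : 0 < ‖x - y‖ := norm_pos_iff.2 (sub_ne_zero.2 hD)
  have hA0 : 0 < ‖(1 + h) • x - y‖ := norm_pos_iff.2 (sub_ne_zero.2 hA)
  have hdiff : ‖((1 + h) • x - y) - (x - y)‖ ≤ h * R := by
    have : ((1 + h) • x - y) - (x - y) = h • x := by rw [add_smul, one_smul]; abel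
    rw [this, norm_smul, Real.norm_of_nonneg hh]
    gcongr
  have hAD : ‖(1 + h) • x - y‖ ≤ ‖x - y‖ + h * R := by
    linarith [norm_sub_norm_le ((1 + h) • x - y) (x - y)]
  have hDA : ‖x - y‖ ≤ ‖(1 + h) • x - y‖ + h * R := by
    linarith [norm_sub_norm_le (x - y) ((1 + h) • x - y),
      norm_sub_rev (x - y) ((1 + h) • x - y)]
  have hxy : ‖y‖ - ‖x‖ ≤ ‖x - y‖ := by
    rw [norm_sub_rev]; exact norm_sub_norm_le y x
  have hkx : |‖x‖ - R| = R - ‖x‖ := by rw [abs_of_neg (by linarith)]; ring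
  have hky : |‖y‖ - R| = ‖y‖ - R := abs_of_nonneg (by linarith)
  rw [hkx, hky]
  have ht1 : 0 ≤ truncInvSq (3 * δ) ((1 + h) • x - y) := truncInvSq_nonneg _ _
  have ht2 : 0 ≤ truncInvSq (3 * δ) (x - y) := truncInvSq_nonneg _ _
  have hball : ∀ z : E3, ‖z‖ < 3 * δ → truncInvSq (3 * δ) z = (‖z‖ ^ 2)⁻¹ := fun z hz => by
    have : z ∈ ball (0 : E3) (3 * δ) := by simpa using hz
    rw [truncInvSq, indicator_of_mem this, Real.rpow_neg (norm_nonneg _)]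
    norm_num
  set D := ‖x - y‖
  set A := ‖(1 + h) • x - y‖
  have hgen : D⁻¹ - A⁻¹ ≤ h * R * (A⁻¹ * D⁻¹) := by
    have : D⁻¹ - A⁻¹ = (A - D) * (A⁻¹ * D⁻¹) := by field_simp
    rw [this]
    gcongr
    linarith
  have hkx0 : 0 < R - ‖x‖ + δ := by linarith
  have hky0 : 0 < ‖y‖ - R + δ := by linarith
  rcases le_or_gt (2 * δ) D with hc | hc
  · have h1 : A⁻¹ ≤ 2 * D⁻¹ := by
      rw [← inv_inv (2 * D⁻¹)]
      refine inv_anti₀ (by positivity) ?_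
      rw [mul_inv, inv_inv]
      linarith
    have h2 : D⁻¹ ≤ 2 * (R - ‖x‖ + δ)⁻¹ := by
      rw [← div_eq_mul_inv, inv_eq_one_div, div_le_div_iff₀ hD0 hkx0]
      linarith
    have h3 : D⁻¹ ≤ 2 * (‖y‖ - R + δ)⁻¹ := by
      rw [← div_eq_mul_inv, inv_eq_one_div, div_le_div_iff₀ hD0 hky0]
      linarith
    calc f * (D⁻¹ - A⁻¹) ≤ f * (h * R * (A⁻¹ * D⁻¹)) := by gcongr
      _ ≤ f * (h * R * ((2 * (2 * (R - ‖x‖ + δ)⁻¹)) * (2 * (‖y‖ - R + δ)⁻¹))) := by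
          gcongr
          exact h1.trans (by gcongr)
      _ = 8 * (h * R) * (R - ‖x‖ + δ)⁻¹ * ((‖y‖ - R + δ)⁻¹ * f) := by ring
      _ ≤ _ := by
          have : 0 ≤ h * R / 2 * F * (truncInvSq (3 * δ) ((1 + h) • x - y)
            + truncInvSq (3 * δ) (x - y)) := by positivity
          linarith
  · have hfF : f ≤ F := hF (by linarith)
    rw [hball _ (by linarith : A < 3 * δ), hball _ (by linarith : D < 3 * δ)]
    have h1 : A⁻¹ * D⁻¹ ≤ ((A ^ 2)⁻¹ + (D ^ 2)⁻¹) / 2 := by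
      rw [← inv_pow, ← inv_pow]
      nlinarith [sq_nonneg (A⁻¹ - D⁻¹)]
    calc f * (D⁻¹ - A⁻¹) ≤ f * (h * R * (A⁻¹ * D⁻¹)) := by gcongr
      _ ≤ F * (h * R * (((A ^ 2)⁻¹ + (D ^ 2)⁻¹) / 2)) := by gcongr
      _ = h * R / 2 * F * ((A ^ 2)⁻¹ + (D ^ 2)⁻¹) := by ring
      _ ≤ _ := by
          have : 0 ≤ 8 * (h * R) * (R - ‖x‖ + δ)⁻¹ * ((‖y‖ - R + δ)⁻¹ * f) := by positivity
          linarith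

/-! ### Local integrability of products of singular weights -/

lemma ae_prod_ne_smul (t : ℝ) : ∀ᵐ z : E3 × E3, t • z.1 ≠ z.2 := by
  refine (Measure.ae_prod_iff_ae_ae (μ := (volume : Measure E3)) (ν := (volume : Measure E3)) ?_).2
    (Eventually.of_forall fun x => ?_)
  · exact (isOpen_ne_fun (by fun_prop) (by fun_prop)).measurableSet
  · filter_upwards [ae_ne_point (t • x)] with y hy using hy.symm

lemma ae_prod_swap {P : E3 × E3 → Prop} (h : ∀ᵐ z, P z) : ∀ᵐ z : E3 × E3, P z.swap :=
  (Measure.measurePreserving_swap (μ := (volume : Measure E3)) (ν := (volume : Measure E3)))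
    |>.quasiMeasurePreserving.ae h

lemma ae_prod_fst_ne_zero : ∀ᵐ z : E3 × E3, z.1 ≠ 0 := by
  refine (Measure.ae_prod_iff_ae_ae (μ := (volume : Measure E3)) (ν := (volume : Measure E3)) ?_).2 ?_
  · exact (isOpen_ne_fun (by fun_prop) (by fun_prop)).measurableSet
  · filter_upwards [ae_ne_point 0] with x hx
    exact Eventually.of_forall fun _ => hx

lemma integrableOn_rpow_mul_rpow_sub {a s : ℝ} (ha : -3 < a) (hs : -3 < s) (R : ℝ) :
    IntegrableOn (fun z : E3 × E3 => ‖z.2‖ ^ a * ‖z.1 - z.2‖ ^ s) (ball 0 R ×ˢ ball 0 R) := by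
  have h1 := ((integrable_indicator_iff measurableSet_ball).2
    (integrableOn_ball_norm_rpow ha R)).convolution_integrand (ContinuousLinearMap.mul ℝ ℝ)
    ((integrable_indicator_iff measurableSet_ball).2 (integrableOn_ball_norm_rpow hs (2 * R)))
  refine (h1.integrableOn (s := ball 0 R ×ˢ ball 0 R)).congr_fun (fun z hz => ?_)
    (measurableSet_ball.prod measurableSet_ball)
  have hz1 : ‖z.1‖ < R := by simpa using hz.1
  have hz2 : ‖z.2‖ < R := by simpa using hz.2
  have hz3 : z.1 - z.2 ∈ ball (0 : E3) (2 * R) := by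
    have := norm_sub_le z.1 z.2
    simp only [mem_ball, dist_zero_right]; linarith
  simp only [ContinuousLinearMap.mul_apply']
  rw [indicator_of_mem hz.2, indicator_of_mem hz3]

lemma integrableOn_fst_weight {a b : ℝ} (ha : -2 < a) (hb : -2 < b) (R : ℝ) :
    IntegrableOn (fun z : E3 × E3 => ‖z.1‖ ^ b * ‖z.2‖ ^ a * (‖z.1‖ * (‖z.1 - z.2‖ ^ 2)⁻¹))
      (ball 0 R ×ˢ ball 0 R) := by
  have hS : MeasurableSet ((ball 0 R : Set E3) ×ˢ (ball 0 R : Set E3)) :=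
    measurableSet_ball.prod measurableSet_ball
  have hmeas : Measurable fun z : E3 × E3 =>
      ‖z.1‖ ^ b * ‖z.2‖ ^ a * (‖z.1‖ * (‖z.1 - z.2‖ ^ 2)⁻¹) := by fun_prop
  have hpw : ∀ z : E3 × E3, z.1 ≠ 0 → ‖z.1‖ ^ b * ‖z.2‖ ^ a * (‖z.1‖ * (‖z.1 - z.2‖ ^ 2)⁻¹)
      = ‖z.2‖ ^ a * (‖z.1‖ ^ (b + 1) * ‖z.1 - z.2‖ ^ (-2 : ℝ)) := by
    intro z hz
    have : 0 < ‖z.1‖ := norm_pos_iff.2 hz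
    rw [Real.rpow_add_one this.ne', Real.rpow_neg (norm_nonneg _)]
    norm_num; ring
  rcases le_or_gt 0 (b + 1) with hb1 | hb1
  · refine ((integrableOn_rpow_mul_rpow_sub (by linarith : -3 < a) (by norm_num : (-3 : ℝ) < -2)
      R).const_mul (R ^ (b + 1))).mono' hmeas.aestronglyMeasurable ?_
    filter_upwards [ae_restrict_of_ae ae_prod_fst_ne_zero, ae_restrict_mem hS] with z hz hzS
    rw [hpw z hz, Real.norm_of_nonneg (by positivity)]
    have hz1 : ‖z.1‖ ≤ R := by simpa using (mem_ball.1 hzS.1).le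
    calc ‖z.2‖ ^ a * (‖z.1‖ ^ (b + 1) * ‖z.1 - z.2‖ ^ (-2 : ℝ))
        ≤ ‖z.2‖ ^ a * (R ^ (b + 1) * ‖z.1 - z.2‖ ^ (-2 : ℝ)) := by gcongr
      _ = _ := by ring
  · have hprod : IntegrableOn (fun z : E3 × E3 => ‖z.1‖ ^ (b - 1) * ‖z.2‖ ^ a)
        (ball 0 R ×ˢ ball 0 R) := by
      have := (integrableOn_ball_norm_rpow (s := b - 1) (by linarith) R).mul_prod
        (integrableOn_ball_norm_rpow (s := a) (by linarith) R)
      rwa [Measure.prod_restrict] at this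
    refine (hprod.add (integrableOn_rpow_mul_rpow_sub (by linarith : -3 < a)
      (by linarith : -3 < b - 1) R)).mono' hmeas.aestronglyMeasurable ?_
    filter_upwards [ae_restrict_of_ae ae_prod_fst_ne_zero,
      ae_restrict_of_ae (ae_prod_ne_smul 1)] with z hz hzD
    rw [one_smul] at hzD
    have hx : 0 < ‖z.1‖ := norm_pos_iff.2 hz
    have hD : 0 < ‖z.1 - z.2‖ := norm_pos_iff.2 (sub_ne_zero.2 hzD)
    rw [hpw z hz, Real.norm_of_nonneg (by positivity)]
    have key : ‖z.1‖ ^ (b + 1) * ‖z.1 - z.2‖ ^ (-2 : ℝ)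
        ≤ ‖z.1‖ ^ (b - 1) + ‖z.1 - z.2‖ ^ (b - 1) := by
      have e1 : ∀ r : ℝ, 0 < r → r ^ (b - 1) = r ^ (b + 1) * r ^ (-2 : ℝ) := fun r hr => by
        rw [← Real.rpow_add hr]; congr 1; ring
      rcases le_total ‖z.1‖ ‖z.1 - z.2‖ with hc | hc
      · have : ‖z.1 - z.2‖ ^ (-2 : ℝ) ≤ ‖z.1‖ ^ (-2 : ℝ) :=
          Real.rpow_le_rpow_of_nonpos hx hc (by norm_num)
        calc _ ≤ ‖z.1‖ ^ (b + 1) * ‖z.1‖ ^ (-2 : ℝ) := by gcongr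
          _ = ‖z.1‖ ^ (b - 1) := (e1 _ hx).symm
          _ ≤ _ := by have : 0 ≤ ‖z.1 - z.2‖ ^ (b - 1) := by positivity
                      linarith
      · have : ‖z.1‖ ^ (b + 1) ≤ ‖z.1 - z.2‖ ^ (b + 1) :=
          Real.rpow_le_rpow_of_nonpos hD hc hb1.le
        calc _ ≤ ‖z.1 - z.2‖ ^ (b + 1) * ‖z.1 - z.2‖ ^ (-2 : ℝ) := by gcongr
          _ = ‖z.1 - z.2‖ ^ (b - 1) := (e1 _ hD).symm
          _ ≤ _ := by have : 0 ≤ ‖z.1‖ ^ (b - 1) := by positivity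
                      linarith
    calc ‖z.2‖ ^ a * (‖z.1‖ ^ (b + 1) * ‖z.1 - z.2‖ ^ (-2 : ℝ))
        ≤ ‖z.2‖ ^ a * (‖z.1‖ ^ (b - 1) + ‖z.1 - z.2‖ ^ (b - 1)) := by gcongr
      _ = _ := by simp only [Pi.add_apply]; ring

lemma integrableOn_snd_weight {a b : ℝ} (ha : -2 < a) (hb : -2 < b) (R : ℝ) :
    IntegrableOn (fun z : E3 × E3 => ‖z.1‖ ^ b * ‖z.2‖ ^ a * (‖z.2‖ * (‖z.1 - z.2‖ ^ 2)⁻¹))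
      (ball 0 R ×ˢ ball 0 R) := by
  refine (integrableOn_fst_weight hb ha R).swap.congr_fun (fun z _ => ?_)
    (measurableSet_ball.prod measurableSet_ball)
  simp only [Function.comp, Prod.fst_swap, Prod.snd_swap, norm_sub_rev z.2]
  ring

/-! ### A Pohozaev type inequality obtained by dilation -/

section
variable {κ a b p q M : ℝ} {u v : E3 → ℝ}

lemma PotSys.M_pos (h : PotSys κ a b p q M u v) : 0 < M := (h.u_pos 0).trans_le (h.u_le 0)

lemma PotSys.src_le (h : PotSys κ a b p q M u v) (y : E3) :
    ‖y‖ ^ a * v y ^ p ≤ ‖y‖ ^ a * M ^ p := by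
  have := h.v_pos y
  have := h.v_le y
  have := h.hp
  gcongr

lemma PotSys.integrableOn_src (h : PotSys κ a b p q M u v) (R : ℝ) :
    IntegrableOn (fun y : E3 => ‖y‖ ^ a * v y ^ p) (ball 0 R) := by
  refine ((integrableOn_ball_norm_rpow (by linarith [h.ha] : -3 < a) R).mul_const (M ^ p)).mono'
    h.src_measurable.aestronglyMeasurable (Eventually.of_forall fun y => ?_)
  rw [Real.norm_of_nonneg (h.src_nonneg y)]
  exact h.src_le y

lemma PotSys.integrableOn_src_mul (h : PotSys κ a b p q M u v) {w : E3 → ℝ} (hw : Continuous w)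
    {C : ℝ} (hC : ∀ x, |w x| ≤ C) (R : ℝ) :
    IntegrableOn (fun y : E3 => ‖y‖ ^ a * v y ^ p * w y) (ball 0 R) :=
  (h.integrableOn_src R).mul_bdd (c := C) hw.aestronglyMeasurable
    (Eventually.of_forall fun y => by simpa using hC y)

lemma PotSys.abs_fst_le (h : PotSys κ a b p q M u v) (x : E3) : |u x| ≤ M := by
  rw [abs_of_pos (h.u_pos x)]; exact h.u_le x

lemma PotSys.integrable_pair (h : PotSys κ a b p q M u v) (t R : ℝ) :
    Integrable (fun z : E3 × E3 => ‖z.1‖ ^ b * u z.1 ^ q *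
      (‖t • z.1 - z.2‖⁻¹ * (‖z.2‖ ^ a * v z.2 ^ p)))
      ((volume.restrict (ball 0 R)).prod (volume.restrict (ball 0 R))) := by
  have hm1 : Measurable fun z : E3 × E3 => ‖z.2‖ ^ a * v z.2 ^ p :=
    h.src_measurable.comp measurable_snd
  have hm2 : Measurable fun z : E3 × E3 => ‖z.1‖ ^ b * u z.1 ^ q :=
    h.symm.src_measurable.comp measurable_fst
  have hm : Measurable (fun z : E3 × E3 => ‖z.1‖ ^ b * u z.1 ^ q *
      (‖t • z.1 - z.2‖⁻¹ * (‖z.2‖ ^ a * v z.2 ^ p))) :=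
    hm2.mul (Measurable.mul (by fun_prop) hm1)
  refine (integrable_prod_iff hm.aestronglyMeasurable).2
    ⟨Eventually.of_forall fun x => ((h.int_u (t • x)).integrableOn).const_mul
      (‖x‖ ^ b * u x ^ q), ?_⟩
  refine ((h.symm.integrableOn_src R).mul_const (κ * M)).mono'
    (hm.norm.stronglyMeasurable.integral_prod_right (ν := volume.restrict (ball 0 R))
      |>.aestronglyMeasurable) (Eventually.of_forall fun x => ?_)
  have hg := h.symm.src_nonneg x
  have hpos : ∀ y, 0 ≤ ‖t • x - y‖⁻¹ * (‖y‖ ^ a * v y ^ p) := fun y =>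
    mul_nonneg (by positivity) (h.src_nonneg y)
  simp only [norm_mul, Real.norm_of_nonneg hg] 
  simp only [← norm_mul, Real.norm_of_nonneg (hpos _)]
  rw [integral_const_mul, Real.norm_of_nonneg
    (mul_nonneg hg (integral_nonneg fun y => hpos y))]
  gcongr
  calc _ ≤ ∫ y, ‖t • x - y‖⁻¹ * (‖y‖ ^ a * v y ^ p) :=
        setIntegral_le_integral (h.int_u _) (Eventually.of_forall hpos)
    _ = κ * u (t • x) := (h.rep_u _).symm
    _ ≤ κ * M := by
        have := h.κ_pos
        have := h.u_le (t • x)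
        gcongr

/-- The double integral of the dilated kernel against both sources over a ball. -/
noncomputable def pairEnergy (a b p q : ℝ) (u v : E3 → ℝ) (R t : ℝ) : ℝ :=
  ∫ x in ball (0 : E3) R, ‖x‖ ^ b * u x ^ q *
    ∫ y in ball (0 : E3) R, ‖t • x - y‖⁻¹ * (‖y‖ ^ a * v y ^ p)

lemma PotSys.integrableOn_pairEnergy (h : PotSys κ a b p q M u v) (t R : ℝ) :
    IntegrableOn (fun x : E3 => ‖x‖ ^ b * u x ^ q *
      ∫ y in ball (0 : E3) R, ‖t • x - y‖⁻¹ * (‖y‖ ^ a * v y ^ p)) (ball 0 R) := by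
  have := (h.integrable_pair t R).integral_prod_left
  simp only [integral_const_mul] at this
  exact this

lemma PotSys.pairEnergy_eq (h : PotSys κ a b p q M u v) (t R : ℝ) :
    pairEnergy a b p q u v R t = ∫ z in (ball 0 R : Set E3) ×ˢ (ball 0 R : Set E3),
      ‖z.1‖ ^ b * u z.1 ^ q * (‖t • z.1 - z.2‖⁻¹ * (‖z.2‖ ^ a * v z.2 ^ p)) := by
  rw [show (volume : Measure (E3 × E3)) = (volume : Measure E3).prod volume from rfl,
    ← Measure.prod_restrict, integral_prod _ (h.integrable_pair t R)]
  simp only [integral_const_mul]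
  rfl

lemma PotSys.pairEnergy_swap_eq (h : PotSys κ a b p q M u v) (t R : ℝ) :
    pairEnergy b a q p v u R t = ∫ z in (ball 0 R : Set E3) ×ˢ (ball 0 R : Set E3),
      ‖z.1‖ ^ b * u z.1 ^ q * (‖t • z.2 - z.1‖⁻¹ * (‖z.2‖ ^ a * v z.2 ^ p)) := by
  rw [h.symm.pairEnergy_eq, show (volume : Measure (E3 × E3)) = (volume : Measure E3).prod volume
    from rfl, ← setIntegral_prod_swap]
  refine integral_congr_ae (Eventually.of_forall fun z => ?_)
  simp only [Prod.fst_swap, Prod.snd_swap]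
  ring

lemma PotSys.pairEnergy_one_symm (h : PotSys κ a b p q M u v) (R : ℝ) :
    pairEnergy b a q p v u R 1 = pairEnergy a b p q u v R 1 := by
  rw [h.pairEnergy_swap_eq, h.pairEnergy_eq]
  simp only [one_smul, norm_sub_rev]

lemma PotSys.pairEnergy_one_le (h : PotSys κ a b p q M u v) (R : ℝ) :
    pairEnergy a b p q u v R 1 ≤ κ * ∫ x in ball (0 : E3) R, ‖x‖ ^ b * u x ^ q * u x := by
  rw [← integral_const_mul]
  refine setIntegral_mono (h.integrableOn_pairEnergy 1 R)
    ((h.symm.integrableOn_src_mul h.hu h.abs_fst_le R).const_mul κ) fun x => ?_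
  have hg := h.symm.src_nonneg x
  have : ∫ y in ball (0 : E3) R, ‖x - y‖⁻¹ * (‖y‖ ^ a * v y ^ p) ≤ κ * u x := by
    rw [h.rep_u]
    exact setIntegral_le_integral (h.int_u x)
      (Eventually.of_forall fun y => mul_nonneg (by positivity) (h.src_nonneg y))
  simp only [one_smul]
  calc _ ≤ ‖x‖ ^ b * u x ^ q * (κ * u x) := by gcongr
    _ = _ := by ring

lemma PotSys.exists_interior_bound (h : PotSys κ a b p q M u v) (R : ℝ) :
    ∃ G : ℝ → ℝ, Tendsto G (𝓝[>] 0) (𝓝 0) ∧ ∀ s > 0,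
      (pairEnergy a b p q u v R 1 - pairEnergy a b p q u v R (1 + s)) +
        (pairEnergy b a q p v u R 1 - pairEnergy b a q p v u R (1 + s))
      ≤ s * pairEnergy a b p q u v R 1 + s * G s := by
  set B : Set (E3 × E3) := (ball 0 R : Set E3) ×ˢ (ball 0 R : Set E3) with hB
  set gf : E3 × E3 → ℝ := fun z => ‖z.1‖ ^ b * u z.1 ^ q * (‖z.2‖ ^ a * v z.2 ^ p) with hgf
  have hgf0 : ∀ z, 0 ≤ gf z := fun z => mul_nonneg (h.symm.src_nonneg _) (h.src_nonneg _)
  have hgfm : Measurable gf :=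
    (h.symm.src_measurable.comp measurable_fst).mul (h.src_measurable.comp measurable_snd)
  let Q : ℝ → E3 × E3 → ℝ := fun s z => gf z * (2 * ‖z.1 - z.2‖⁻¹ *
    (s⁻¹ * min 1 (s ^ 2 * (‖z.1‖ ^ 2 + ‖z.2‖ ^ 2) / (4 * ‖z.1 - z.2‖ ^ 2))))
  have hQm : ∀ s, Measurable (Q s) := fun s => hgfm.mul (by fun_prop)
  have hQ0 : ∀ s > 0, ∀ z, 0 ≤ Q s z := fun s hs z => mul_nonneg (hgf0 z) (by positivity)
  let D : E3 × E3 → ℝ := fun z => M ^ q * M ^ p * (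
    ‖z.1‖ ^ b * ‖z.2‖ ^ a * (‖z.1‖ * (‖z.1 - z.2‖ ^ 2)⁻¹) +
    ‖z.1‖ ^ b * ‖z.2‖ ^ a * (‖z.2‖ * (‖z.1 - z.2‖ ^ 2)⁻¹))
  have hD : IntegrableOn D B := ((integrableOn_fst_weight h.ha h.hb R).add
    (integrableOn_snd_weight h.ha h.hb R)).const_mul _
  have hQD : ∀ s > 0, ∀ z, Q s z ≤ D z := by
    intro s hs z
    have hmin : s⁻¹ * min 1 (s ^ 2 * (‖z.1‖ ^ 2 + ‖z.2‖ ^ 2) / (4 * ‖z.1 - z.2‖ ^ 2))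
        ≤ (‖z.1‖ + ‖z.2‖) / (2 * ‖z.1 - z.2‖) := by
      set r := s * (‖z.1‖ + ‖z.2‖) / (2 * ‖z.1 - z.2‖) with hr
      have hr0 : 0 ≤ r := by positivity
      have h1 : s ^ 2 * (‖z.1‖ ^ 2 + ‖z.2‖ ^ 2) / (4 * ‖z.1 - z.2‖ ^ 2) ≤ r ^ 2 := by
        rw [hr, div_pow, mul_pow, mul_pow]
        norm_num
        gcongr
        nlinarith [norm_nonneg z.1, norm_nonneg z.2, mul_nonneg (norm_nonneg z.1) (norm_nonneg z.2)]
      have h2 : min 1 (s ^ 2 * (‖z.1‖ ^ 2 + ‖z.2‖ ^ 2) / (4 * ‖z.1 - z.2‖ ^ 2)) ≤ r := by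
        rcases le_total 1 r with h3 | h3
        · exact (min_le_left _ _).trans h3
        · exact ((min_le_right _ _).trans h1).trans (by nlinarith)
      rw [inv_mul_le_iff₀ hs]
      exact h2.trans (le_of_eq (by rw [hr]; ring))
    have h4 : gf z ≤ M ^ q * M ^ p * (‖z.1‖ ^ b * ‖z.2‖ ^ a) := by
      calc gf z ≤ (‖z.1‖ ^ b * M ^ q) * (‖z.2‖ ^ a * M ^ p) :=
            mul_le_mul (h.symm.src_le _) (h.src_le _) (h.src_nonneg _)
              (by have := h.M_pos; positivity)
        _ = _ := by ring
    have hM := h.M_pos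
    calc Q s z ≤ M ^ q * M ^ p * (‖z.1‖ ^ b * ‖z.2‖ ^ a) *
          (2 * ‖z.1 - z.2‖⁻¹ * ((‖z.1‖ + ‖z.2‖) / (2 * ‖z.1 - z.2‖))) := by
            simp only [Q]; gcongr
      _ = D z := by
        simp only [D]
        rw [div_eq_mul_inv, mul_inv]
        ring
  have hQi : ∀ s > 0, IntegrableOn (Q s) B := fun s hs =>
    hD.mono' (hQm s).aestronglyMeasurable (Eventually.of_forall fun z => by
      rw [Real.norm_of_nonneg (hQ0 s hs z)]; exact hQD s hs z)
  refine ⟨fun s => ∫ z in B, Q s z, ?_, fun s hs => ?_⟩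
  · rw [show 𝓝 (0 : ℝ) = 𝓝 (∫ z in B, (0 : ℝ)) by simp]
    refine tendsto_integral_filter_of_dominated_convergence D
      (Eventually.of_forall fun s => (hQm s).aestronglyMeasurable) ?_ hD
      (Eventually.of_forall fun z => ?_)
    · filter_upwards [self_mem_nhdsWithin] with s hs
      exact Eventually.of_forall fun z => by
        rw [Real.norm_of_nonneg (hQ0 s hs z)]; exact hQD s hs z
    · set c := gf z * (2 * ‖z.1 - z.2‖⁻¹ * ((‖z.1‖ ^ 2 + ‖z.2‖ ^ 2) / (4 * ‖z.1 - z.2‖ ^ 2)))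
        with hc
      have hlim : Tendsto (fun s : ℝ => s * c) (𝓝[>] 0) (𝓝 0) := by
        have : Tendsto (fun s : ℝ => s * c) (𝓝 0) (𝓝 (0 * c)) :=
          (continuous_id.mul continuous_const).tendsto 0
        rw [zero_mul] at this
        exact this.mono_left nhdsWithin_le_nhds
      refine tendsto_of_tendsto_of_tendsto_of_le_of_le' tendsto_const_nhds hlim ?_ ?_
      · filter_upwards [self_mem_nhdsWithin] with s hs using hQ0 s hs z
      · filter_upwards [self_mem_nhdsWithin] with s hs
        have hs' : 0 < s := hs
        have : s⁻¹ * min 1 (s ^ 2 * (‖z.1‖ ^ 2 + ‖z.2‖ ^ 2) / (4 * ‖z.1 - z.2‖ ^ 2))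
            ≤ s * ((‖z.1‖ ^ 2 + ‖z.2‖ ^ 2) / (4 * ‖z.1 - z.2‖ ^ 2)) := by
          rw [inv_mul_le_iff₀ hs']
          exact (min_le_right _ _).trans (le_of_eq (by ring))
        have h0 := hgf0 z
        calc Q s z ≤ gf z * (2 * ‖z.1 - z.2‖⁻¹ *
              (s * ((‖z.1‖ ^ 2 + ‖z.2‖ ^ 2) / (4 * ‖z.1 - z.2‖ ^ 2)))) := by
                simp only [Q]; gcongr
          _ = s * c := by rw [hc]; ring
  · have hi1 : ∀ t, IntegrableOn (fun z : E3 × E3 => ‖z.1‖ ^ b * u z.1 ^ q *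
        (‖t • z.1 - z.2‖⁻¹ * (‖z.2‖ ^ a * v z.2 ^ p))) B := fun t => by
      have := h.integrable_pair t R
      rwa [Measure.prod_restrict] at this
    have hi2 : ∀ t, IntegrableOn (fun z : E3 × E3 => ‖z.1‖ ^ b * u z.1 ^ q *
        (‖t • z.2 - z.1‖⁻¹ * (‖z.2‖ ^ a * v z.2 ^ p))) B := fun t => by
      have := (h.symm.integrable_pair t R).swap
      rw [Measure.prod_restrict] at this
      refine this.congr (Eventually.of_forall fun z => ?_)
      simp only [Function.comp, Prod.fst_swap, Prod.snd_swap]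
      ring
    have hl1 := (hi1 1).sub (hi1 (1 + s))
    have hl2 := (hi2 1).sub (hi2 (1 + s))
    have hr1 := (hi1 1).const_mul s
    have hr2 := (hQi s hs).const_mul s
    rw [h.pairEnergy_swap_eq 1, h.pairEnergy_swap_eq (1 + s), h.pairEnergy_eq 1,
      h.pairEnergy_eq (1 + s), ← integral_sub (hi1 _) (hi1 _), ← integral_sub (hi2 _) (hi2 _),
      ← integral_const_mul, ← integral_const_mul]
    refine (integral_add hl1 hl2).symm.trans_le (le_of_le_of_eq ?_ (integral_add hr1 hr2))
    refine integral_mono_ae (hl1.add hl2) (hr1.add hr2) ?_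
    filter_upwards [ae_restrict_of_ae (ae_prod_ne_smul 1),
      ae_restrict_of_ae (ae_prod_ne_smul (1 + s)),
      ae_restrict_of_ae (ae_prod_swap (ae_prod_ne_smul (1 + s)))] with z h1 h2 h3
    rw [one_smul] at h1
    have key := mul_le_mul_of_nonneg_left (inv_sub_inv_dilate_le hs h1 h2 h3) (hgf0 z)
    simp only [one_smul, Q, hgf, Pi.sub_apply] at key ⊢
    have : s * s⁻¹ = 1 := mul_inv_cancel₀ hs.ne'
    calc _ = _ := ?_
      _ ≤ _ := key
      _ = _ := ?_
    · ring
    · linear_combination (-(‖z.1‖ ^ b * u z.1 ^ q * (‖z.2‖ ^ a * v z.2 ^ p)) * (2 * ‖z.1 - z.2‖⁻¹ *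
        min 1 (s ^ 2 * (‖z.1‖ ^ 2 + ‖z.2‖ ^ 2) / (4 * ‖z.1 - z.2‖ ^ 2)))) * this

end

section
variable {κ a b p q M : ℝ} {u v : E3 → ℝ}

lemma PotSys.integral_mul_sub_dilate_le (h : PotSys κ a b p q M u v) {R δ s F : ℝ}
    (hR : 0 < R) (hδ : 0 < δ) (hs : 0 ≤ s) (hsR : s * R ≤ δ) (hF0 : 0 ≤ F)
    (hF : ∀ y : E3, R ≤ ‖y‖ → ‖y‖ ≤ R + 2 * δ → ‖y‖ ^ a * v y ^ p ≤ F)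
    (hKf : Integrable fun y : E3 => (|‖y‖ - R| + δ)⁻¹ * (‖y‖ ^ a * v y ^ p))
    (hKg : Integrable fun y : E3 => (|‖y‖ - R| + δ)⁻¹ * (‖y‖ ^ b * u y ^ q)) :
    κ * ∫ x in ball (0 : E3) R, ‖x‖ ^ b * u x ^ q * (u x - u ((1 + s) • x)) ≤
      pairEnergy a b p q u v R 1 - pairEnergy a b p q u v R (1 + s) +
      s * (8 * R * (∫ y : E3, (|‖y‖ - R| + δ)⁻¹ * (‖y‖ ^ a * v y ^ p)) *
          (∫ y : E3, (|‖y‖ - R| + δ)⁻¹ * (‖y‖ ^ b * u y ^ q)) +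
        3 * R * δ * ballMoment (-2) * F * ∫ x in ball (0 : E3) R, ‖x‖ ^ b * u x ^ q) := by
  set f : E3 → ℝ := fun y => ‖y‖ ^ a * v y ^ p with hf
  set g : E3 → ℝ := fun y => ‖y‖ ^ b * u y ^ q with hg
  set K : E3 → ℝ := fun y => (|‖y‖ - R| + δ)⁻¹ with hK
  have hf0 : ∀ y, 0 ≤ f y := h.src_nonneg
  have hg0 : ∀ y, 0 ≤ g y := h.symm.src_nonneg
  have hK0 : ∀ y, 0 ≤ K y := fun y => by positivity
  set Kf := ∫ y, K y * f y
  set Kg := ∫ y, K y * g y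
  have hKf0 : 0 ≤ Kf := integral_nonneg fun y => mul_nonneg (hK0 y) (hf0 y)
  set B : Set E3 := ball 0 R with hB
  have hBm : MeasurableSet B := measurableSet_ball
  have hpt : ∀ x ∈ B, κ * (g x * (u x - u ((1 + s) • x))) ≤
      (g x * ∫ y in B, ‖(1 : ℝ) • x - y‖⁻¹ * f y) -
        (g x * ∫ y in B, ‖(1 + s) • x - y‖⁻¹ * f y) +
      (s * (8 * R * Kf) * (K x * g x) + s * (3 * R * δ * ballMoment (-2) * F) * g x) := by
    intro x hx
    have hxR : ‖x‖ < R := by simpa [hB] using hx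
    have hout : ∫ y in Bᶜ, (‖x - y‖⁻¹ * f y - ‖(1 + s) • x - y‖⁻¹ * f y) ≤
        ∫ y, (8 * (s * R) * K x * (K y * f y) + s * R / 2 * F *
          (truncInvSq (3 * δ) ((1 + s) • x - y) + truncInvSq (3 * δ) (x - y))) := by
      have hi3 : Integrable fun y => 8 * (s * R) * K x * (K y * f y) + s * R / 2 * F *
          (truncInvSq (3 * δ) ((1 + s) • x - y) + truncInvSq (3 * δ) (x - y)) :=
        (hKf.const_mul _).add ((((integrable_truncInvSq _).comp_sub_left _).add
          ((integrable_truncInvSq _).comp_sub_left _)).const_mul _)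
      refine le_trans ?_ (setIntegral_le_integral (s := Bᶜ) hi3 (Eventually.of_forall fun y => ?_))
      · refine integral_mono_ae ((h.int_u x).sub (h.int_u _)).integrableOn hi3.integrableOn ?_
        filter_upwards [ae_restrict_mem hBm.compl, ae_restrict_of_ae (ae_ne_point ((1 + s) • x))]
          with y hy hne
        have hyR : R ≤ ‖y‖ := by simpa [hB] using hy
        have := inv_sub_inv_cross_le hs hδ hsR hxR hyR hne.symm (hf0 y) (hF y hyR) hF0
        calc _ = f y * (‖x - y‖⁻¹ - ‖(1 + s) • x - y‖⁻¹) := by ring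
          _ ≤ _ := this
      · have := hK0 x
        have := mul_nonneg (hK0 y) (hf0 y)
        have := truncInvSq_nonneg (3 * δ) ((1 + s) • x - y)
        have := truncInvSq_nonneg (3 * δ) (x - y)
        simp only [Pi.zero_apply]
        positivity
    have hval : ∫ y, (8 * (s * R) * K x * (K y * f y) + s * R / 2 * F *
          (truncInvSq (3 * δ) ((1 + s) • x - y) + truncInvSq (3 * δ) (x - y)))
        = 8 * (s * R) * K x * Kf + s * R / 2 * F * (3 * δ * ballMoment (-2) +
          3 * δ * ballMoment (-2)) := by
      have hi1 := (integrable_truncInvSq (3 * δ)).comp_sub_left ((1 + s) • x)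
      have hi2 := (integrable_truncInvSq (3 * δ)).comp_sub_left x
      have hi12 : Integrable fun y =>
          truncInvSq (3 * δ) ((1 + s) • x - y) + truncInvSq (3 * δ) (x - y) := hi1.add hi2
      rw [integral_add (hKf.const_mul _) (hi12.const_mul _), integral_const_mul,
        integral_const_mul, integral_add hi1 hi2, integral_sub_left_eq_self,
        integral_sub_left_eq_self, integral_truncInvSq (by positivity)]
    rw [integral_sub (h.int_u x).integrableOn (h.int_u _).integrableOn, hval] at hout
    have e1 := integral_add_compl hBm (h.int_u x)
    have e2 := integral_add_compl hBm (h.int_u ((1 + s) • x))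
    rw [← h.rep_u] at e1 e2
    have := mul_le_mul_of_nonneg_left hout (hg0 x)
    rw [one_smul]
    calc κ * (g x * (u x - u ((1 + s) • x)))
        = g x * (κ * u x - κ * u ((1 + s) • x)) := by ring
      _ ≤ _ := by rw [← e1, ← e2]; linarith
  have hint1 := h.integrableOn_pairEnergy 1 R
  have hint2 := h.integrableOn_pairEnergy (1 + s) R
  have hgB := h.symm.integrableOn_src R
  have hint3 : IntegrableOn (fun x => s * (8 * R * Kf) * (K x * g x) +
      s * (3 * R * δ * ballMoment (-2) * F) * g x) B :=
    ((hKg.const_mul _).integrableOn).add (hgB.const_mul _)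
  have hint4 : IntegrableOn (fun x => κ * (g x * (u x - u ((1 + s) • x)))) B := by
    refine (h.symm.integrableOn_src_mul (w := fun x => u x - u ((1 + s) • x))
      (h.hu.sub (h.hu.comp (continuous_const_smul _))) (C := 2 * M) (fun x => ?_) R).const_mul κ
    have := abs_sub (u x) (u ((1 + s) • x))
    linarith [h.abs_fst_le x, h.abs_fst_le ((1 + s) • x)]
  have hmono := setIntegral_mono_on hint4 ((hint1.sub hint2).add hint3) hBm hpt
  rw [integral_const_mul] at hmono
  have e3 : ∫ x in B, (s * (8 * R * Kf) * (K x * g x) +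
      s * (3 * R * δ * ballMoment (-2) * F) * g x) =
      s * (8 * R * Kf) * (∫ x in B, K x * g x) +
      s * (3 * R * δ * ballMoment (-2) * F) * ∫ x in B, g x := by
    rw [integral_add (hKg.const_mul _).integrableOn (hgB.const_mul _), integral_const_mul,
      integral_const_mul]
  have e4 : ∫ x in B, K x * g x ≤ Kg := setIntegral_le_integral hKg
    (Eventually.of_forall fun y => mul_nonneg (hK0 y) (hg0 y))
  have e5 := integral_add (hint1.sub hint2) hint3
  have e6 := integral_sub hint1 hint2
  have e7 : s * (8 * R * Kf) * (∫ x in B, K x * g x) ≤ s * (8 * R * Kf) * Kg := by gcongr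
  refine hmono.trans (e5.trans_le ((add_le_add e6.le e3.le).trans ?_))
  simp only [pairEnergy]
  linarith

lemma PotSys.le_integral_mul_sub_dilate (h : PotSys κ a b p q M u v) {R δ s S : ℝ}
    (hR : 0 < R) (hs : 0 ≤ s) (hsR : s * R ≤ δ)
    (hS : ∀ x : E3, |‖x‖ - R| ≤ δ → u x ≤ S) :
    (1 - (1 + s) ^ (-(3 + b))) / (q + 1) * ((∫ x in ball (0 : E3) R, ‖x‖ ^ b * u x ^ q * u x)
        - S ^ (q + 1) * (R ^ (3 + b) * ballMoment b)) ≤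
      ∫ x in ball (0 : E3) R, ‖x‖ ^ b * u x ^ q * (u x - u ((1 + s) • x)) := by
  have hq := h.hq
  have hb := h.hb
  set t := 1 + s with ht
  have ht1 : 1 ≤ t := by linarith
  have ht0 : 0 < t := by linarith
  have hu0 : ∀ x, 0 ≤ u x := fun x => (h.u_pos x).le
  set e : E3 → ℝ := fun x => ‖x‖ ^ b * u x ^ q * u x with he
  have hpow : ∀ x, u x ^ (q + 1) = u x ^ q * u x := fun x => by
    rw [Real.rpow_add_one (h.u_pos x).ne']
  have heint : ∀ r, IntegrableOn e (ball 0 r) := fun r =>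
    h.symm.integrableOn_src_mul h.hu h.abs_fst_le r
  have hscale : ∫ x in ball (0 : E3) R, ‖x‖ ^ b * u (t • x) ^ (q + 1)
      = t ^ (-(3 + b)) * ∫ x in ball (0 : E3) (t * R), e x := by
    have h1 := Measure.setIntegral_comp_smul_of_pos (volume : Measure E3) e (ball 0 R) ht0
    rw [_root_.smul_ball ht0.ne', smul_zero, Real.norm_of_nonneg ht0.le] at h1
    have h2 : ∀ x : E3, e (t • x) = t ^ b * (‖x‖ ^ b * u (t • x) ^ (q + 1)) := fun x => by
      simp only [he, norm_smul, Real.norm_of_nonneg ht0.le, hpow]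
      rw [Real.mul_rpow ht0.le (norm_nonneg _)]
      ring
    simp only [h2, integral_const_mul, finrank_euclideanSpace_fin, smul_eq_mul] at h1
    have h3 : t ^ (-(3 + b)) = (t ^ 3)⁻¹ * (t ^ b)⁻¹ := by
      rw [neg_add, Real.rpow_add ht0, Real.rpow_neg ht0.le, Real.rpow_neg ht0.le]
      norm_num
    have h4 : t ^ b ≠ 0 := by positivity
    rw [h3, mul_comm ((t ^ 3)⁻¹), mul_assoc, ← h1]
    field_simp
  have hann : ∫ x in ball (0 : E3) (t * R), e x ≤ (∫ x in ball (0 : E3) R, e x)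
      + S ^ (q + 1) * ((t ^ (3 + b) - 1) * (R ^ (3 + b) * ballMoment b)) := by
    have hsub : ball (0 : E3) R ⊆ ball 0 (t * R) := ball_subset_ball (by nlinarith)
    have hsplit := setIntegral_sdiff measurableSet_ball (heint (t * R)) hsub
    have hw := integrableOn_ball_norm_rpow (by linarith : -3 < b) (t * R)
    have hsplit2 := setIntegral_sdiff measurableSet_ball hw hsub
    rw [setIntegral_ball_norm_rpow _ (by positivity), setIntegral_ball_norm_rpow _ hR,
      Real.mul_rpow ht0.le hR.le] at hsplit2
    have hmono : ∫ x in ball (0 : E3) (t * R) \ ball 0 R, e x ≤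
        ∫ x in ball (0 : E3) (t * R) \ ball 0 R, S ^ (q + 1) * ‖x‖ ^ b := by
      refine setIntegral_mono_on ((heint _).mono_set sdiff_subset)
        (IntegrableOn.mono_set (hw.const_mul _) sdiff_subset) (measurableSet_ball.diff measurableSet_ball)
        fun x hx => ?_
      have h1 : ‖x‖ < t * R := by simpa using hx.1
      have h2 : R ≤ ‖x‖ := by simpa using hx.2
      have h3 : u x ≤ S := hS x (by rw [abs_of_nonneg (by linarith)]; rw [ht] at h1; linarith)
      have h4 := hu0 x
      simp only [he]
      rw [mul_assoc, ← hpow, mul_comm]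
      gcongr
    rw [integral_const_mul, hsplit2] at hmono
    linarith
  have hu2 : IntegrableOn (fun x => ‖x‖ ^ b * u (t • x) ^ (q + 1)) (ball (0 : E3) R) := by
    have hc : Continuous fun x => u (t • x) := h.hu.comp (continuous_const_smul _)
    refine ((integrableOn_ball_norm_rpow (by linarith : -3 < b) R).mul_const
      (M ^ (q + 1))).mono' (measurable_norm_rpow_mul hc b (q + 1)).aestronglyMeasurable
      (Eventually.of_forall fun x => ?_)
    have h1 := hu0 (t • x)
    have h2 := h.u_le (t • x)
    rw [Real.norm_of_nonneg (by positivity)]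
    gcongr
  have hintg : IntegrableOn (fun x => ‖x‖ ^ b * u x ^ q * (u x - u (t • x))) (ball (0 : E3) R) := by
    refine h.symm.integrableOn_src_mul (w := fun x => u x - u (t • x))
      (h.hu.sub (h.hu.comp (continuous_const_smul _))) (C := 2 * M) (fun x => ?_) R
    have := abs_sub (u x) (u (t • x))
    linarith [h.abs_fst_le x, h.abs_fst_le (t • x)]
  have hyoung : ∫ x in ball (0 : E3) R, (q + 1)⁻¹ * (e x - ‖x‖ ^ b * u (t • x) ^ (q + 1)) ≤
      ∫ x in ball (0 : E3) R, ‖x‖ ^ b * u x ^ q * (u x - u (t • x)) := by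
    refine setIntegral_mono (((heint R).sub hu2).const_mul _) hintg fun x => ?_
    have hconj : ((q + 1) / q).HolderConjugate (q + 1) := by
      rw [Real.holderConjugate_iff]
      constructor
      · rw [lt_div_iff₀ hq]; linarith
      · field_simp
    have hY := Real.young_inequality_of_nonneg (by have := hu0 x; positivity : 0 ≤ u x ^ q)
      (hu0 (t • x)) hconj
    rw [← Real.rpow_mul (hu0 x), mul_div_cancel₀ _ hq.ne'] at hY
    have hY2 : u x ^ q * u (t • x) ≤ q / (q + 1) * (u x ^ q * u x)
        + (q + 1)⁻¹ * u (t • x) ^ (q + 1) := by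
      refine hY.trans (le_of_eq ?_)
      rw [hpow]; field_simp
    have e1 : q / (q + 1) = 1 - (q + 1)⁻¹ := by field_simp; ring
    rw [e1] at hY2
    have := mul_le_mul_of_nonneg_left hY2 (by positivity : 0 ≤ ‖x‖ ^ b)
    simp only [he]
    linarith
  rw [integral_const_mul, integral_sub (heint R) hu2, hscale] at hyoung
  refine le_trans ?_ hyoung
  have hq1 : 0 ≤ (q + 1)⁻¹ := by positivity
  have ht3 : t ^ (-(3 + b)) * t ^ (3 + b) = 1 := by
    rw [← Real.rpow_add ht0, neg_add_cancel, Real.rpow_zero]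
  have h5 := mul_le_mul_of_nonneg_left hann (by positivity : 0 ≤ t ^ (-(3 + b)))
  have h6 : t ^ (-(3 + b)) * ((∫ x in ball (0 : E3) R, e x)
      + S ^ (q + 1) * ((t ^ (3 + b) - 1) * (R ^ (3 + b) * ballMoment b)))
      = t ^ (-(3 + b)) * (∫ x in ball (0 : E3) R, e x) + S ^ (q + 1) *
        ((1 - t ^ (-(3 + b))) * (R ^ (3 + b) * ballMoment b)) := by
    linear_combination S ^ (q + 1) * (R ^ (3 + b) * ballMoment b) * ht3
  rw [h6] at h5
  have h7 := mul_le_mul_of_nonneg_left h5 hq1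
  rw [div_eq_mul_inv]
  linarith

lemma tendsto_one_sub_rpow_neg_div (c : ℝ) :
    Tendsto (fun s : ℝ => s⁻¹ * (1 - (1 + s) ^ (-c))) (𝓝[>] 0) (𝓝 c) := by
  have h1 : HasDerivAt (fun t : ℝ => -t ^ (-c)) (-(-c * 1 ^ (-c - 1))) 1 :=
    (Real.hasDerivAt_rpow_const (Or.inl one_ne_zero)).neg
  have := h1.tendsto_slope_zero_right
  simp only [Real.one_rpow, mul_one, neg_neg, smul_eq_mul] at this
  refine this.congr fun s => ?_
  ring

/-- A localized Pohozaev inequality. -/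
theorem PotSys.pohozaev (h : PotSys κ a b p q M u v) {R δ Su Sv Ff Fg : ℝ}
    (hR : 0 < R) (hδ : 0 < δ) (hFf0 : 0 ≤ Ff) (hFg0 : 0 ≤ Fg)
    (hFf : ∀ y : E3, R ≤ ‖y‖ → ‖y‖ ≤ R + 2 * δ → ‖y‖ ^ a * v y ^ p ≤ Ff)
    (hFg : ∀ y : E3, R ≤ ‖y‖ → ‖y‖ ≤ R + 2 * δ → ‖y‖ ^ b * u y ^ q ≤ Fg)
    (hSu : ∀ x : E3, |‖x‖ - R| ≤ δ → u x ≤ Su) (hSv : ∀ x : E3, |‖x‖ - R| ≤ δ → v x ≤ Sv)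
    (hKf : Integrable fun y : E3 => (|‖y‖ - R| + δ)⁻¹ * (‖y‖ ^ a * v y ^ p))
    (hKg : Integrable fun y : E3 => (|‖y‖ - R| + δ)⁻¹ * (‖y‖ ^ b * u y ^ q)) :
    κ * ((3 + b) / (q + 1) * ((∫ x in ball (0 : E3) R, ‖x‖ ^ b * u x ^ q * u x)
        - Su ^ (q + 1) * (R ^ (3 + b) * ballMoment b)) +
      (3 + a) / (p + 1) * ((∫ x in ball (0 : E3) R, ‖x‖ ^ a * v x ^ p * v x)
        - Sv ^ (p + 1) * (R ^ (3 + a) * ballMoment a))) ≤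
    pairEnergy a b p q u v R 1 +
      (16 * R * (∫ y : E3, (|‖y‖ - R| + δ)⁻¹ * (‖y‖ ^ a * v y ^ p)) *
          (∫ y : E3, (|‖y‖ - R| + δ)⁻¹ * (‖y‖ ^ b * u y ^ q)) +
        3 * R * δ * ballMoment (-2) * (Ff * (∫ x in ball (0 : E3) R, ‖x‖ ^ b * u x ^ q) +
          Fg * ∫ x in ball (0 : E3) R, ‖x‖ ^ a * v x ^ p)) := by
  obtain ⟨G, hG, hGle⟩ := h.exists_interior_bound R
  set Eg := ∫ x in ball (0 : E3) R, ‖x‖ ^ b * u x ^ q * u x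
  set Ef := ∫ x in ball (0 : E3) R, ‖x‖ ^ a * v x ^ p * v x
  set Cg := Eg - Su ^ (q + 1) * (R ^ (3 + b) * ballMoment b)
  set Cf := Ef - Sv ^ (p + 1) * (R ^ (3 + a) * ballMoment a)
  set E := 16 * R * (∫ y : E3, (|‖y‖ - R| + δ)⁻¹ * (‖y‖ ^ a * v y ^ p)) *
          (∫ y : E3, (|‖y‖ - R| + δ)⁻¹ * (‖y‖ ^ b * u y ^ q)) +
        3 * R * δ * ballMoment (-2) * (Ff * (∫ x in ball (0 : E3) R, ‖x‖ ^ b * u x ^ q) +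
          Fg * ∫ x in ball (0 : E3) R, ‖x‖ ^ a * v x ^ p) with hE
  have hlim : Tendsto (fun s : ℝ => κ * ((s⁻¹ * (1 - (1 + s) ^ (-(3 + b)))) / (q + 1) * Cg +
      (s⁻¹ * (1 - (1 + s) ^ (-(3 + a)))) / (p + 1) * Cf)) (𝓝[>] 0)
      (𝓝 (κ * ((3 + b) / (q + 1) * Cg + (3 + a) / (p + 1) * Cf))) :=
    ((((tendsto_one_sub_rpow_neg_div (3 + b)).div_const _).mul_const _).add
      (((tendsto_one_sub_rpow_neg_div (3 + a)).div_const _).mul_const _)).const_mul κ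
  have hlim2 : Tendsto (fun s => pairEnergy a b p q u v R 1 + G s + E) (𝓝[>] 0)
      (𝓝 (pairEnergy a b p q u v R 1 + 0 + E)) := (hG.const_add _).add_const _
  rw [add_zero] at hlim2
  refine le_of_tendsto_of_tendsto hlim hlim2 ?_
  have hsmall : ∀ᶠ s in 𝓝[>] (0 : ℝ), s < δ / R :=
    nhdsWithin_le_nhds (eventually_lt_nhds (by positivity))
  filter_upwards [self_mem_nhdsWithin, hsmall] with s hs hsδ
  have hs0 : 0 < s := hs
  have hsR : s * R ≤ δ := by rw [lt_div_iff₀ hR] at hsδ; exact hsδ.le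
  have h1 := h.integral_mul_sub_dilate_le hR hδ hs0.le hsR hFf0 hFf hKf hKg
  have h2 := h.symm.integral_mul_sub_dilate_le hR hδ hs0.le hsR hFg0 hFg hKg hKf
  have h3 := mul_le_mul_of_nonneg_left (h.le_integral_mul_sub_dilate hR hs0.le hsR hSu) h.κ_pos.le
  have h4 := mul_le_mul_of_nonneg_left (h.symm.le_integral_mul_sub_dilate hR hs0.le hsR hSv)
    h.κ_pos.le
  have h5 := hGle s hs0
  have key : κ * ((1 - (1 + s) ^ (-(3 + b))) / (q + 1) * Cg) +
      κ * ((1 - (1 + s) ^ (-(3 + a))) / (p + 1) * Cf) ≤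
      s * (pairEnergy a b p q u v R 1 + G s + E) := by
    rw [hE]; linarith
  refine le_of_mul_le_mul_left (le_trans (le_of_eq ?_) key) hs0
  field_simp

end

/-! ### Nonexistence below the critical hyperbola -/

section
variable {κ a b p q M : ℝ} {u v : E3 → ℝ}

lemma PotSys.mul_le_of_near_sphere (h : PotSys κ a b p q M u v) {R δ F : ℝ} (hδ : 0 < δ)
    (hF0 : 0 ≤ F) (hF : ∀ y : E3, |‖y‖ - R| ≤ 2 * δ → ‖y‖ ^ a * v y ^ p ≤ F)
    (hKf : Integrable fun y : E3 => (|‖y‖ - R| + δ)⁻¹ * (‖y‖ ^ a * v y ^ p)) {x : E3}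
    (hx : |‖x‖ - R| ≤ δ) :
    κ * u x ≤ 3 * (∫ y : E3, (|‖y‖ - R| + δ)⁻¹ * (‖y‖ ^ a * v y ^ p))
      + F * (δ ^ 2 * ballMoment (-1)) := by
  set T : E3 → ℝ := (ball 0 δ).indicator fun z => ‖z‖ ^ (-1 : ℝ) with hT
  have hTi : Integrable T := (integrable_indicator_iff measurableSet_ball).2
    (integrableOn_ball_norm_rpow (by norm_num) δ)
  have hT0 : ∀ z, 0 ≤ T z := fun z => indicator_nonneg (fun z _ => by positivity) z
  have hTx : ∫ y, T (x - y) = δ ^ 2 * ballMoment (-1) := by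
    rw [integral_sub_left_eq_self T, hT, integral_indicator measurableSet_ball,
      setIntegral_ball_norm_rpow _ hδ]
    norm_num
  have hrhs : Integrable fun y => 3 * ((|‖y‖ - R| + δ)⁻¹ * (‖y‖ ^ a * v y ^ p)) + F * T (x - y) :=
    (hKf.const_mul 3).add ((hTi.comp_sub_left x).const_mul F)
  have hval : ∫ y, (3 * ((|‖y‖ - R| + δ)⁻¹ * (‖y‖ ^ a * v y ^ p)) + F * T (x - y)) =
      3 * (∫ y : E3, (|‖y‖ - R| + δ)⁻¹ * (‖y‖ ^ a * v y ^ p))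
      + F * (δ ^ 2 * ballMoment (-1)) := by
    rw [integral_add (hKf.const_mul 3) ((hTi.comp_sub_left x).const_mul F), integral_const_mul,
      integral_const_mul, hTx]
  rw [h.rep_u, ← hval]
  refine integral_mono_ae (h.int_u x) hrhs ?_
  filter_upwards [ae_ne_point x] with y hy
  have hf0 := h.src_nonneg y
  have hd : 0 < ‖x - y‖ := norm_pos_iff.2 (sub_ne_zero.2 hy.symm)
  have hdist : |‖y‖ - R| ≤ ‖x - y‖ + δ := by
    have h1 := abs_norm_sub_norm_le x y
    rw [abs_sub_comm] at h1
    calc |‖y‖ - R| = |(‖y‖ - ‖x‖) + (‖x‖ - R)| := by ring_nf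
      _ ≤ |‖y‖ - ‖x‖| + |‖x‖ - R| := abs_add_le _ _
      _ ≤ _ := by linarith
  rcases lt_or_ge ‖x - y‖ δ with hc | hc
  · have hmem : x - y ∈ ball (0 : E3) δ := by simpa using hc
    have : T (x - y) = ‖x - y‖⁻¹ := by
      rw [hT, indicator_of_mem hmem, Real.rpow_neg_one]
    rw [this]
    have h2 := hF y (by linarith)
    have h3 : ‖x - y‖⁻¹ * (‖y‖ ^ a * v y ^ p) ≤ F * ‖x - y‖⁻¹ := by
      rw [mul_comm]; gcongr
    have h4 : 0 ≤ 3 * ((|‖y‖ - R| + δ)⁻¹ * (‖y‖ ^ a * v y ^ p)) := by positivity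
    linarith
  · have h2 : ‖x - y‖⁻¹ ≤ 3 * (|‖y‖ - R| + δ)⁻¹ := by
      rw [← div_eq_mul_inv, inv_le_comm₀ hd (by positivity), inv_div, div_le_iff₀ (by norm_num)]
      linarith
    have h3 := mul_le_mul_of_nonneg_right h2 hf0
    have := mul_nonneg hF0 (hT0 (x - y))
    linarith

lemma PotSys.exists_common_good_radius (h : PotSys κ a b p q M u v) {X δ : ℝ} (hX : 0 < X)
    (hδ : 0 < δ) : ∃ R ∈ Icc X (2 * X),
      (Integrable fun y : E3 => (|‖y‖ - R| + δ)⁻¹ * (‖y‖ ^ a * v y ^ p)) ∧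
      (Integrable fun y : E3 => (|‖y‖ - R| + δ)⁻¹ * (‖y‖ ^ b * u y ^ q)) ∧
      (∫ y : E3, (|‖y‖ - R| + δ)⁻¹ * (‖y‖ ^ a * v y ^ p)) ≤
        (10 * Real.log ((4 * X + δ) / δ) + 3) * 2 * avgPot (fun y => ‖y‖ ^ a * v y ^ p) X ∧
      (∫ y : E3, (|‖y‖ - R| + δ)⁻¹ * (‖y‖ ^ b * u y ^ q)) ≤
        (10 * Real.log ((4 * X + δ) / δ) + 3) * 2 * avgPot (fun y => ‖y‖ ^ b * u y ^ q) X := by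
  set f : E3 → ℝ := fun y => ‖y‖ ^ a * v y ^ p
  set g : E3 → ℝ := fun y => ‖y‖ ^ b * u y ^ q
  have hf0 : ∀ y, 0 ≤ f y := h.src_nonneg
  have hg0 : ∀ y, 0 ≤ g y := h.symm.src_nonneg
  have hU : 0 < avgPot f X := h.avgPot_pos hX
  have hV : 0 < avgPot g X := h.symm.avgPot_pos hX
  set U := avgPot f X
  set V := avgPot g X
  set w : E3 → ℝ := fun y => U⁻¹ * f y + V⁻¹ * g y with hw
  have hwm : Measurable w :=
    (h.src_measurable.const_mul _).add (h.symm.src_measurable.const_mul _)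
  have hw0 : ∀ y, 0 ≤ w y := fun y =>
    add_nonneg (mul_nonneg (by positivity) (hf0 y)) (mul_nonneg (by positivity) (hg0 y))
  have hwi : Integrable fun y => ‖0 - y‖⁻¹ * w y := by
    refine (((h.int_u 0).const_mul U⁻¹).add ((h.int_v 0).const_mul V⁻¹)).congr
      (Eventually.of_forall fun y => ?_)
    simp only [hw, Pi.add_apply, f, g]
    ring
  have havg : avgPot w X = 2 := by
    have e1 : avgPot w X = U⁻¹ * U + V⁻¹ * V := by
      have hi1 := integrable_avgPot h.src_measurable h.src_nonneg (h.int_u 0) hX.le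
      have hi2 := integrable_avgPot h.symm.src_measurable h.symm.src_nonneg (h.int_v 0) hX.le
      simp only [U, V, avgPot]
      rw [← integral_const_mul, ← integral_const_mul,
        ← integral_add (hi1.const_mul _) (hi2.const_mul _)]
      refine integral_congr_ae (Eventually.of_forall fun y => ?_)
      simp only [hw, U, V, avgPot]
      ring
    rw [e1, inv_mul_cancel₀ hU.ne', inv_mul_cancel₀ hV.ne']
    norm_num
  obtain ⟨R, hR, hi, hle⟩ := exists_good_radius hwm hw0 hwi hX hδ
  rw [havg] at hle
  have part : ∀ {c : ℝ} {s : E3 → ℝ}, 0 < c → Measurable s → (∀ y, 0 ≤ s y) →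
      (∀ y, c⁻¹ * s y ≤ w y) → (Integrable fun y : E3 => (|‖y‖ - R| + δ)⁻¹ * s y) ∧
      (∫ y : E3, (|‖y‖ - R| + δ)⁻¹ * s y) ≤
        (10 * Real.log ((4 * X + δ) / δ) + 3) * 2 * c := by
    intro c s hc hsm hs0 hsw
    have hpt : ∀ y, (|‖y‖ - R| + δ)⁻¹ * s y ≤ c * ((|‖y‖ - R| + δ)⁻¹ * w y) := fun y => by
      have h1 : s y ≤ c * w y := by
        have := hsw y
        rwa [inv_mul_le_iff₀ hc] at this
      calc _ ≤ (|‖y‖ - R| + δ)⁻¹ * (c * w y) := by gcongr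
        _ = _ := by ring
    have hintg : Integrable fun y : E3 => (|‖y‖ - R| + δ)⁻¹ * s y := by
      refine (hi.const_mul c).mono' (Measurable.aestronglyMeasurable ?_)
        (Eventually.of_forall fun y => ?_)
      · exact Measurable.mul (by fun_prop) hsm
      · rw [Real.norm_of_nonneg (mul_nonneg (by positivity) (hs0 y))]
        exact hpt y
    refine ⟨hintg, (integral_mono hintg (hi.const_mul c) hpt).trans ?_⟩
    rw [integral_const_mul, mul_comm]
    gcongr
  have pf := part hU h.src_measurable hf0 fun y =>
    le_add_of_nonneg_right (mul_nonneg (by positivity) (hg0 y))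
  have pg := part hV h.symm.src_measurable hg0 fun y =>
    le_add_of_nonneg_left (mul_nonneg (by positivity) (hf0 y))
  exact ⟨R, hR, pf.1, pg.1, pf.2, pg.2⟩

lemma log_ratio_le {K ε X : ℝ} (hK : 0 < K) (hε : 0 < ε) (hX : 1 ≤ X) :
    10 * Real.log ((4 * X + X ^ (-K)) / X ^ (-K)) + 3 ≤
      (10 * (5 ^ (ε / (K + 1)) / (ε / (K + 1))) + 3) * X ^ ε := by
  have hX0 : 0 < X := by linarith
  have h1 : (4 * X + X ^ (-K)) / X ^ (-K) ≤ 5 * X ^ (K + 1) := by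
    have h2 : X ^ (-K) ≤ X := (Real.rpow_le_one_of_one_le_of_nonpos hX (by linarith)).trans hX
    rw [div_le_iff₀ (by positivity), mul_assoc, ← Real.rpow_add hX0]
    norm_num
    linarith
  have h3 : Real.log ((4 * X + X ^ (-K)) / X ^ (-K)) ≤
      5 ^ (ε / (K + 1)) / (ε / (K + 1)) * X ^ ε := by
    refine (Real.log_le_rpow_div (by positivity) (by positivity : 0 < ε / (K + 1))).trans ?_
    have h4 : ((4 * X + X ^ (-K)) / X ^ (-K)) ^ (ε / (K + 1)) ≤ 5 ^ (ε / (K + 1)) * X ^ ε := by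
      calc _ ≤ (5 * X ^ (K + 1)) ^ (ε / (K + 1)) := by gcongr
        _ = _ := by
          rw [Real.mul_rpow (by norm_num) (by positivity), ← Real.rpow_mul hX0.le,
            mul_div_cancel₀ _ (by positivity)]
    rw [div_mul_eq_mul_div]
    gcongr
  have h5 : 1 ≤ X ^ ε := Real.one_le_rpow hX hε.le
  linarith

lemma rpow_le_mul_rpow_of_near {s X r : ℝ} (hX : 0 < X) (h1 : X / 4 ≤ r) (h2 : r ≤ 4 * X) :
    r ^ s ≤ 4 ^ |s| * X ^ s := by
  have hr : 0 < r := by linarith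
  rcases le_total 0 s with hs | hs
  · rw [abs_of_nonneg hs, ← Real.mul_rpow (by norm_num) hX.le]
    gcongr
  · rw [abs_of_nonpos hs, Real.rpow_neg (by norm_num), ← Real.inv_rpow (by norm_num),
      ← Real.mul_rpow (by norm_num) hX.le]
    refine Real.rpow_le_rpow_of_nonpos (by positivity) (by linarith) hs

lemma PotSys.exists_boundary_bounds (h : PotSys κ a b p q M u v) {A ε K γ α : ℝ} (hA : 0 ≤ A)
    (hK1 : 1 ≤ K) (hK2 : a + α - ε ≤ 2 * K) (hK3 : 5 + a + b ≤ K) (hγ1 : γ ≤ 1)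
    (hγ : (q + 1) * (ε - α) + (3 + b) ≤ -γ) :
    ∃ C, 0 ≤ C ∧ ∀ X R : ℝ, 2 ≤ X → R ∈ Icc X (2 * X) →
      (Integrable fun y : E3 => (|‖y‖ - R| + X ^ (-K))⁻¹ * (‖y‖ ^ a * v y ^ p)) →
      (∫ y : E3, (|‖y‖ - R| + X ^ (-K))⁻¹ * (‖y‖ ^ a * v y ^ p)) ≤ A * X ^ (ε - α) →
      ∃ S F : ℝ, 0 ≤ F ∧
        (∀ y : E3, R ≤ ‖y‖ → ‖y‖ ≤ R + 2 * X ^ (-K) → ‖y‖ ^ a * v y ^ p ≤ F) ∧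
        (∀ x : E3, |‖x‖ - R| ≤ X ^ (-K) → u x ≤ S) ∧
        S ^ (q + 1) * R ^ (3 + b) ≤ C * X ^ (-γ) ∧
        R * X ^ (-K) * (F * ∫ x in ball (0 : E3) R, ‖x‖ ^ b * u x ^ q) ≤ C * X ^ (-γ) := by
  have hκ := h.κ_pos
  have hM := h.M_pos
  have hb := h.hb
  have hq := h.hq
  have hm1 := ballMoment_pos (s := -1) (by norm_num)
  have hmb := ballMoment_pos (s := b) (by linarith)
  set F1 := 4 ^ |a| * M ^ p with hF1
  have hF10 : 0 < F1 := by positivity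
  set S1 := (3 * A + F1 * ballMoment (-1)) / κ with hS1
  have hS10 : 0 ≤ S1 := by positivity
  set C1 := S1 ^ (q + 1) * 2 ^ (3 + b) with hC1
  set C2 := 2 * F1 * (M ^ q * (2 ^ (3 + b) * ballMoment b)) with hC2
  have hC10 : 0 ≤ C1 := by positivity
  have hC20 : 0 ≤ C2 := by positivity
  refine ⟨C1 + C2, by positivity, fun X R hX hR hKi hKle => ?_⟩
  have hX0 : 0 < X := by linarith
  have hX1 : 1 ≤ X := by linarith
  have hR0 : 0 < R := by linarith [hR.1]
  set δ := X ^ (-K) with hδ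
  have hδ0 : 0 < δ := by positivity
  have hδ1 : δ ≤ X / 4 := by
    have : δ ≤ X ^ (-1 : ℝ) := Real.rpow_le_rpow_of_exponent_le hX1 (by linarith)
    rw [Real.rpow_neg_one] at this
    have h2 : X⁻¹ ≤ 2⁻¹ := by gcongr
    linarith
  have hF : ∀ y : E3, |‖y‖ - R| ≤ 2 * δ → ‖y‖ ^ a * v y ^ p ≤ F1 * X ^ a := fun y hy => by
    rw [abs_le] at hy
    refine (h.src_le y).trans ?_
    have := rpow_le_mul_rpow_of_near (s := a) hX0 (r := ‖y‖) (by linarith [hR.1]) (by linarith [hR.2])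
    calc _ ≤ (4 ^ |a| * X ^ a) * M ^ p := by gcongr
      _ = _ := by rw [hF1]; ring
  have hR3 : R ^ (3 + b) ≤ 2 ^ (3 + b) * X ^ (3 + b) := by
    rw [← Real.mul_rpow (by norm_num) hX0.le]
    have := hR.2
    have : 0 ≤ 3 + b := by linarith
    gcongr
  have hγX : 0 ≤ X ^ (-γ) := by positivity
  refine ⟨S1 * X ^ (ε - α), F1 * X ^ a, by positivity, fun y h1 h2 => hF y ?_, fun x hx => ?_,
    ?_, ?_⟩
  · rw [abs_of_nonneg (by linarith)]; linarith
  · have h1 := h.mul_le_of_near_sphere hδ0 (by positivity) hF hKi hx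
    have h2 : X ^ a * δ ^ 2 ≤ X ^ (ε - α) := by
      rw [hδ, ← Real.rpow_natCast, ← Real.rpow_mul hX0.le, ← Real.rpow_add hX0]
      refine Real.rpow_le_rpow_of_exponent_le hX1 ?_
      push_cast
      linarith
    have h3 : F1 * X ^ a * (δ ^ 2 * ballMoment (-1)) ≤ F1 * ballMoment (-1) * X ^ (ε - α) := by
      calc _ = F1 * ballMoment (-1) * (X ^ a * δ ^ 2) := by ring
        _ ≤ _ := by gcongr
    rw [hS1, div_mul_eq_mul_div, le_div_iff₀ hκ]
    linarith
  · calc (S1 * X ^ (ε - α)) ^ (q + 1) * R ^ (3 + b)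
        ≤ (S1 * X ^ (ε - α)) ^ (q + 1) * (2 ^ (3 + b) * X ^ (3 + b)) := by gcongr
      _ = C1 * X ^ ((q + 1) * (ε - α) + (3 + b)) := by
        rw [Real.mul_rpow hS10 (by positivity), ← Real.rpow_mul hX0.le,
          Real.rpow_add hX0 ((q + 1) * (ε - α)), mul_comm (ε - α), hC1]
        ring
      _ ≤ C1 * X ^ (-γ) := by
        gcongr
      _ ≤ _ := by nlinarith
  · have h1 : ∫ x in ball (0 : E3) R, ‖x‖ ^ b * u x ^ q ≤
        M ^ q * (R ^ (3 + b) * ballMoment b) := by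
      rw [← setIntegral_ball_norm_rpow _ hR0, ← integral_const_mul]
      refine setIntegral_mono (h.symm.integrableOn_src R)
        ((integrableOn_ball_norm_rpow (by linarith) R).const_mul _) fun x => ?_
      rw [mul_comm (M ^ q)]
      exact h.symm.src_le x
    have hR2 := hR.2
    calc _ ≤ (2 * X) * δ * (F1 * X ^ a * (M ^ q * (2 ^ (3 + b) * X ^ (3 + b) * ballMoment b))) := by
          have h2 := h1.trans (mul_le_mul_of_nonneg_left
            (mul_le_mul_of_nonneg_right hR3 hmb.le) (by positivity : 0 ≤ M ^ q))
          gcongr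
          exact mul_nonneg (by positivity)
            (integral_nonneg fun y => h.symm.src_nonneg y)
      _ = C2 * (X * (δ * (X ^ a * X ^ (3 + b)))) := by rw [hC2]; ring
      _ = C2 * X ^ (1 + (-K + (a + (3 + b)))) := by
          rw [Real.rpow_add hX0 1, Real.rpow_add hX0 (-K), Real.rpow_add hX0 a, Real.rpow_one]
      _ ≤ C2 * X ^ (-γ) := by
          gcongr
          linarith
      _ ≤ _ := by nlinarith

lemma PotSys.energy_pos (h : PotSys κ a b p q M u v) :
    0 < ∫ x in ball (0 : E3) 1, ‖x‖ ^ b * u x ^ q * u x := by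
  have hpos : ∀ x : E3, x ≠ 0 → 0 < ‖x‖ ^ b * u x ^ q * u x := fun x hx => by
    have := norm_pos_iff.2 hx
    have := h.u_pos x
    positivity
  rw [setIntegral_pos_iff_support_of_nonneg_ae
    (Eventually.of_forall fun x => mul_nonneg (h.symm.src_nonneg x) (h.u_pos x).le)
    (h.symm.integrableOn_src_mul h.hu h.abs_fst_le 1)]
  have hsub : ball (0 : E3) 1 \ {0} ⊆
      Function.support (fun x => ‖x‖ ^ b * u x ^ q * u x) ∩ ball (0 : E3) 1 :=
    fun x hx => ⟨(hpos x hx.2).ne', hx.1⟩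
  refine lt_of_lt_of_le ?_ (measure_mono hsub)
  rw [measure_sdiff_null (by simp)]
  exact measure_ball_pos _ _ one_pos

lemma PotSys.energy_mono (h : PotSys κ a b p q M u v) {R : ℝ} (hR : 1 ≤ R) :
    ∫ x in ball (0 : E3) 1, ‖x‖ ^ b * u x ^ q * u x ≤
      ∫ x in ball (0 : E3) R, ‖x‖ ^ b * u x ^ q * u x :=
  setIntegral_mono_set (h.symm.integrableOn_src_mul h.hu h.abs_fst_le R)
    (Eventually.of_forall fun x => mul_nonneg (h.symm.src_nonneg x) (h.u_pos x).le)
    (ball_subset_ball hR).eventuallyLE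

lemma decayExp_mul {a b p q : ℝ} (hpq : 1 < p * q) :
    decayExp a b p q * q = decayExp b a q p + (2 + b) := by
  have h1 : p * q - 1 ≠ 0 := by linarith
  rw [decayExp, decayExp, mul_comm q p]
  field_simp
  ring

lemma one_lt_decayExp_add {a b p q : ℝ} (hp : 0 < p) (hq : 0 < q) (hpq : 1 < p * q)
    (hc : 1 < (3 + a) / (p + 1) + (3 + b) / (q + 1)) :
    1 < decayExp a b p q + decayExp b a q p := by
  rw [div_add_div _ _ (by positivity) (by positivity), lt_div_iff₀ (by positivity)] at hc
  rw [decayExp, decayExp, mul_comm q p, ← add_div, lt_div_iff₀ (by linarith)]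
  linarith

set_option maxHeartbeats 1000000 in
theorem PotSys.not_supercritical (h : PotSys κ a b p q M u v)
    (hc : 1 < (3 + a) / (p + 1) + (3 + b) / (q + 1)) : False := by
  have hκ := h.κ_pos
  have hp := h.hp
  have hq := h.hq
  have ha := h.ha
  have hb := h.hb
  have hpq := h.one_lt_mul
  have hαβ := one_lt_decayExp_add hp hq hpq hc
  have hα := decayExp_mul (a := a) (b := b) hpq
  have hβ := decayExp_mul (a := b) (b := a) (p := q) (q := p) (by linarith)
  obtain ⟨Cf, hCf, hUf⟩ := h.avgPot_le_rpow
  obtain ⟨Cg, hCg, hUg⟩ := h.symm.avgPot_le_rpow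
  set α := decayExp a b p q
  set β := decayExp b a q p
  set ε := (α + β - 1) / (2 * (p + q + 2)) with hε
  have hε0 : 0 < ε := div_pos (by linarith) (by positivity)
  have hεe : ε * (p + q + 2) = (α + β - 1) / 2 := by rw [hε]; field_simp
  set γ := min 1 ((α + β - 1) / 2) with hγ
  have hγ0 : 0 < γ := lt_min one_pos (by linarith)
  have hγ1 : γ ≤ 1 := min_le_left _ _
  have hγ2 : γ ≤ (α + β - 1) / 2 := min_le_right _ _
  have hεp : 0 < ε * p := by positivity
  have hεq : 0 < ε * q := by positivity
  set K := 10 + |a| + |b| + |α| + |β| with hK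
  have := le_abs_self a
  have := le_abs_self b
  have := le_abs_self α
  have := le_abs_self β
  have := abs_nonneg a
  have := abs_nonneg b
  have := abs_nonneg α
  have := abs_nonneg β
  set L := 10 * (5 ^ (ε / (K + 1)) / (ε / (K + 1))) + 3 with hL
  have hL0 : 0 < L := by positivity
  obtain ⟨C1, hC1, hb1⟩ := h.exists_boundary_bounds (A := L * 2 * Cf) (ε := ε) (K := K) (γ := γ)
    (α := α) (by positivity) (by linarith) (by linarith) (by linarith) hγ1 (by nlinarith)
  obtain ⟨C2, hC2, hb2⟩ := h.symm.exists_boundary_bounds (A := L * 2 * Cg) (ε := ε) (K := K)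
    (γ := γ) (α := β) (by positivity) (by linarith) (by linarith) (by linarith) hγ1 (by nlinarith)
  set lam := (3 + b) / (q + 1) with hlam
  set mu := (3 + a) / (p + 1) with hmu
  have hlam0 : 0 < lam := div_pos (by linarith) (by linarith)
  have hmu0 : 0 < mu := div_pos (by linarith) (by linarith)
  have hma := ballMoment_pos (s := a) (by linarith)
  have hmb := ballMoment_pos (s := b) (by linarith)
  have hm2 := ballMoment_pos (s := -2) (by norm_num)
  set C := κ * (lam * (C1 * ballMoment b) + mu * (C2 * ballMoment a)) +
    32 * (L * 2 * Cf) * (L * 2 * Cg) + 3 * ballMoment (-2) * (C1 + C2) with hC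
  set θ := lam + mu - 1 with hθ
  have hθ0 : 0 < θ := by linarith
  set m := min (∫ x in ball (0 : E3) 1, ‖x‖ ^ b * u x ^ q * u x)
    (∫ x in ball (0 : E3) 1, ‖x‖ ^ a * v x ^ p * v x) with hm
  have hm0 : 0 < m := lt_min h.energy_pos h.symm.energy_pos
  have main : ∀ X : ℝ, 2 ≤ X → κ * θ * m ≤ C * X ^ (-γ) := by
    intro X hX
    have hX0 : 0 < X := by linarith
    have hX1 : 1 ≤ X := by linarith
    have hδ : 0 < X ^ (-K) := by positivity
    obtain ⟨R, hR, hif, hig, hlf, hlg⟩ := h.exists_common_good_radius hX0 hδ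
    have hR0 : 0 < R := by linarith [hR.1]
    have hlog := log_ratio_le (K := K) (by linarith) hε0 hX1
    have bound : ∀ {I U c e : ℝ}, 0 ≤ U → U ≤ c * X ^ (-e) →
        I ≤ (10 * Real.log ((4 * X + X ^ (-K)) / X ^ (-K)) + 3) * 2 * U →
        I ≤ L * 2 * c * X ^ (ε - e) := by
      intro I U c e hU hUc hI
      refine hI.trans ?_
      rw [← hL] at hlog
      calc _ ≤ (L * X ^ ε) * 2 * (c * X ^ (-e)) := by gcongr
        _ = L * 2 * c * (X ^ ε * X ^ (-e)) := by ring
        _ = _ := by rw [← Real.rpow_add hX0, ← sub_eq_add_neg]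
    have hkf := bound (avgPot_nonneg h.src_nonneg hX0.le) (hUf X hX0) hlf
    have hkg := bound (avgPot_nonneg h.symm.src_nonneg hX0.le) (hUg X hX0) hlg
    obtain ⟨Su, Ff, hFf0, hFf, hSu, hSu2, hFf2⟩ := hb1 X R hX hR hif hkf
    obtain ⟨Sv, Fg, hFg0, hFg, hSv, hSv2, hFg2⟩ := hb2 X R hX hR hig hkg
    have hpoh := h.pohozaev hR0 hδ hFf0 hFg0 hFf hFg hSu hSv hif hig
    have hW1 := h.pairEnergy_one_le R
    have hW2 := h.symm.pairEnergy_one_le R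
    rw [h.pairEnergy_one_symm] at hW2
    have hE1 : m ≤ _ := (min_le_left _ _).trans (h.energy_mono (R := R) (by linarith [hR.1]))
    have hE2 : m ≤ _ := (min_le_right _ _).trans (h.symm.energy_mono (R := R) (by linarith [hR.1]))
    set Eg := ∫ x in ball (0 : E3) R, ‖x‖ ^ b * u x ^ q * u x
    set Ef := ∫ x in ball (0 : E3) R, ‖x‖ ^ a * v x ^ p * v x
    set W := pairEnergy a b p q u v R 1
    set Kf := ∫ y : E3, (|‖y‖ - R| + X ^ (-K))⁻¹ * (‖y‖ ^ a * v y ^ p)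
    set Kg := ∫ y : E3, (|‖y‖ - R| + X ^ (-K))⁻¹ * (‖y‖ ^ b * u y ^ q)
    have hKg0 : 0 ≤ Kg := integral_nonneg fun y => mul_nonneg (by positivity) (h.symm.src_nonneg y)
    have hKf0 : 0 ≤ Kf := integral_nonneg fun y => mul_nonneg (by positivity) (h.src_nonneg y)
    have hKK : R * Kf * Kg ≤ 2 * (L * 2 * Cf) * (L * 2 * Cg) * X ^ (-γ) := by
      have hR2 := hR.2
      calc R * Kf * Kg ≤ (2 * X) * (L * 2 * Cf * X ^ (ε - α)) * (L * 2 * Cg * X ^ (ε - β)) := by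
            gcongr
        _ = 2 * (L * 2 * Cf) * (L * 2 * Cg) * X ^ (1 + (ε - α) + (ε - β)) := by
            rw [Real.rpow_add hX0, Real.rpow_add hX0, Real.rpow_one]; ring
        _ ≤ _ := by
            gcongr
            nlinarith
    have hlow : κ * θ * m ≤ κ * (lam * Eg + mu * Ef) - W := by
      rcases le_total Eg Ef with hc | hc
      · have e1 : κ * (lam * Eg + mu * Eg) ≤ κ * (lam * Eg + mu * Ef) := by gcongr
        have e2 : κ * θ * m ≤ κ * θ * Eg := by gcongr
        rw [hθ] at e2 ⊢
        linarith
      · have e1 : κ * (lam * Ef + mu * Ef) ≤ κ * (lam * Eg + mu * Ef) := by gcongr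
        have e2 : κ * θ * m ≤ κ * θ * Ef := by gcongr
        rw [hθ] at e2 ⊢
        linarith
    have e3 := mul_le_mul_of_nonneg_left hSu2 (by positivity : 0 ≤ κ * (lam * ballMoment b))
    have e4 := mul_le_mul_of_nonneg_left hSv2 (by positivity : 0 ≤ κ * (mu * ballMoment a))
    have e5 := mul_le_mul_of_nonneg_left (add_le_add hFf2 hFg2)
      (by positivity : 0 ≤ 3 * ballMoment (-2))
    rw [hC]
    linarith
  have hlim : Tendsto (fun X : ℝ => C * X ^ (-γ)) atTop (𝓝 (C * 0)) :=
    (tendsto_rpow_neg_atTop hγ0).const_mul C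
  have := ge_of_tendsto hlim (eventually_atTop.2 ⟨2, main⟩)
  rw [mul_zero] at this
  exact absurd this (not_le.2 (by positivity))

end

theorem not_exists_bounded_of_supercritical {a b p q : ℝ} (ha : -2 < a) (hb : -2 < b) (hp : 0 < p)
    (hq : 0 < q) (hc : 1 < (3 + a) / (p + 1) + (3 + b) / (q + 1)) :
    ¬ ∃ u v : E3 → ℝ, IsHHSol a b p q univ u v ∧ (∃ M, ∀ x, u x ≤ M) ∧ (∃ M, ∀ x, v x ≤ M) := by
  rintro ⟨u, v, h, ⟨M₁, h₁⟩, M₂, h₂⟩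
  exact (h.potSys ha hb hp hq (M := max M₁ M₂) (fun x => (h₁ x).trans (le_max_left _ _))
    (fun x => (h₂ x).trans (le_max_right _ _))).not_supercritical hc

/-- Minus the radial solution of `-Δw = r^a φ(r)` in dimension three with `w(0) = 0`. -/
noncomputable def radPot (a : ℝ) (φ : ℝ → ℝ) (r : ℝ) : ℝ :=
  |r| ^ (2 + a) * ∫ σ in (0 : ℝ)..1, σ ^ (1 + a) * (1 - σ) * φ (r * σ)

/-- The mass `∫₀^r τ^(2+a) φ(τ) dτ`, in scaled form. -/
noncomputable def radMass (a : ℝ) (φ : ℝ → ℝ) (r : ℝ) : ℝ :=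
  |r| ^ (3 + a) * ∫ σ in (0 : ℝ)..1, σ ^ (2 + a) * φ (r * σ)

section
variable {a r : ℝ} {φ ψ : ℝ → ℝ}

lemma intervalIntegrable_rpow_mul {e : ℝ} (he : -1 < e) (hφ : Continuous φ) (x y : ℝ) :
    IntervalIntegrable (fun τ => τ ^ e * φ τ) volume x y :=
  (intervalIntegral.intervalIntegrable_rpow' he).mul_continuousOn hφ.continuousOn

lemma intervalIntegrable_radPot (ha : -2 < a) (hφ : Continuous φ) (r : ℝ) :
    IntervalIntegrable (fun σ => σ ^ (1 + a) * (1 - σ) * φ (r * σ)) volume 0 1 := by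
  have := intervalIntegrable_rpow_mul (e := 1 + a) (φ := fun σ => (1 - σ) * φ (r * σ))
    (by linarith) (by fun_prop) 0 1
  simpa only [mul_assoc] using this

lemma intervalIntegrable_radMass (ha : -2 < a) (hφ : Continuous φ) (r : ℝ) :
    IntervalIntegrable (fun σ => σ ^ (2 + a) * φ (r * σ)) volume 0 1 :=
  intervalIntegrable_rpow_mul (φ := fun σ => φ (r * σ)) (by linarith) (by fun_prop) 0 1

lemma continuous_radPot (ha : -2 < a) (hφ : Continuous φ) {C : ℝ} (hC : ∀ x, |φ x| ≤ C) :
    Continuous (radPot a φ) := by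
  refine Continuous.mul (continuous_abs.rpow_const fun _ => Or.inr (by linarith)) ?_
  refine intervalIntegral.continuous_of_dominated_interval
    (bound := fun σ => σ ^ (1 + a) * C) (fun x => ?_) (fun x => ?_) ?_ ?_
  · have := (intervalIntegrable_radPot ha hφ x).aestronglyMeasurable
    rwa [uIoc_of_le zero_le_one]
  · refine Eventually.of_forall fun σ hσ => ?_
    rw [uIoc_of_le zero_le_one] at hσ
    rw [mul_assoc, norm_mul, norm_mul, Real.norm_of_nonneg (Real.rpow_nonneg hσ.1.le _),
      Real.norm_eq_abs, Real.norm_eq_abs, abs_of_nonneg (by linarith [hσ.2])]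
    refine mul_le_mul_of_nonneg_left ?_ (Real.rpow_nonneg hσ.1.le _)
    have := hC (x * σ)
    have := abs_nonneg (φ (x * σ))
    nlinarith [hσ.1]
  · exact intervalIntegrable_rpow_mul (φ := fun _ => C) (by linarith) continuous_const 0 1
  · exact Eventually.of_forall fun σ _ => by fun_prop

lemma radPot_zero_right (ha : -2 < a) (φ : ℝ → ℝ) : radPot a φ 0 = 0 := by
  rw [radPot, abs_zero, Real.zero_rpow (by linarith), zero_mul]

lemma mul_mem_Icc {r σ : ℝ} (hr : 0 ≤ r) (hσ : σ ∈ Icc (0 : ℝ) 1) : r * σ ∈ Icc 0 r :=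
  ⟨mul_nonneg hr hσ.1, mul_le_of_le_one_right hr hσ.2⟩

lemma radPot_congr (hr : 0 ≤ r) (h : EqOn φ ψ (Icc 0 r)) : radPot a φ r = radPot a ψ r := by
  unfold radPot
  congr 1
  refine intervalIntegral.integral_congr fun σ hσ => ?_
  rw [uIcc_of_le zero_le_one] at hσ
  simp only [h (mul_mem_Icc hr hσ)]

lemma radPot_le (ha : -2 < a) (hφ : Continuous φ) (hr : 0 ≤ r) {C : ℝ} (hC : 0 ≤ C)
    (h : ∀ x ∈ Icc 0 r, φ x ≤ C) : radPot a φ r ≤ C * (r ^ (2 + a) / (2 + a)) := by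
  have h1 : ∫ σ in (0 : ℝ)..1, σ ^ (1 + a) * (1 - σ) * φ (r * σ) ≤
      ∫ σ in (0 : ℝ)..1, σ ^ (1 + a) * C := by
    refine intervalIntegral.integral_mono_on zero_le_one (intervalIntegrable_radPot ha hφ r)
      (intervalIntegrable_rpow_mul (φ := fun _ => C) (by linarith) continuous_const 0 1)
      fun σ hσ => ?_
    rw [mul_assoc]
    refine mul_le_mul_of_nonneg_left ?_ (Real.rpow_nonneg hσ.1 _)
    have := h _ (mul_mem_Icc hr hσ)
    nlinarith [hσ.1, hσ.2]
  rw [intervalIntegral.integral_mul_const, integral_rpow (Or.inl (by linarith)),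
    Real.one_rpow, Real.zero_rpow (by linarith), show 1 + a + 1 = 2 + a by ring] at h1
  rw [radPot, abs_of_nonneg hr]
  calc _ ≤ r ^ (2 + a) * ((1 - 0) / (2 + a) * C) := by gcongr
    _ = _ := by ring

lemma radMass_nonneg (hr : 0 ≤ r) (h : ∀ x ∈ Icc 0 r, 0 ≤ φ x) : 0 ≤ radMass a φ r := by
  refine mul_nonneg (by positivity) (intervalIntegral.integral_nonneg zero_le_one fun σ hσ => ?_)
  exact mul_nonneg (Real.rpow_nonneg hσ.1 _) (h _ (mul_mem_Icc hr hσ))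

lemma radMass_pos (ha : -2 < a) (hφ : Continuous φ) (hr : 0 < r) (h : ∀ x ∈ Icc 0 r, 0 < φ x) :
    0 < radMass a φ r := by
  refine mul_pos (by positivity) (intervalIntegral.intervalIntegral_pos_of_pos_on
    (intervalIntegrable_radMass ha hφ r) (fun σ hσ => ?_) zero_lt_one)
  exact mul_pos (Real.rpow_pos_of_pos hσ.1 _) (h _ (mul_mem_Icc hr.le ⟨hσ.1.le, hσ.2.le⟩))

lemma radMass_le (ha : -2 < a) (hφ : Continuous φ) (hr : 0 ≤ r) {C : ℝ} (hC : 0 ≤ C)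
    (h : ∀ x ∈ Icc 0 r, φ x ≤ C) : radMass a φ r ≤ C * r ^ (3 + a) := by
  have h1 : ∫ σ in (0 : ℝ)..1, σ ^ (2 + a) * φ (r * σ) ≤ ∫ σ in (0 : ℝ)..1, C := by
    refine intervalIntegral.integral_mono_on zero_le_one (intervalIntegrable_radMass ha hφ r)
      intervalIntegrable_const fun σ hσ => ?_
    have h2 := h _ (mul_mem_Icc hr hσ)
    have h3 := Real.rpow_le_one hσ.1 hσ.2 (by linarith : 0 ≤ 2 + a)
    have h4 := Real.rpow_nonneg hσ.1 (2 + a)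
    calc _ ≤ σ ^ (2 + a) * C := by gcongr
      _ ≤ 1 * C := by gcongr
      _ = C := one_mul C
  rw [intervalIntegral.integral_const, smul_eq_mul, sub_zero, one_mul] at h1
  rw [radMass, abs_of_nonneg hr, mul_comm C]
  gcongr

lemma radMass_eq (hr : 0 < r) (φ : ℝ → ℝ) (a : ℝ) :
    radMass a φ r = ∫ τ in (0 : ℝ)..r, τ ^ (2 + a) * φ τ := by
  have h := intervalIntegral.integral_comp_mul_left (a := 0) (b := 1)
    (fun τ => τ ^ (2 + a) * φ τ) hr.ne'
  rw [mul_zero, mul_one, smul_eq_mul, eq_inv_mul_iff_mul_eq₀ hr.ne',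
    ← intervalIntegral.integral_const_mul] at h
  rw [← h, radMass, abs_of_pos hr, ← intervalIntegral.integral_const_mul]
  refine intervalIntegral.integral_congr fun σ hσ => ?_
  rw [uIcc_of_le zero_le_one] at hσ
  rw [Real.mul_rpow hr.le hσ.1, show (3 + a) = 1 + (2 + a) by ring, Real.rpow_add hr,
    Real.rpow_one]
  ring

lemma rpow_two_add (hr : 0 < r) : r ^ (2 + a) = r * r ^ (1 + a) := by
  rw [show 2 + a = 1 + (1 + a) by ring, Real.rpow_add hr, Real.rpow_one]

lemma rpow_three_add (hr : 0 < r) : r ^ (3 + a) = r ^ 2 * r ^ (1 + a) := by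
  rw [show 3 + a = 2 + (1 + a) by ring, Real.rpow_add hr, Real.rpow_two]

lemma radPot_eq (ha : -2 < a) (hφ : Continuous φ) (hr : 0 < r) :
    radPot a φ r = (∫ τ in (0 : ℝ)..r, τ ^ (1 + a) * φ τ) - r⁻¹ * radMass a φ r := by
  have h := intervalIntegral.integral_comp_mul_left (a := 0) (b := 1)
    (fun τ => τ ^ (1 + a) * φ τ) hr.ne'
  rw [mul_zero, mul_one, smul_eq_mul, eq_inv_mul_iff_mul_eq₀ hr.ne',
    ← intervalIntegral.integral_const_mul] at h
  rw [← h, radPot, radMass, abs_of_pos hr, ← intervalIntegral.integral_const_mul,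
    ← intervalIntegral.integral_const_mul, ← intervalIntegral.integral_const_mul,
    ← intervalIntegral.integral_sub]
  · refine intervalIntegral.integral_congr_ae (Eventually.of_forall fun σ hσ => ?_)
    rw [uIoc_of_le zero_le_one] at hσ
    rw [Real.mul_rpow hr.le hσ.1.le, rpow_three_add hr, rpow_two_add hr, rpow_two_add hσ.1]
    field_simp
  · have := (intervalIntegrable_rpow_mul (e := 1 + a) (φ := fun σ => φ (r * σ)) (by linarith)
      (by fun_prop) 0 1).const_mul (r * r ^ (1 + a))
    refine this.congr fun σ hσ => ?_
    rw [uIoc_of_le zero_le_one] at hσ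
    rw [Real.mul_rpow hr.le hσ.1.le]
    ring
  · exact ((intervalIntegrable_radMass ha hφ r).const_mul _).const_mul _

lemma hasDerivAt_primitive {e : ℝ} (he : -1 < e) (hφ : Continuous φ) (hr : 0 < r) :
    HasDerivAt (fun r => ∫ τ in (0 : ℝ)..r, τ ^ e * φ τ) (r ^ e * φ r) r := by
  have hc : ContinuousAt (fun τ => τ ^ e * φ τ) r :=
    (Real.continuousAt_rpow_const _ _ (Or.inl hr.ne')).mul hφ.continuousAt
  refine intervalIntegral.integral_hasDerivAt_right (intervalIntegrable_rpow_mul he hφ 0 r) ?_ hc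
  refine ContinuousOn.stronglyMeasurableAtFilter isOpen_Ioi (s := Ioi 0) ?_ r hr
  exact (continuousOn_id.rpow_const fun x hx => Or.inl (ne_of_gt hx)).mul hφ.continuousOn

lemma hasDerivAt_radMass (ha : -2 < a) (hφ : Continuous φ) (hr : 0 < r) :
    HasDerivAt (radMass a φ) (r ^ (2 + a) * φ r) r := by
  refine (hasDerivAt_primitive (by linarith) hφ hr).congr_of_eventuallyEq ?_
  filter_upwards [lt_mem_nhds hr] with s hs using radMass_eq hs φ a

lemma hasDerivAt_radPot (ha : -2 < a) (hφ : Continuous φ) (hr : 0 < r) :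
    HasDerivAt (radPot a φ) (radMass a φ r / r ^ 2) r := by
  have h := (hasDerivAt_primitive (e := 1 + a) (by linarith) hφ hr).sub
    ((hasDerivAt_inv hr.ne').mul (hasDerivAt_radMass ha hφ hr))
  refine (h.congr_deriv ?_).congr_of_eventuallyEq ?_
  · rw [rpow_two_add hr]
    field_simp
    ring
  · filter_upwards [lt_mem_nhds hr] with s hs using radPot_eq ha hφ hs

lemma continuousOn_radPot (ha : -2 < a) (hφ : Continuous φ) (h0 : ∀ x ∈ Icc 0 r, 0 ≤ φ x)
    (h1 : ∀ x ∈ Icc 0 r, φ x ≤ 1) : ContinuousOn (radPot a φ) (Icc 0 r) := by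
  have hc : Continuous fun x => max 0 (min (φ x) 1) := by fun_prop
  have := continuous_radPot ha hc (C := 1) fun x => by
    rw [abs_of_nonneg (le_max_left _ _)]
    exact max_le zero_le_one (min_le_right _ _)
  refine this.continuousOn.congr fun x hx => radPot_congr hx.1 fun y hy => ?_
  have hy' : y ∈ Icc 0 r := ⟨hy.1, hy.2.trans hx.2⟩
  rw [min_eq_left (h1 y hy'), max_eq_right (h0 y hy')]

lemma monotoneOn_radPot (ha : -2 < a) (hφ : Continuous φ) (h0 : ∀ x ∈ Icc 0 r, 0 ≤ φ x)
    (h1 : ∀ x ∈ Icc 0 r, φ x ≤ 1) : MonotoneOn (radPot a φ) (Icc 0 r) := by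
  refine monotoneOn_of_hasDerivWithinAt_nonneg (f' := fun x => radMass a φ x / x ^ 2)
    (convex_Icc 0 r) (continuousOn_radPot ha hφ h0 h1) (fun x hx => ?_) fun x hx => ?_
  · rw [interior_Icc] at hx
    exact (hasDerivAt_radPot ha hφ hx.1).hasDerivWithinAt
  · rw [interior_Icc] at hx
    have := radMass_nonneg (a := a) hx.1.le fun y hy => h0 y ⟨hy.1, hy.2.trans hx.2.le⟩
    positivity

lemma strictMonoOn_radPot (ha : -2 < a) (hφ : Continuous φ) (h0 : ∀ x ∈ Icc 0 r, 0 < φ x)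
    (h1 : ∀ x ∈ Icc 0 r, φ x ≤ 1) : StrictMonoOn (radPot a φ) (Icc 0 r) := by
  refine strictMonoOn_of_hasDerivWithinAt_pos (f' := fun x => radMass a φ x / x ^ 2)
    (convex_Icc 0 r) (continuousOn_radPot ha hφ (fun x hx => (h0 x hx).le) h1) (fun x hx => ?_)
    fun x hx => ?_
  · rw [interior_Icc] at hx
    exact (hasDerivAt_radPot ha hφ hx.1).hasDerivWithinAt
  · rw [interior_Icc] at hx
    have := radMass_pos ha hφ hx.1 fun y hy => h0 y ⟨hy.1, hy.2.trans hx.2.le⟩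
    have := hx.1
    positivity

lemma radPot_sub_le (ha : -2 < a) (hφ : Continuous φ) (h0 : ∀ x ∈ Icc 0 r, 0 ≤ φ x)
    (h1 : ∀ x ∈ Icc 0 r, φ x ≤ 1) :
    MonotoneOn (fun x => x ^ (2 + a) / (2 + a) - radPot a φ x) (Icc 0 r) := by
  refine monotoneOn_of_hasDerivWithinAt_nonneg
    (f' := fun x => x ^ (1 + a) - radMass a φ x / x ^ 2)
    (convex_Icc 0 r) (ContinuousOn.sub ?_ (continuousOn_radPot ha hφ h0 h1)) (fun x hx => ?_)
    fun x hx => ?_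
  · exact ((Real.continuous_rpow_const (by linarith)).div_const _).continuousOn
  · rw [interior_Icc] at hx
    have h := (Real.hasDerivAt_rpow_const (p := 2 + a) (Or.inl hx.1.ne')).div_const (2 + a)
    refine (h.sub (hasDerivAt_radPot ha hφ hx.1)).hasDerivWithinAt.congr_deriv ?_
    rw [mul_div_cancel_left₀ _ (by linarith), show 2 + a - 1 = 1 + a by ring]
  · rw [interior_Icc] at hx
    have h := radMass_le ha hφ hx.1.le zero_le_one fun y hy => h1 y ⟨hy.1, hy.2.trans hx.2.le⟩
    have hx0 := hx.1
    rw [one_mul, rpow_three_add hx0] at h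
    rw [sub_nonneg, div_le_iff₀ (by positivity)]
    linarith

end

/-- Exponential weight making the Volterra operators contractive. -/
noncomputable def expWeight (a b l r : ℝ) : ℝ :=
  Real.exp (l * (|r| ^ (2 + a) / (2 + a) + |r| ^ (2 + b) / (2 + b)))

section
open BoundedContinuousFunction
variable {a b l : ℝ}

lemma expWeight_symm (a b l r : ℝ) : expWeight a b l r = expWeight b a l r := by
  rw [expWeight, expWeight, add_comm]

lemma expWeight_pos (a b l r : ℝ) : 0 < expWeight a b l r := Real.exp_pos _

lemma one_le_expWeight (ha : -2 < a) (hb : -2 < b) (hl : 0 ≤ l) (r : ℝ) :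
    1 ≤ expWeight a b l r := by
  have h1 : 0 ≤ 2 + a := by linarith
  have h2 : 0 ≤ 2 + b := by linarith
  exact Real.one_le_exp (by positivity)

lemma continuous_expWeight (ha : -2 < a) (hb : -2 < b) (l : ℝ) :
    Continuous (expWeight a b l) := by
  have h1 : Continuous fun r : ℝ => |r| ^ (2 + a) :=
    continuous_abs.rpow_const fun _ => Or.inr (by linarith)
  have h2 : Continuous fun r : ℝ => |r| ^ (2 + b) :=
    continuous_abs.rpow_const fun _ => Or.inr (by linarith)
  unfold expWeight
  fun_prop

lemma integral_expWeight_le (ha : -2 < a) (hb : -2 < b) (hl : 0 < l) (r : ℝ) :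
    |r| ^ (2 + a) * ∫ σ in (0 : ℝ)..1, σ ^ (1 + a) * expWeight a b l (r * σ) ≤
      expWeight a b l r / l := by
  have hW := continuous_expWeight ha hb l
  have hWr : Continuous fun σ => expWeight a b l (r * σ) := by fun_prop
  have i1 := (intervalIntegrable_rpow_mul (e := 1 + a) (by linarith) hWr 0 1).const_mul
    (|r| ^ (2 + a))
  have i2 := (intervalIntegrable_rpow_mul (e := 1 + b) (by linarith) hWr 0 1).const_mul
    (|r| ^ (2 + b))
  have hd : ∀ e : ℝ, -2 < e → ∀ σ ∈ Ioo (0 : ℝ) 1,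
      HasDerivAt (fun σ => |r * σ| ^ (2 + e) / (2 + e)) (|r| ^ (2 + e) * σ ^ (1 + e)) σ := by
    intro e he σ hσ
    have h := ((Real.hasDerivAt_rpow_const (p := 2 + e) (Or.inl hσ.1.ne')).div_const
      (2 + e)).const_mul (|r| ^ (2 + e))
    refine (h.congr_deriv ?_).congr_of_eventuallyEq ?_
    · rw [mul_div_cancel_left₀ _ (by linarith), show 2 + e - 1 = 1 + e by ring]
    · filter_upwards [lt_mem_nhds hσ.1] with t ht
      rw [abs_mul, abs_of_pos ht, Real.mul_rpow (abs_nonneg r) ht.le, mul_div_assoc]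
  have hF := intervalIntegral.integral_eq_sub_of_hasDerivAt_of_le zero_le_one
    (f := fun σ => expWeight a b l (r * σ) / l)
    (f' := fun σ => |r| ^ (2 + a) * (σ ^ (1 + a) * expWeight a b l (r * σ)) +
      |r| ^ (2 + b) * (σ ^ (1 + b) * expWeight a b l (r * σ)))
    (by fun_prop) (fun σ hσ => by
      have h := ((((hd a ha σ hσ).add (hd b hb σ hσ)).const_mul l).exp).div_const l
      refine h.congr_deriv ?_
      simp only [expWeight, Pi.add_apply]
      field_simp) (i1.add i2)
  rw [intervalIntegral.integral_add i1 i2, intervalIntegral.integral_const_mul,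
    intervalIntegral.integral_const_mul, mul_one] at hF
  have h2 : 0 ≤ |r| ^ (2 + b) * ∫ σ in (0 : ℝ)..1, σ ^ (1 + b) * expWeight a b l (r * σ) := by
    refine mul_nonneg (by positivity) (intervalIntegral.integral_nonneg zero_le_one fun σ hσ => ?_)
    exact mul_nonneg (Real.rpow_nonneg hσ.1 _) (expWeight_pos _ _ _ _).le
  have h3 : 0 ≤ expWeight a b l (r * 0) / l := div_nonneg (expWeight_pos _ _ _ _).le hl.le
  linarith

lemma abs_radPot_sub_le (ha : -2 < a) (hb : -2 < b) (hl : 0 < l) {φ ψ : ℝ → ℝ}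
    (hφ : Continuous φ) (hψ : Continuous ψ) {C : ℝ} (hC : 0 ≤ C)
    (h : ∀ x, |φ x - ψ x| ≤ C * expWeight a b l x) (r : ℝ) :
    |radPot a φ r - radPot a ψ r| ≤ C * (expWeight a b l r / l) := by
  have hW := continuous_expWeight ha hb l
  have hWr : Continuous fun σ => expWeight a b l (r * σ) := by fun_prop
  have hb1 : |∫ σ in (0 : ℝ)..1, (σ ^ (1 + a) * (1 - σ) * φ (r * σ) -
      σ ^ (1 + a) * (1 - σ) * ψ (r * σ))| ≤
      ∫ σ in (0 : ℝ)..1, C * (σ ^ (1 + a) * expWeight a b l (r * σ)) := by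
    rw [← Real.norm_eq_abs]
    refine intervalIntegral.norm_integral_le_of_norm_le zero_le_one
      (Eventually.of_forall fun σ hσ => ?_)
      ((intervalIntegrable_rpow_mul (by linarith) hWr 0 1).const_mul C)
    have h1 := h (r * σ)
    have h0 := Real.rpow_nonneg hσ.1.le (1 + a)
    rw [← mul_sub, mul_assoc, norm_mul, norm_mul, Real.norm_of_nonneg h0, Real.norm_eq_abs,
      Real.norm_eq_abs, abs_of_nonneg (by linarith [hσ.2])]
    have : (1 - σ) * |φ (r * σ) - ψ (r * σ)| ≤ C * expWeight a b l (r * σ) := by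
      nlinarith [hσ.1, abs_nonneg (φ (r * σ) - ψ (r * σ))]
    calc _ ≤ σ ^ (1 + a) * (C * expWeight a b l (r * σ)) := by gcongr
      _ = _ := by ring
  rw [intervalIntegral.integral_const_mul] at hb1
  rw [radPot, radPot, ← mul_sub, ← intervalIntegral.integral_sub
    (intervalIntegrable_radPot ha hφ r) (intervalIntegrable_radPot ha hψ r), abs_mul,
    abs_of_nonneg (by positivity : 0 ≤ |r| ^ (2 + a))]
  calc _ ≤ |r| ^ (2 + a) * (C * ∫ σ in (0 : ℝ)..1, σ ^ (1 + a) * expWeight a b l (r * σ)) := by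
        gcongr
    _ = C * (|r| ^ (2 + a) * ∫ σ in (0 : ℝ)..1, σ ^ (1 + a) * expWeight a b l (r * σ)) := by ring
    _ ≤ _ := by
        gcongr
        exact integral_expWeight_le ha hb hl r

lemma abs_radPot_le_expWeight (ha : -2 < a) (hb : -2 < b) (hl : 0 < l) {φ : ℝ → ℝ}
    (hφ : Continuous φ) (h : ∀ x, |φ x| ≤ 1) (r : ℝ) :
    |radPot a φ r| ≤ expWeight a b l r / l := by
  have := abs_radPot_sub_le ha hb hl hφ (ψ := fun _ => 0) continuous_const zero_le_one
    (fun x => by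
      rw [sub_zero, one_mul]
      exact (h x).trans (one_le_expWeight ha hb hl.le x)) r
  have h0 : radPot a (fun _ => 0) r = 0 := by simp [radPot]
  rwa [h0, sub_zero, one_mul] at this

lemma exists_volterraMap (ha : -2 < a) (hb : -2 < b) (hl : 0 < l) {f : ℝ → ℝ} (hf : Continuous f)
    (hf1 : ∀ x, |f x| ≤ 1) (c : ℝ) (w : ℝ →ᵇ ℝ) :
    ∃ z : ℝ →ᵇ ℝ, ∀ r, z r = (expWeight a b l r)⁻¹ *
      (c - radPot a (fun τ => f (expWeight a b l τ * w τ)) r) := by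
  have hW := continuous_expWeight ha hb l
  have hφ : Continuous fun τ => f (expWeight a b l τ * w τ) := by fun_prop
  refine ⟨BoundedContinuousFunction.ofNormedAddCommGroup _
    ((hW.inv₀ fun r => (expWeight_pos _ _ _ _).ne').mul
      (continuous_const.sub (continuous_radPot ha hφ fun x => hf1 _))) (|c| + 1 / l) fun r => ?_,
    fun r => rfl⟩
  have h1 := abs_radPot_le_expWeight ha hb hl hφ (fun x => hf1 _) r
  have hp := expWeight_pos a b l r
  have h2 := one_le_expWeight ha hb hl.le r
  change ‖(expWeight a b l r)⁻¹ *
    (c - radPot a (fun τ => f (expWeight a b l τ * w τ)) r)‖ ≤ _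
  rw [norm_mul, norm_inv, Real.norm_of_nonneg hp.le, Real.norm_eq_abs, inv_mul_le_iff₀ hp]
  calc _ ≤ |c| + expWeight a b l r / l := (abs_sub _ _).trans (by gcongr)
    _ ≤ expWeight a b l r * |c| + expWeight a b l r * (1 / l) := by
        rw [mul_one_div]
        gcongr
        exact le_mul_of_one_le_left (abs_nonneg c) h2
    _ = _ := by ring

/-- The weighted Volterra operator. -/
noncomputable def volterraMap (ha : -2 < a) (hb : -2 < b) (hl : 0 < l) {f : ℝ → ℝ}
    (hf : Continuous f) (hf1 : ∀ x, |f x| ≤ 1) (c : ℝ) (w : ℝ →ᵇ ℝ) : ℝ →ᵇ ℝ :=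
  (exists_volterraMap ha hb hl hf hf1 c w).choose

lemma volterraMap_apply (ha : -2 < a) (hb : -2 < b) (hl : 0 < l) {f : ℝ → ℝ}
    (hf : Continuous f) (hf1 : ∀ x, |f x| ≤ 1) (c : ℝ) (w : ℝ →ᵇ ℝ) (r : ℝ) :
    volterraMap ha hb hl hf hf1 c w r = (expWeight a b l r)⁻¹ *
      (c - radPot a (fun τ => f (expWeight a b l τ * w τ)) r) :=
  (exists_volterraMap ha hb hl hf hf1 c w).choose_spec r

lemma dist_volterraMap_le (ha : -2 < a) (hb : -2 < b) (hl : 0 < l) {f : ℝ → ℝ} {K : ℝ}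
    (hK : 0 ≤ K) (hf : Continuous f) (hf1 : ∀ x, |f x| ≤ 1) (hfK : ∀ x y, |f x - f y| ≤ K * |x - y|)
    (c : ℝ) (w z : ℝ →ᵇ ℝ) :
    dist (volterraMap ha hb hl hf hf1 c w) (volterraMap ha hb hl hf hf1 c z) ≤
      K / l * dist w z := by
  have hW := continuous_expWeight ha hb l
  refine (BoundedContinuousFunction.dist_le (by positivity)).2 fun r => ?_
  have hp := expWeight_pos a b l r
  have := abs_radPot_sub_le ha hb hl (φ := fun τ => f (expWeight a b l τ * w τ))
    (ψ := fun τ => f (expWeight a b l τ * z τ)) (by fun_prop) (by fun_prop)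
    (C := K * dist w z) (by positivity) (fun x => by
      refine (hfK _ _).trans ?_
      rw [← mul_sub, abs_mul, abs_of_pos (expWeight_pos a b l x), mul_assoc, mul_comm (dist w z)]
      have := BoundedContinuousFunction.dist_coe_le_dist (f := w) (g := z) x
      rw [Real.dist_eq] at this
      have := expWeight_pos a b l x
      gcongr) r
  rw [volterraMap_apply, volterraMap_apply, Real.dist_eq, ← mul_sub, sub_sub_sub_cancel_left,
    abs_mul, abs_inv, abs_of_pos hp, inv_mul_le_iff₀ hp, abs_sub_comm]
  calc _ ≤ _ := this
    _ = _ := by ring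

lemma dist_volterraMap_const_le (ha : -2 < a) (hb : -2 < b) (hl : 0 < l) {f : ℝ → ℝ}
    (hf : Continuous f) (hf1 : ∀ x, |f x| ≤ 1) (c d : ℝ) (w : ℝ →ᵇ ℝ) :
    dist (volterraMap ha hb hl hf hf1 c w) (volterraMap ha hb hl hf hf1 d w) ≤ |c - d| := by
  refine (BoundedContinuousFunction.dist_le (abs_nonneg _)).2 fun r => ?_
  have hp := expWeight_pos a b l r
  rw [volterraMap_apply, volterraMap_apply, Real.dist_eq, ← mul_sub, sub_sub_sub_cancel_right,
    abs_mul, abs_inv, abs_of_pos hp, inv_mul_le_iff₀ hp]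
  exact le_mul_of_one_le_left (abs_nonneg _) (one_le_expWeight ha hb hl.le r)

theorem exists_volterra_flow (ha : -2 < a) (hb : -2 < b) {f g : ℝ → ℝ} {K : ℝ} (hK : 0 ≤ K)
    (hf1 : ∀ x, |f x| ≤ 1) (hg1 : ∀ x, |g x| ≤ 1) (hf : ∀ x y, |f x - f y| ≤ K * |x - y|)
    (hg : ∀ x y, |g x - g y| ≤ K * |x - y|) :
    ∃ u v : ℝ → ℝ → ℝ, (∀ s, Continuous (u s)) ∧ (∀ s, Continuous (v s)) ∧
      (∀ r, Continuous fun s => u s r) ∧ (∀ r, Continuous fun s => v s r) ∧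
      ∀ s r, u s r = 1 - s - radPot a (fun τ => f (v s τ)) r ∧
        v s r = s - radPot b (fun τ => g (u s τ)) r := by
  have cont : ∀ {f : ℝ → ℝ}, (∀ x y, |f x - f y| ≤ K * |x - y|) → Continuous f := fun h =>
    (LipschitzWith.of_dist_le_mul (K := ⟨K, hK⟩) h).continuous
  have hfc := cont hf
  have hgc := cont hg
  have hl : 0 < 2 * K + 1 := by linarith
  set l := 2 * K + 1 with hl_def
  let T : ℝ → (ℝ →ᵇ ℝ) × (ℝ →ᵇ ℝ) → (ℝ →ᵇ ℝ) × (ℝ →ᵇ ℝ) := fun s w =>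
    (volterraMap ha hb hl hfc hf1 (1 - s) w.2, volterraMap hb ha hl hgc hg1 s w.1)
  have hKl : K / l ≤ 1 / 2 := by
    rw [div_le_div_iff₀ hl two_pos]
    linarith
  have hT : ∀ s, ContractingWith (1 / 2) (T s) := fun s =>
    ⟨by norm_num, LipschitzWith.of_dist_le_mul fun w z => by
      rw [Prod.dist_eq, Prod.dist_eq]
      push_cast
      refine max_le ?_ ?_
      · refine (dist_volterraMap_le ha hb hl hK hfc hf1 hf _ _ _).trans ?_
        gcongr
        exact le_max_right _ _
      · refine (dist_volterraMap_le hb ha hl hK hgc hg1 hg _ _ _).trans ?_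
        gcongr
        exact le_max_left _ _⟩
  let w : ℝ → (ℝ →ᵇ ℝ) × (ℝ →ᵇ ℝ) := fun s => ContractingWith.fixedPoint (T s) (hT s)
  have hw : ∀ s, T s (w s) = w s := fun s => (hT s).fixedPoint_isFixedPt
  have hwd : ∀ s t, dist (w s) (w t) ≤ 2 * dist s t := fun s t => by
    have := (hT s).fixedPoint_lipschitz_in_map (hT t) (C := dist s t) fun z => by
      rw [Prod.dist_eq]
      refine max_le ?_ ?_
      · refine (dist_volterraMap_const_le ha hb hl hfc hf1 _ _ _).trans_eq ?_
        rw [sub_sub_sub_cancel_left, abs_sub_comm, Real.dist_eq]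
      · exact dist_volterraMap_const_le hb ha hl hgc hg1 _ _ _
    refine this.trans_eq ?_
    push_cast
    ring
  have hwc : Continuous w :=
    (LipschitzWith.of_dist_le_mul (K := 2) (by simpa using hwd)).continuous
  have hW := continuous_expWeight ha hb l
  refine ⟨fun s r => expWeight a b l r * (w s).1 r, fun s r => expWeight a b l r * (w s).2 r,
    fun s => by fun_prop, fun s => by fun_prop, fun r => ?_, fun r => ?_, fun s r => ⟨?_, ?_⟩⟩
  · exact continuous_const.mul
      ((continuous_eval_const r).comp (continuous_fst.comp hwc))
  · exact continuous_const.mul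
      ((continuous_eval_const r).comp (continuous_snd.comp hwc))
  · have h := volterraMap_apply ha hb hl hfc hf1 (1 - s) (w s).2 r
    rw [show volterraMap ha hb hl hfc hf1 (1 - s) (w s).2 = (w s).1 from
      congrArg Prod.fst (hw s)] at h
    beta_reduce
    rw [h, mul_inv_cancel_left₀ (expWeight_pos _ _ _ _).ne']
  · have h := volterraMap_apply hb ha hl hgc hg1 s (w s).1 r
    rw [show volterraMap hb ha hl hgc hg1 s (w s).1 = (w s).2 from
      congrArg Prod.snd (hw s)] at h
    beta_reduce
    rw [h, expWeight_symm a b l r, mul_inv_cancel_left₀ (expWeight_pos _ _ _ _).ne']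
    simp only [expWeight_symm b a]

end

/-- Radial profiles solving the integrated system on `[0, R]`, normalized at the origin. -/
structure RadSol (a b p q R : ℝ) (u v : ℝ → ℝ) : Prop where
  hu : Continuous u
  hv : Continuous v
  sum : u 0 + v 0 = 1
  u_mem : ∀ r ∈ Icc 0 R, u r ∈ Icc (0 : ℝ) 1
  v_mem : ∀ r ∈ Icc 0 R, v r ∈ Icc (0 : ℝ) 1
  u_eq : ∀ r ∈ Icc 0 R, u r = u 0 - radPot a (fun τ => v τ ^ p) r
  v_eq : ∀ r ∈ Icc 0 R, v r = v 0 - radPot b (fun τ => u τ ^ q) r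

lemma RadSol.symm {a b p q R : ℝ} {u v : ℝ → ℝ} (h : RadSol a b p q R u v) :
    RadSol b a q p R v u :=
  ⟨h.hv, h.hu, by rw [add_comm]; exact h.sum, h.v_mem, h.u_mem, h.v_eq, h.u_eq⟩

lemma RadSol.mono {a b p q R R' : ℝ} {u v : ℝ → ℝ} (h : RadSol a b p q R u v) (hR : R' ≤ R) :
    RadSol a b p q R' u v :=
  ⟨h.hu, h.hv, h.sum, fun r hr => h.u_mem r ⟨hr.1, hr.2.trans hR⟩,
    fun r hr => h.v_mem r ⟨hr.1, hr.2.trans hR⟩, fun r hr => h.u_eq r ⟨hr.1, hr.2.trans hR⟩,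
    fun r hr => h.v_eq r ⟨hr.1, hr.2.trans hR⟩⟩

lemma exists_clamped_rpow {p ε : ℝ} (hp : 0 < p) (hε : 0 < ε) (hε1 : ε ≤ 1) :
    ∃ f : ℝ → ℝ, (∀ x, ε ^ p ≤ f x ∧ f x ≤ 1) ∧ (∀ x ∈ Icc ε 1, f x = x ^ p) ∧
      ∃ K, 0 ≤ K ∧ ∀ x y, |f x - f y| ≤ K * |x - y| := by
  have hmem : ∀ x, max ε (min x 1) ∈ Icc ε 1 := fun x =>
    ⟨le_max_left _ _, max_le hε1 (min_le_right _ _)⟩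
  have hc : ContinuousOn (fun y : ℝ => p * y ^ (p - 1)) (Icc ε 1) :=
    continuousOn_const.mul (continuousOn_id.rpow_const fun x hx => Or.inl (hε.trans_le hx.1).ne')
  obtain ⟨K, hK⟩ := isCompact_Icc.exists_bound_of_continuousOn hc
  have hK0 : 0 ≤ K := (norm_nonneg _).trans (hK ε (left_mem_Icc.2 hε1))
  refine ⟨fun x => max ε (min x 1) ^ p, fun x => ⟨?_, ?_⟩, fun x hx => ?_, K, hK0, fun x y => ?_⟩
  · exact Real.rpow_le_rpow hε.le (hmem x).1 hp.le
  · exact Real.rpow_le_one (hε.le.trans (hmem x).1) (hmem x).2 hp.le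
  · beta_reduce
    rw [min_eq_left hx.2, max_eq_right hx.1]
  · have h := (convex_Icc ε 1).norm_image_sub_le_of_norm_hasDerivWithin_le
      (f := fun y : ℝ => y ^ p) (fun z hz => (Real.hasDerivAt_rpow_const
        (Or.inl (hε.trans_le hz.1).ne')).hasDerivWithinAt) hK (hmem y) (hmem x)
    refine h.trans (mul_le_mul_of_nonneg_left ?_ hK0)
    rw [Real.norm_eq_abs, max_comm ε, max_comm ε]
    exact (abs_max_sub_max_le_abs _ _ _).trans
      ((abs_min_sub_min_le_max x 1 y 1).trans (by simp))

section
variable {a : ℝ} {φ : ℝ → ℝ}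

lemma le_radPot (ha : -2 < a) (hφ : Continuous φ) {c r : ℝ} (hr : 0 ≤ r) (h : ∀ x, c ≤ φ x) :
    c * (r ^ (2 + a) * ∫ σ in (0 : ℝ)..1, σ ^ (1 + a) * (1 - σ)) ≤ radPot a φ r := by
  have h1 : ∫ σ in (0 : ℝ)..1, σ ^ (1 + a) * (1 - σ) * c ≤
      ∫ σ in (0 : ℝ)..1, σ ^ (1 + a) * (1 - σ) * φ (r * σ) := by
    refine intervalIntegral.integral_mono_on zero_le_one
      (intervalIntegrable_radPot (φ := fun _ => c) ha continuous_const r)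
      (intervalIntegrable_radPot ha hφ r) fun σ hσ => ?_
    exact mul_le_mul_of_nonneg_left (h _)
      (mul_nonneg (Real.rpow_nonneg hσ.1 _) (by linarith [hσ.2]))
  rw [intervalIntegral.integral_mul_const] at h1
  rw [radPot, abs_of_nonneg hr]
  calc _ = r ^ (2 + a) * ((∫ σ in (0 : ℝ)..1, σ ^ (1 + a) * (1 - σ)) * c) := by ring
    _ ≤ _ := by gcongr

lemma exists_one_lt_radPot (ha : -2 < a) (hφ : Continuous φ) {c : ℝ} (hc : 0 < c)
    (h : ∀ x, c ≤ φ x) : ∃ r, 0 ≤ r ∧ 1 < radPot a φ r := by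
  have hI : 0 < ∫ σ in (0 : ℝ)..1, σ ^ (1 + a) * (1 - σ) := by
    refine intervalIntegral.intervalIntegral_pos_of_pos_on
      (intervalIntegrable_rpow_mul (by linarith) (by fun_prop) 0 1) (fun σ hσ => ?_) zero_lt_one
    exact mul_pos (Real.rpow_pos_of_pos hσ.1 _) (by linarith [hσ.2])
  have ht := ((tendsto_rpow_atTop (by linarith : 0 < 2 + a)).atTop_mul_const hI).const_mul_atTop hc
  obtain ⟨r, hr, hr0⟩ := ((ht.eventually_gt_atTop 1).and (eventually_ge_atTop 0)).exists
  exact ⟨r, hr0, hr.trans_le (le_radPot ha hφ hr0 h)⟩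

end

lemma eq_of_not_cross {u v : ℝ → ℝ} {ε R : ℝ} (hv : Continuous v) (hua : StrictAntiOn u (Ici 0))
    (hR : 0 ≤ R) (huR : u R = ε) (hsum : 2 * ε < u 0 + v 0)
    (h1 : ¬ ∃ r, 0 ≤ r ∧ u r < ε ∧ ε < v r) (h2 : ¬ ∃ r, 0 ≤ r ∧ v r < ε ∧ ε < u r) :
    v R = ε := by
  by_contra hne
  rcases lt_or_gt_of_ne hne with hlt | hgt
  · have hR0 : 0 < R := by
      rcases hR.eq_or_lt with h0 | h0
      · subst h0; linarith
      · exact h0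
    obtain ⟨r, ⟨hr1, hr2⟩, hr3⟩ := (((hv.continuousAt.eventually (gt_mem_nhds hlt)).and
      (lt_mem_nhds hR0)).filter_mono nhdsWithin_le_nhds |>.and
        (self_mem_nhdsWithin (s := Iio R))).exists
    exact h2 ⟨r, hr2.le, hr1, huR ▸ hua hr2.le hR hr3⟩
  · obtain ⟨r, hr1, hr3⟩ := ((hv.continuousAt.eventually (lt_mem_nhds hgt)).filter_mono
      nhdsWithin_le_nhds |>.and (self_mem_nhdsWithin (s := Ioi R))).exists
    have hr0 : 0 ≤ r := hR.trans (le_of_lt hr3)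
    exact h1 ⟨r, hr0, huR ▸ hua hR hr0 hr3, hr1⟩

lemma exists_radSol_hitting {a b p q ε : ℝ} (ha : -2 < a) (hb : -2 < b) (hp : 0 < p) (hq : 0 < q)
    (hε : 0 < ε) (hε2 : 2 * ε < 1) : ∃ R u v, 0 < R ∧ RadSol a b p q R u v ∧
      u R = ε ∧ v R = ε ∧ (∀ r ∈ Icc 0 R, ε ≤ u r) ∧ ∀ r ∈ Icc 0 R, ε ≤ v r := by
  obtain ⟨f, hf1, hf2, Kf, hKf0, hKf⟩ := exists_clamped_rpow hp hε (by linarith)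
  obtain ⟨g, hg1, hg2, Kg, hKg0, hKg⟩ := exists_clamped_rpow hq hε (by linarith)
  have hcp : 0 < ε ^ p := by positivity
  have hcq : 0 < ε ^ q := by positivity
  have cont : ∀ {f : ℝ → ℝ} {K : ℝ}, 0 ≤ K → (∀ x y, |f x - f y| ≤ K * |x - y|) → Continuous f :=
    fun hK h => (LipschitzWith.of_dist_le_mul (K := ⟨_, hK⟩) h).continuous
  have hfc := cont hKf0 hKf
  have hgc := cont hKg0 hKg
  obtain ⟨u, v, hu, hv, hus, hvs, huv⟩ := exists_volterra_flow ha hb (K := max Kf Kg)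
    (le_max_of_le_left hKf0)
    (fun x => by rw [abs_of_nonneg (hcp.le.trans (hf1 x).1)]; exact (hf1 x).2)
    (fun x => by rw [abs_of_nonneg (hcq.le.trans (hg1 x).1)]; exact (hg1 x).2)
    (fun x y => (hKf x y).trans (by gcongr; exact le_max_left _ _))
    (fun x y => (hKg x y).trans (by gcongr; exact le_max_right _ _))
  have hφ : ∀ s, Continuous fun τ => f (v s τ) := fun s => hfc.comp (hv s)
  have hψ : ∀ s, Continuous fun τ => g (u s τ) := fun s => hgc.comp (hu s)
  have hu0 : ∀ s, u s 0 = 1 - s := fun s => by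
    rw [(huv s 0).1, radPot_zero_right ha, sub_zero]
  have hv0 : ∀ s, v s 0 = s := fun s => by
    rw [(huv s 0).2, radPot_zero_right hb, sub_zero]
  have hua : ∀ s, StrictAntiOn (u s) (Ici 0) := fun s x hx y hy hxy => by
    rw [(huv s x).1, (huv s y).1]
    have := strictMonoOn_radPot (r := y) ha (hφ s) (fun z _ => hcp.trans_le (hf1 _).1)
      (fun z _ => (hf1 _).2) ⟨hx, hxy.le⟩ ⟨hy, le_rfl⟩ hxy
    linarith
  have hva : ∀ s, StrictAntiOn (v s) (Ici 0) := fun s x hx y hy hxy => by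
    rw [(huv s x).2, (huv s y).2]
    have := strictMonoOn_radPot (r := y) hb (hψ s) (fun z _ => hcq.trans_le (hg1 _).1)
      (fun z _ => (hg1 _).2) ⟨hx, hxy.le⟩ ⟨hy, le_rfl⟩ hxy
    linarith
  have hop : ∀ {u v : ℝ → ℝ → ℝ}, (∀ r, Continuous fun s => u s r) →
      (∀ r, Continuous fun s => v s r) → IsOpen {s | ∃ r, 0 ≤ r ∧ u s r < ε ∧ ε < v s r} := by
    intro u v hu hv
    have : {s | ∃ r, 0 ≤ r ∧ u s r < ε ∧ ε < v s r} =
        ⋃ r, ⋃ _ : 0 ≤ r, {s | u s r < ε} ∩ {s | ε < v s r} := by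
      ext s; simp only [mem_iUnion, mem_inter_iff, mem_ofPred_eq, exists_prop]
    rw [this]
    exact isOpen_iUnion fun r => isOpen_iUnion fun _ =>
      (isOpen_lt (hu r) continuous_const).inter (isOpen_lt continuous_const (hv r))
  obtain ⟨s, hs, hsA, hsB⟩ : ∃ s ∈ Icc (0 : ℝ) 1,
      (¬ ∃ r, 0 ≤ r ∧ u s r < ε ∧ ε < v s r) ∧ ¬ ∃ r, 0 ≤ r ∧ v s r < ε ∧ ε < u s r := by
    by_contra! hcon
    obtain ⟨s, -, ⟨r, hr, hr1, hr2⟩, r', hr', hr1', hr2'⟩ :=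
      (isPreconnected_Icc (a := (0 : ℝ)) (b := 1)) _ _ (hop hus hvs) (hop hvs hus)
      (fun s hs => by
        by_contra hn
        rw [mem_union, not_or] at hn
        obtain ⟨r, hr⟩ := hcon s hs (by simpa using hn.1)
        exact hn.2 ⟨r, hr⟩)
      ⟨1, by simp, 0, le_rfl, by rw [hu0]; linarith, by rw [hv0]; linarith⟩
      ⟨0, by simp, 0, le_rfl, by rw [hv0]; linarith, by rw [hu0]; linarith⟩
    have e1 : r' < r := ((hua s).lt_iff_gt hr hr').1 (hr1.trans hr2')
    have e2 : r < r' := ((hva s).lt_iff_gt hr' hr).1 (hr1'.trans hr2)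
    exact absurd e1 e2.not_gt
  have hsum : u s 0 + v s 0 = 1 := by rw [hu0, hv0]; ring
  obtain ⟨T, hT0, hT⟩ := exists_one_lt_radPot ha (hφ s) hcp fun x => (hf1 _).1
  have huT : u s T ≤ ε := by
    rw [(huv s T).1]
    linarith [hs.1]
  have hu0ε : ε ≤ u s 0 := by
    by_contra! h
    exact hsA ⟨0, le_rfl, h, by linarith⟩
  obtain ⟨R, hR, huR⟩ := intermediate_value_Icc' hT0 (hu s).continuousOn ⟨huT, hu0ε⟩
  have hvR := eq_of_not_cross (hv s) (hua s) hR.1 huR (by linarith) hsA hsB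
  have hR0 : 0 < R := by
    rcases hR.1.eq_or_lt with h0 | h0
    · subst h0; linarith
    · exact h0
  have hul : ∀ r ∈ Icc 0 R, ε ≤ u s r := fun r hr => by
    rw [← huR]; exact (hua s).antitoneOn hr.1 hR.1 hr.2
  have hvl : ∀ r ∈ Icc 0 R, ε ≤ v s r := fun r hr => by
    rw [← hvR]; exact (hva s).antitoneOn hr.1 hR.1 hr.2
  have hu1 : ∀ r ∈ Icc 0 R, u s r ≤ 1 := fun r hr =>
    ((hua s).antitoneOn self_mem_Ici hr.1 hr.1).trans (by rw [hu0]; linarith [hs.1])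
  have hv1 : ∀ r ∈ Icc 0 R, v s r ≤ 1 := fun r hr =>
    ((hva s).antitoneOn self_mem_Ici hr.1 hr.1).trans (by rw [hv0]; exact hs.2)
  refine ⟨R, u s, v s, hR0, ⟨hu s, hv s, hsum, fun r hr => ⟨hε.le.trans (hul r hr), hu1 r hr⟩,
    fun r hr => ⟨hε.le.trans (hvl r hr), hv1 r hr⟩, fun r hr => ?_, fun r hr => ?_⟩,
    huR, hvR, hul, hvl⟩
  · rw [(huv s r).1, hu0]
    congr 1
    exact radPot_congr hr.1 fun x hx =>
      hf2 _ ⟨hvl x ⟨hx.1, hx.2.trans hr.2⟩, hv1 x ⟨hx.1, hx.2.trans hr.2⟩⟩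
  · rw [(huv s r).2, hv0]
    congr 1
    exact radPot_congr hr.1 fun x hx =>
      hg2 _ ⟨hul x ⟨hx.1, hx.2.trans hr.2⟩, hu1 x ⟨hx.1, hx.2.trans hr.2⟩⟩

section
variable {a b p q R : ℝ} {u v : ℝ → ℝ}

lemma RadSol.cont_src (h : RadSol a b p q R u v) (hp : 0 < p) : Continuous fun τ => v τ ^ p :=
  h.hv.rpow_const fun _ => Or.inr hp.le

lemma RadSol.src_nonneg (h : RadSol a b p q R u v) (p : ℝ) {r : ℝ} (hr : r ∈ Icc 0 R) :
    0 ≤ v r ^ p :=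
  Real.rpow_nonneg (h.v_mem r hr).1 _

lemma RadSol.src_le_one (h : RadSol a b p q R u v) (hp : 0 < p) {r : ℝ} (hr : r ∈ Icc 0 R) :
    v r ^ p ≤ 1 :=
  Real.rpow_le_one (h.v_mem r hr).1 (h.v_mem r hr).2 hp.le

lemma RadSol.hasDerivAt (h : RadSol a b p q R u v) (ha : -2 < a) (hp : 0 < p) {r : ℝ}
    (hr : r ∈ Ioo 0 R) : HasDerivAt u (-(radMass a (fun τ => v τ ^ p) r / r ^ 2)) r := by
  refine ((hasDerivAt_radPot ha (h.cont_src hp) hr.1).const_sub (u 0)).congr_of_eventuallyEq ?_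
  filter_upwards [Ioo_mem_nhds hr.1 hr.2] with s hs using h.u_eq s ⟨hs.1.le, hs.2.le⟩

lemma RadSol.radMass_nonneg (h : RadSol a b p q R u v) {r : ℝ} (hr : r ∈ Icc 0 R) :
    0 ≤ radMass a (fun τ => v τ ^ p) r :=
  _root_.radMass_nonneg hr.1 fun _ hx => h.src_nonneg p ⟨hx.1, hx.2.trans hr.2⟩

lemma RadSol.radMass_le (h : RadSol a b p q R u v) (ha : -2 < a) (hp : 0 < p) {r : ℝ}
    (hr : r ∈ Icc 0 R) : radMass a (fun τ => v τ ^ p) r ≤ r ^ (3 + a) := by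
  have := _root_.radMass_le ha (h.cont_src hp) hr.1 zero_le_one
    fun x hx => h.src_le_one hp ⟨hx.1, hx.2.trans hr.2⟩
  rwa [one_mul] at this

lemma RadSol.antitoneOn (h : RadSol a b p q R u v) (ha : -2 < a) (hp : 0 < p) :
    AntitoneOn u (Icc 0 R) := fun x hx y hy hxy => by
  rw [h.u_eq x hx, h.u_eq y hy]
  have := monotoneOn_radPot ha (h.cont_src hp) (fun x hx => h.src_nonneg p hx)
    (fun x hx => h.src_le_one hp hx) hx hy hxy
  linarith

lemma hasDerivAt_virial {p e r d : ℝ} {w : ℝ → ℝ} (hp : 0 < p) (hr : 0 < r)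
    (hw : HasDerivAt w d r) (hw0 : 0 ≤ w r) :
    HasDerivAt (fun r => r ^ (3 + e) * w r ^ (p + 1) / (p + 1))
      ((3 + e) / (p + 1) * (r ^ (2 + e) * w r ^ p * w r) + r ^ (3 + e) * w r ^ p * d) r := by
  have h1 := Real.hasDerivAt_rpow_const (x := r) (p := 3 + e) (Or.inl hr.ne')
  have h2 := hw.rpow_const (p := p + 1) (Or.inr (by linarith))
  refine ((h1.mul h2).div_const (p + 1)).congr_deriv ?_
  rw [Real.rpow_add_one' hw0 (by linarith), show 3 + e - 1 = 2 + e by ring, add_sub_cancel_right]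
  field_simp

theorem RadSol.pohozaev (h : RadSol a b p q R u v) (ha : -2 < a) (hb : -2 < b) (hp : 0 < p)
    (hq : 0 < q) (hR : 0 < R) (hc : (3 + a) / (p + 1) + (3 + b) / (q + 1) ≤ 1) :
    radMass a (fun τ => v τ ^ p) R * radMass b (fun τ => u τ ^ q) R ≤
      R * (radMass a (fun τ => v τ ^ p) R * v R + radMass b (fun τ => u τ ^ q) R * u R) := by
  set f := fun τ => v τ ^ p with hf
  set g := fun τ => u τ ^ q with hg
  have hfc : Continuous f := h.cont_src hp
  have hgc : Continuous g := h.symm.cont_src hq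
  have h3a : 0 < 3 + a := by linarith
  have h3b : 0 < 3 + b := by linarith
  set mu := (3 + b) / (q + 1) with hmu
  have hmu0 : 0 < mu := by positivity
  have hla0 : 0 < (3 + a) / (p + 1) := by positivity
  let H : ℝ → ℝ := fun r => radMass a f r * radMass b g r / r +
    r ^ (3 + a) * v r ^ (p + 1) / (p + 1) + r ^ (3 + b) * u r ^ (q + 1) / (q + 1) -
    (1 - mu) * (radMass a f r * v r) - mu * (radMass b g r * u r)
  have hH : ∀ r ∈ Ioo 0 R, HasDerivAt H (-((1 - mu - (3 + a) / (p + 1)) *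
      (r ^ (2 + a) * v r ^ p * v r))) r := by
    intro r hr
    have hr0 := hr.1
    have hrI : r ∈ Icc 0 R := ⟨hr.1.le, hr.2.le⟩
    have hu := h.hasDerivAt ha hp hr
    have hv := h.symm.hasDerivAt hb hq hr
    have hmf := hasDerivAt_radMass ha hfc hr0
    have hmg := hasDerivAt_radMass hb hgc hr0
    have hd := ((((hmf.mul hmg).div (hasDerivAt_id r) hr0.ne').add
      (hasDerivAt_virial (e := a) hp hr0 hv (h.v_mem r hrI).1)).add
      (hasDerivAt_virial (e := b) hq hr0 hu (h.u_mem r hrI).1)).sub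
      ((hmf.mul hv).const_mul (1 - mu)) |>.sub ((hmg.mul hu).const_mul mu)
    refine hd.congr_deriv ?_
    have e1 : r ^ (3 + a) = r * r ^ (2 + a) := by
      rw [show 3 + a = 1 + (2 + a) by ring, Real.rpow_add hr0, Real.rpow_one]
    have e2 : r ^ (3 + b) = r * r ^ (2 + b) := by
      rw [show 3 + b = 1 + (2 + b) by ring, Real.rpow_add hr0, Real.rpow_one]
    simp only [Pi.mul_apply, id, e1, e2, ← hmu, hf, hg]
    field_simp
    ring
  have hHc : ContinuousOn H (Ioc 0 R) := by
    intro r hr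
    have c1 := (hasDerivAt_radMass ha hfc hr.1).continuousAt
    have c2 := (hasDerivAt_radMass hb hgc hr.1).continuousAt
    have c3 := Real.continuousAt_rpow_const r (3 + a) (Or.inl hr.1.ne')
    have c4 := Real.continuousAt_rpow_const r (3 + b) (Or.inl hr.1.ne')
    have c5 : ContinuousAt (fun r => v r ^ (p + 1)) r :=
      h.hv.continuousAt.rpow_const (Or.inr (by linarith))
    have c6 : ContinuousAt (fun r => u r ^ (q + 1)) r :=
      h.hu.continuousAt.rpow_const (Or.inr (by linarith))
    have c7 := h.hu.continuousAt (x := r)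
    have c8 := h.hv.continuousAt (x := r)
    have hr0 := hr.1.ne'
    refine ContinuousAt.continuousWithinAt ?_
    simp only [H]
    fun_prop (disch := assumption)
  have hanti : AntitoneOn H (Ioc 0 R) := by
    refine antitoneOn_of_hasDerivWithinAt_nonpos (convex_Ioc 0 R) hHc
      (fun x hx => (hH x (by rwa [interior_Ioc] at hx)).hasDerivWithinAt) fun x hx => ?_
    rw [interior_Ioc] at hx
    have hxI : x ∈ Icc 0 R := ⟨hx.1.le, hx.2.le⟩
    have := h.src_nonneg p hxI
    have := (h.v_mem x hxI).1
    have := hx.1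
    rw [neg_nonpos]
    exact mul_nonneg (by linarith) (by positivity)
  have hbound : ∀ r ∈ Ioc 0 R, H R ≤ r ^ (2 + a) * r ^ (3 + b) + r ^ (3 + a) + r ^ (3 + b) := by
    intro r hr
    have hr0 := hr.1
    have hrI : r ∈ Icc 0 R := ⟨hr.1.le, hr.2⟩
    refine (hanti hr ⟨hR, le_rfl⟩ hr.2).trans ?_
    have m1 := h.radMass_nonneg hrI
    have m2 := h.symm.radMass_nonneg hrI
    have m3 := h.radMass_le ha hp hrI
    have m4 := h.symm.radMass_le hb hq hrI
    have t1 : radMass a f r * radMass b g r / r ≤ r ^ (2 + a) * r ^ (3 + b) := by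
      rw [div_le_iff₀ hr0]
      calc _ ≤ r ^ (3 + a) * r ^ (3 + b) := mul_le_mul m3 m4 m2 (by positivity)
        _ = _ := by
          rw [show 3 + a = 1 + (2 + a) by ring, Real.rpow_add hr0 1, Real.rpow_one]
          ring
    have vir : ∀ {w e p : ℝ}, w ∈ Icc (0 : ℝ) 1 → 0 < p →
        r ^ e * w ^ (p + 1) / (p + 1) ≤ r ^ e := by
      intro w e p hw hp
      rw [div_le_iff₀ (by linarith)]
      gcongr
      exact (Real.rpow_le_one hw.1 hw.2 (by linarith)).trans (by linarith)
    have t2 := vir (e := 3 + a) (h.v_mem r hrI) hp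
    have t3 := vir (e := 3 + b) (h.u_mem r hrI) hq
    have t4 : 0 ≤ (1 - mu) * (radMass a f r * v r) :=
      mul_nonneg (by linarith) (mul_nonneg m1 (h.v_mem r hrI).1)
    have t5 : 0 ≤ mu * (radMass b g r * u r) :=
      mul_nonneg hmu0.le (mul_nonneg m2 (h.u_mem r hrI).1)
    simp only [H]
    linarith
  have hH0 : H R ≤ 0 := by
    have ht : Tendsto (fun r : ℝ => r ^ (2 + a) * r ^ (3 + b) + r ^ (3 + a) + r ^ (3 + b)) (𝓝 0)
        (𝓝 0) := by
      have c1 := Real.continuous_rpow_const (q := 2 + a) (by linarith)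
      have c2 := Real.continuous_rpow_const (q := 3 + a) (by linarith)
      have c3 := Real.continuous_rpow_const (q := 3 + b) (by linarith)
      have hc : Continuous fun r : ℝ => r ^ (2 + a) * r ^ (3 + b) + r ^ (3 + a) + r ^ (3 + b) :=
        ((c1.mul c3).add c2).add c3
      have := hc.tendsto 0
      simpa [Real.zero_rpow (by linarith : 2 + a ≠ 0), Real.zero_rpow h3a.ne',
        Real.zero_rpow h3b.ne'] using this
    refine ge_of_tendsto (ht.mono_left (nhdsWithin_le_nhds (s := Ioi 0))) ?_
    filter_upwards [Ioc_mem_nhdsGT hR] with r hr using hbound r hr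
  have hRI : R ∈ Icc 0 R := ⟨hR.le, le_rfl⟩
  have m1 := h.radMass_nonneg hRI
  have m2 := h.symm.radMass_nonneg hRI
  have hv0 := (h.v_mem R hRI).1
  have hu0 := (h.u_mem R hRI).1
  have t1 : 0 ≤ R ^ (3 + a) * v R ^ (p + 1) / (p + 1) := by positivity
  have t2 : 0 ≤ R ^ (3 + b) * u R ^ (q + 1) / (q + 1) := by positivity
  have t3 : 0 ≤ mu * (radMass a f R * v R) := mul_nonneg hmu0.le (mul_nonneg m1 hv0)
  have t4 : 0 ≤ (1 - mu) * (radMass b g R * u R) :=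
    mul_nonneg (by linarith) (mul_nonneg m2 hu0)
  simp only [H] at hH0
  rw [← div_le_iff₀' hR]
  linarith

end

section
variable {a b p q R R₀ ε η : ℝ} {u v : ℝ → ℝ}

lemma RadSol.radMass_monotoneOn (h : RadSol a b p q R u v) (ha : -2 < a) (hp : 0 < p) :
    MonotoneOn (radMass a (fun τ => v τ ^ p)) (Ioc 0 R) := by
  have hd : ∀ x, 0 < x → HasDerivAt (radMass a fun τ => v τ ^ p) (x ^ (2 + a) * v x ^ p) x :=
    fun x hx => hasDerivAt_radMass ha (h.cont_src hp) hx
  refine monotoneOn_of_hasDerivWithinAt_nonneg (convex_Ioc 0 R)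
    (fun x hx => (hd x hx.1).continuousAt.continuousWithinAt)
    (fun x hx => (hd x ?_).hasDerivWithinAt) fun x hx => ?_
  · rw [interior_Ioc] at hx
    exact hx.1
  · rw [interior_Ioc] at hx
    have := h.src_nonneg p ⟨hx.1.le, hx.2.le⟩
    have := hx.1
    positivity

lemma RadSol.le_add_radMass_div (h : RadSol a b p q R u v) (ha : -2 < a) (hp : 0 < p)
    (hη : 0 < η) (hηR : η ≤ R) : u η ≤ u R + radMass a (fun τ => v τ ^ p) R / η := by
  have hR : 0 < R := hη.trans_le hηR
  set m := radMass a (fun τ => v τ ^ p) R with hm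
  have hm0 : 0 ≤ m := h.radMass_nonneg ⟨hR.le, le_rfl⟩
  have hmono : MonotoneOn (fun r => u r - m * r⁻¹) (Icc η R) := by
    refine monotoneOn_of_hasDerivWithinAt_nonneg (convex_Icc η R)
      (f' := fun r => -(radMass a (fun τ => v τ ^ p) r / r ^ 2) - m * -(r ^ 2)⁻¹)
      (h.hu.continuousOn.sub (continuousOn_const.mul
        (continuousOn_inv₀.mono fun x hx => (hη.trans_le hx.1).ne'))) (fun x hx => ?_)
      fun x hx => ?_
    · rw [interior_Icc] at hx
      have hx0 : 0 < x := hη.trans hx.1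
      exact ((h.hasDerivAt ha hp ⟨hx0, hx.2⟩).sub
        ((hasDerivAt_inv hx0.ne').const_mul m)).hasDerivWithinAt
    · rw [interior_Icc] at hx
      have hx0 : 0 < x := hη.trans hx.1
      have hle := h.radMass_monotoneOn ha hp ⟨hx0, hx.2.le⟩ ⟨hR, le_rfl⟩ hx.2.le
      have : 0 ≤ (m - radMass a (fun τ => v τ ^ p) x) / x ^ 2 :=
        div_nonneg (by linarith) (by positivity)
      calc (0 : ℝ) ≤ _ := this
        _ = _ := by field_simp; ring
  have h1 : u η - m * η⁻¹ ≤ u R - m * R⁻¹ := hmono ⟨le_rfl, hηR⟩ ⟨hηR, le_rfl⟩ hηR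
  have h2 : 0 ≤ m * R⁻¹ := by positivity
  rw [div_eq_mul_inv]
  linarith

lemma RadSol.sub_le (h : RadSol a b p q R u v) (ha : -2 < a) (hp : 0 < p) {r : ℝ}
    (hr : r ∈ Icc 0 R) : u 0 ≤ u r + r ^ (2 + a) / (2 + a) := by
  have := radPot_le ha (h.cont_src hp) hr.1 zero_le_one
    fun x hx => h.src_le_one hp ⟨hx.1, hx.2.trans hr.2⟩
  rw [one_mul] at this
  linarith [h.u_eq r hr]

lemma RadSol.fst_zero_le (h : RadSol a b p q R u v) (ha : -2 < a) (hp : 0 < p) (hR : 0 < R)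
    (hη : 0 < η) : u 0 ≤ u R + η ^ (2 + a) / (2 + a) + radMass a (fun τ => v τ ^ p) R / η := by
  have h2a : 0 < 2 + a := by linarith
  rcases le_total R η with hle | hle
  · have h1 := h.sub_le ha hp ⟨hR.le, le_rfl⟩
    have h2 : R ^ (2 + a) / (2 + a) ≤ η ^ (2 + a) / (2 + a) := by gcongr
    have h3 := div_nonneg (h.radMass_nonneg ⟨hR.le, le_rfl⟩) hη.le
    linarith
  · have h1 := h.sub_le ha hp ⟨hη.le, hle⟩
    have h2 := h.le_add_radMass_div ha hp hη hle
    linarith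

lemma RadSol.snd_zero_le (h : RadSol a b p q R u v) (ha : -2 < a) (hb : -2 < b) (hp : 0 < p)
    (hq : 0 < q) (hR : 0 ≤ R) : v 0 ≤ v R + u 0 ^ q * (R ^ (2 + b) / (2 + b)) := by
  have h0 : (0 : ℝ) ∈ Icc 0 R := ⟨le_rfl, hR⟩
  have h1 := radPot_le hb (h.symm.cont_src hq) hR (C := u 0 ^ q) (h.symm.src_nonneg q h0)
    fun x hx => Real.rpow_le_rpow (h.u_mem x hx).1 (h.antitoneOn ha hp h0 hx hx.1) hq.le
  linarith [h.v_eq R ⟨hR, le_rfl⟩]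

/-- Bound for the value at the origin of the component with small mass. -/
noncomputable def originBound (a R₀ ε : ℝ) : ℝ :=
  ε + √ε ^ (2 + a) / (2 + a) + 2 * R₀ * √ε

lemma eventually_originBound_lt (ha : -2 < a) (hq : 0 < q) (R₀ c : ℝ) :
    ∀ᶠ ε in 𝓝[>] (0 : ℝ), originBound a R₀ ε + ε + originBound a R₀ ε ^ q * c < 1 := by
  have hc1 : Continuous (originBound a R₀) := by
    have := Real.continuous_rpow_const (q := 2 + a) (by linarith)
    unfold originBound
    fun_prop
  have hc2 : Continuous fun ε => originBound a R₀ ε ^ q := hc1.rpow_const fun _ => Or.inr hq.le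
  have hc : Continuous fun ε => originBound a R₀ ε + ε + originBound a R₀ ε ^ q * c := by
    fun_prop
  have h0 : originBound a R₀ 0 = 0 := by
    simp [originBound, Real.zero_rpow (by linarith : 2 + a ≠ 0)]
  refine (hc.continuousAt.eventually (gt_mem_nhds ?_)).filter_mono nhdsWithin_le_nhds
  simp [h0, Real.zero_rpow hq.ne']

lemma RadSol.one_le_of_radMass_le (h : RadSol a b p q R u v) (ha : -2 < a) (hb : -2 < b)
    (hp : 0 < p) (hq : 0 < q) (hR : 0 < R) (hR₀ : R ≤ R₀) (hε : 0 < ε) (hu : u R = ε)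
    (hv : v R = ε) (hm : radMass a (fun τ => v τ ^ p) R ≤ 2 * ε * R) :
    1 ≤ originBound a R₀ ε + ε + originBound a R₀ ε ^ q * (R₀ ^ (2 + b) / (2 + b)) := by
  have h2b : 0 < 2 + b := by linarith
  have hs : 0 < √ε := Real.sqrt_pos.2 hε
  have h1 : u 0 ≤ originBound a R₀ ε := by
    refine (h.fst_zero_le ha hp hR hs).trans ?_
    rw [hu, originBound]
    gcongr
    rw [div_le_iff₀ hs, mul_assoc _ _ (√ε), Real.mul_self_sqrt hε.le]
    refine hm.trans ?_
    nlinarith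
  have h2 := h.snd_zero_le ha hb hp hq hR.le
  have hu0 := (h.u_mem 0 ⟨le_rfl, hR.le⟩).1
  have hω := Real.rpow_nonneg (hu0.trans h1) q
  have h3 : u 0 ^ q * (R ^ (2 + b) / (2 + b)) ≤
      originBound a R₀ ε ^ q * (R₀ ^ (2 + b) / (2 + b)) := by gcongr
  linarith [h.sum]

theorem exists_radSol (ha : -2 < a) (hb : -2 < b) (hp : 0 < p) (hq : 0 < q)
    (hc : (3 + a) / (p + 1) + (3 + b) / (q + 1) ≤ 1) (R₀ : ℝ) :
    ∃ u v, RadSol a b p q R₀ u v := by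
  obtain ⟨ε, ⟨⟨hε1, hε2⟩, hε0⟩, hε3⟩ := ((eventually_originBound_lt (a := a) ha hq R₀
    (R₀ ^ (2 + b) / (2 + b))).and (eventually_originBound_lt (a := b) hb hp R₀
    (R₀ ^ (2 + a) / (2 + a))) |>.and self_mem_nhdsWithin |>.and
    (Ioo_mem_nhdsGT (show (0 : ℝ) < 1 / 2 by norm_num))).exists
  have hε : 0 < ε := hε0
  obtain ⟨R, u, v, hR, h, hu, hv, -, -⟩ :=
    exists_radSol_hitting (p := p) (q := q) ha hb hp hq hε (by linarith [hε3.2])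
  by_cases hRR : R₀ ≤ R
  · exact ⟨u, v, h.mono hRR⟩
  exfalso
  have hRR' : R ≤ R₀ := (not_le.1 hRR).le
  have hpoh := h.pohozaev ha hb hp hq hR hc
  rw [hu, hv] at hpoh
  have m1 := h.radMass_nonneg ⟨hR.le, le_rfl⟩
  have m2 := h.symm.radMass_nonneg ⟨hR.le, le_rfl⟩
  set mf := radMass a (fun τ => v τ ^ p) R
  set mg := radMass b (fun τ => u τ ^ q) R
  rcases le_or_gt mf (2 * ε * R) with hm | hm
  · linarith [h.one_le_of_radMass_le ha hb hp hq hR hRR' hε hu hv hm]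
  rcases le_or_gt mg (2 * ε * R) with hm' | hm'
  · linarith [h.symm.one_le_of_radMass_le hb ha hq hp hR hRR' hε hv hu hm']
  have := mul_pos hε hR
  nlinarith

end

lemma exists_continuous_limit {F : ℕ → ℝ → ℝ} {g : ℝ → ℝ} (hg : Continuous g)
    (h : ∀ r s, ∀ᶠ n in atTop, |F n r - F n s| ≤ |g r - g s|)
    (hQ : ∀ t : ℚ, ∃ l, Tendsto (fun n => F n t) atTop (𝓝 l)) :
    ∃ G : ℝ → ℝ, Continuous G ∧ ∀ r, Tendsto (fun n => F n r) atTop (𝓝 (G r)) := by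
  have hlim : ∀ r, ∃ l, Tendsto (fun n => F n r) atTop (𝓝 l) := by
    intro r
    refine cauchySeq_tendsto_of_complete (Metric.cauchySeq_iff'.2 fun δ hδ => ?_)
    have hδ3 : 0 < δ / 3 := by positivity
    obtain ⟨t, ht⟩ := Rat.denseRange_cast.exists_mem_open
      ((isOpen_ball (x := g r) (ε := δ / 3)).preimage hg) ⟨r, mem_ball_self hδ3⟩
    have htr : |g r - g t| < δ / 3 := by
      rw [abs_sub_comm]; simpa [Real.dist_eq] using ht
    obtain ⟨l, hl⟩ := hQ t
    obtain ⟨k, hk⟩ := eventually_atTop.1 (h r t)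
    obtain ⟨k', hk'⟩ := Metric.cauchySeq_iff.1 hl.cauchySeq (δ / 3) hδ3
    refine ⟨max k k', fun n hn => ?_⟩
    have e1 := hk n ((le_max_left _ _).trans hn)
    have e2 := hk (max k k') (le_max_left _ _)
    have e3 := hk' n ((le_max_right _ _).trans hn) (max k k') (le_max_right _ _)
    rw [Real.dist_eq] at e3 ⊢
    rw [abs_le] at e1 e2
    rw [abs_lt] at e3 ⊢
    constructor <;> linarith
  choose G hG using hlim
  have hGg : ∀ r s, |G r - G s| ≤ |g r - g s| := fun r s =>
    le_of_tendsto ((hG r).sub (hG s)).abs (h r s)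
  refine ⟨G, continuous_iff_continuousAt.2 fun r => ?_, hG⟩
  rw [ContinuousAt, tendsto_iff_dist_tendsto_zero]
  refine squeeze_zero (fun _ => dist_nonneg) (fun s => ?_)
    (tendsto_iff_dist_tendsto_zero.1 (hg.tendsto r))
  simpa only [Real.dist_eq] using hGg s r

section
variable {a b p q R : ℝ} {u v : ℝ → ℝ}

lemma RadSol.abs_sub_le (h : RadSol a b p q R u v) (ha : -2 < a) (hp : 0 < p) {x y : ℝ}
    (hx : x ∈ Icc 0 R) (hy : y ∈ Icc 0 R) :
    |u x - u y| ≤ |x ^ (2 + a) / (2 + a) - y ^ (2 + a) / (2 + a)| := by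
  wlog hxy : x ≤ y generalizing x y
  · rw [abs_sub_comm, abs_sub_comm (x ^ (2 + a) / (2 + a))]
    exact this hy hx (not_le.1 hxy).le
  have h1 := h.antitoneOn ha hp hx hy hxy
  have h2 : x ^ (2 + a) / (2 + a) - radPot a (fun τ => v τ ^ p) x ≤
      y ^ (2 + a) / (2 + a) - radPot a (fun τ => v τ ^ p) y :=
    radPot_sub_le ha (h.cont_src hp) (fun x hx => h.src_nonneg p hx)
      (fun x hx => h.src_le_one hp hx) hx hy hxy
  rw [abs_of_nonneg (by linarith), abs_sub_comm]
  refine le_trans ?_ (le_abs_self _)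
  linarith [h.u_eq x hx, h.u_eq y hy]

lemma tendsto_radPot (ha : -2 < a) {r : ℝ} (hr : 0 ≤ r) {F : ℕ → ℝ → ℝ} {φ : ℝ → ℝ}
    (hF : ∀ n, Continuous (F n)) (hb : ∀ᶠ n in atTop, ∀ x ∈ Icc 0 r, |F n x| ≤ 1)
    (hlim : ∀ x ∈ Icc 0 r, Tendsto (fun n => F n x) atTop (𝓝 (φ x))) :
    Tendsto (fun n => radPot a (F n) r) atTop (𝓝 (radPot a φ r)) := by
  refine Tendsto.const_mul _ ?_
  refine intervalIntegral.tendsto_integral_filter_of_dominated_convergence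
    (fun σ => σ ^ (1 + a)) (Eventually.of_forall fun n => ?_) ?_
    (intervalIntegral.intervalIntegrable_rpow' (by linarith)) ?_
  · have := (intervalIntegrable_radPot ha (hF n) r).aestronglyMeasurable
    rwa [uIoc_of_le zero_le_one]
  · filter_upwards [hb] with n hn
    refine Eventually.of_forall fun σ hσ => ?_
    rw [uIoc_of_le zero_le_one] at hσ
    have h0 := Real.rpow_nonneg hσ.1.le (1 + a)
    rw [mul_assoc, norm_mul, norm_mul, Real.norm_of_nonneg h0, Real.norm_eq_abs,
      Real.norm_eq_abs, abs_of_nonneg (by linarith [hσ.2])]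
    refine mul_le_of_le_one_right h0 ?_
    have := hn _ (mul_mem_Icc hr ⟨hσ.1.le, hσ.2⟩)
    nlinarith [hσ.1, hσ.2, abs_nonneg (F n (r * σ))]
  · refine Eventually.of_forall fun σ hσ => ?_
    rw [uIoc_of_le zero_le_one] at hσ
    exact (hlim _ (mul_mem_Icc hr ⟨hσ.1.le, hσ.2⟩)).const_mul _

theorem exists_global_radSol (ha : -2 < a) (hb : -2 < b) (hp : 0 < p) (hq : 0 < q)
    (hc : (3 + a) / (p + 1) + (3 + b) / (q + 1) ≤ 1) :
    ∃ u v, ∀ R, RadSol a b p q R u v := by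
  have hex : ∀ n : ℕ, ∃ u v, RadSol a b p q n u v := fun n => exists_radSol ha hb hp hq hc n
  choose U V hUV using hex
  let clamp : ℝ → ℝ := fun x => max 0 (min x 1)
  have hclamp : ∀ x, clamp x ∈ Icc (0 : ℝ) 1 := fun x =>
    ⟨le_max_left _ _, max_le zero_le_one (min_le_right _ _)⟩
  have hclamp_eq : ∀ x ∈ Icc (0 : ℝ) 1, clamp x = x := fun x hx => by
    simp only [clamp]
    rw [min_eq_left hx.2, max_eq_right hx.1]
  have hcomp : IsCompact (univ.pi fun _ : ℚ => Icc (0 : ℝ) 1 ×ˢ Icc (0 : ℝ) 1) :=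
    isCompact_univ_pi fun _ => isCompact_Icc.prod isCompact_Icc
  obtain ⟨l, -, φ, hφ, hl⟩ := hcomp.tendsto_subseq
    (x := fun (n : ℕ) (t : ℚ) => (clamp (U n |(t : ℝ)|), clamp (V n |(t : ℝ)|)))
    (fun n => mem_univ_pi.2 fun t => ⟨hclamp _, hclamp _⟩)
  rw [tendsto_pi_nhds] at hl
  have hmem : ∀ r : ℝ, ∀ᶠ n in atTop, |r| ∈ Icc (0 : ℝ) (φ n) := fun r => by
    filter_upwards [hφ.tendsto_atTop.eventually_ge_atTop ⌈|r|⌉₊] with n hn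
    exact ⟨abs_nonneg r, (Nat.le_ceil _).trans (by exact_mod_cast hn)⟩
  have hpow : ∀ e : ℝ, -2 < e → Continuous fun r : ℝ => |r| ^ (2 + e) / (2 + e) := fun e he =>
    (continuous_abs.rpow_const fun _ => Or.inr (by linarith)).div_const _
  obtain ⟨u, hu, hUu⟩ := exists_continuous_limit (F := fun n r => U (φ n) |r|) (hpow a ha)
    (fun r s => by
      filter_upwards [hmem r, hmem s] with n hr hs using (hUV (φ n)).abs_sub_le ha hp hr hs)
    (fun t => ⟨(l t).1, by
      refine ((continuous_fst.tendsto _).comp (hl t)).congr' ?_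
      filter_upwards [hmem t] with n ht using hclamp_eq _ ((hUV (φ n)).u_mem _ ht)⟩)
  obtain ⟨v, hv, hVv⟩ := exists_continuous_limit (F := fun n r => V (φ n) |r|) (hpow b hb)
    (fun r s => by
      filter_upwards [hmem r, hmem s] with n hr hs using (hUV (φ n)).symm.abs_sub_le hb hq hr hs)
    (fun t => ⟨(l t).2, by
      refine ((continuous_snd.tendsto _).comp (hl t)).congr' ?_
      filter_upwards [hmem t] with n ht using hclamp_eq _ ((hUV (φ n)).v_mem _ ht)⟩)
  have hU : ∀ r, 0 ≤ r → Tendsto (fun n => U (φ n) r) atTop (𝓝 (u r)) := fun r hr => by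
    simpa only [abs_of_nonneg hr] using hUu r
  have hV : ∀ r, 0 ≤ r → Tendsto (fun n => V (φ n) r) atTop (𝓝 (v r)) := fun r hr => by
    simpa only [abs_of_nonneg hr] using hVv r
  have hmem' : ∀ r : ℝ, 0 ≤ r → ∀ᶠ n in atTop, r ∈ Icc (0 : ℝ) (φ n) := fun r hr => by
    simpa only [abs_of_nonneg hr] using hmem r
  refine ⟨u, v, fun R => ⟨hu, hv, ?_, fun r hr => ?_, fun r hr => ?_, fun r hr => ?_,
    fun r hr => ?_⟩⟩
  · refine tendsto_nhds_unique ((hU 0 le_rfl).add (hV 0 le_rfl)) ?_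
    exact tendsto_const_nhds.congr fun n => ((hUV (φ n)).sum).symm
  · refine isClosed_Icc.mem_of_tendsto (hU r hr.1) ?_
    filter_upwards [hmem' r hr.1] with n hn using (hUV (φ n)).u_mem r hn
  · refine isClosed_Icc.mem_of_tendsto (hV r hr.1) ?_
    filter_upwards [hmem' r hr.1] with n hn using (hUV (φ n)).v_mem r hn
  · have ht := tendsto_radPot ha hr.1 (F := fun n τ => V (φ n) τ ^ p) (φ := fun τ => v τ ^ p)
      (fun n => (hUV (φ n)).cont_src hp)
      (by
        filter_upwards [hmem' r hr.1] with n hn x hx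
        have hx' : x ∈ Icc (0 : ℝ) (φ n) := ⟨hx.1, hx.2.trans hn.2⟩
        rw [abs_of_nonneg ((hUV (φ n)).src_nonneg p hx')]
        exact (hUV (φ n)).src_le_one hp hx')
      (fun x hx => (hV x hx.1).rpow_const (Or.inr hp.le))
    refine tendsto_nhds_unique (hU r hr.1) (((hU 0 le_rfl).sub ht).congr' ?_)
    filter_upwards [hmem' r hr.1] with n hn using ((hUV (φ n)).u_eq r hn).symm
  · have ht := tendsto_radPot hb hr.1 (F := fun n τ => U (φ n) τ ^ q) (φ := fun τ => u τ ^ q)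
      (fun n => (hUV (φ n)).symm.cont_src hq)
      (by
        filter_upwards [hmem' r hr.1] with n hn x hx
        have hx' : x ∈ Icc (0 : ℝ) (φ n) := ⟨hx.1, hx.2.trans hn.2⟩
        rw [abs_of_nonneg ((hUV (φ n)).symm.src_nonneg q hx')]
        exact (hUV (φ n)).symm.src_le_one hq hx')
      (fun x hx => (hU x hx.1).rpow_const (Or.inr hq.le))
    refine tendsto_nhds_unique (hV r hr.1) (((hV 0 le_rfl).sub ht).congr' ?_)
    filter_upwards [hmem' r hr.1] with n hn using ((hUV (φ n)).v_eq r hn).symm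

lemma RadSol.pos (h : ∀ R, RadSol a b p q R u v) (ha : -2 < a) (hb : -2 < b) (hp : 0 < p)
    (hq : 0 < q) {r : ℝ} (hr : 0 ≤ r) : 0 < u r := by
  have hu0 : ∀ s, 0 ≤ s → 0 ≤ u s := fun s hs => ((h s).u_mem s ⟨hs, le_rfl⟩).1
  have hanti : ∀ s t, 0 ≤ s → s ≤ t → u t ≤ u s := fun s t hs hst =>
    (h t).antitoneOn ha hp ⟨hs, hst⟩ ⟨hs.trans hst, le_rfl⟩ hst
  have hvanti : ∀ s t, 0 ≤ s → s ≤ t → v t ≤ v s := fun s t hs hst =>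
    (h t).symm.antitoneOn hb hq ⟨hs, hst⟩ ⟨hs.trans hst, le_rfl⟩ hst
  by_contra! hle
  have hv0 : v 0 ≤ 0 := by
    by_contra! hv0
    obtain ⟨t, ht, ht0⟩ := (((h 0).hv.continuousAt.eventually (lt_mem_nhds hv0)).filter_mono
      nhdsWithin_le_nhds |>.and (self_mem_nhdsWithin (s := Ioi (0 : ℝ)))).exists
    have ht0' : (0 : ℝ) < t := ht0
    have hrs : r < max r t + 1 := by linarith [le_max_left r t]
    have hts : t ≤ max r t + 1 := by linarith [le_max_right r t]
    set s := max r t + 1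
    have hs0 : 0 < s := ht0'.trans_le hts
    have hm := (radMass_pos ha ((h s).cont_src hp) ht0' fun x hx =>
      Real.rpow_pos_of_pos (ht.trans_le (hvanti x t hx.1 hx.2)) p).trans_le
        ((h s).radMass_monotoneOn ha hp ⟨ht0', hts⟩ ⟨hs0, le_rfl⟩ hts)
    have hd := (h (s + 1)).hasDerivAt ha hp ⟨hs0, by linarith⟩
    have hd0 : HasDerivAt u 0 s := by
      refine (hasDerivAt_const s (0 : ℝ)).congr_of_eventuallyEq ?_
      filter_upwards [lt_mem_nhds hrs] with x hx
      exact le_antisymm ((hanti r x hr hx.le).trans hle) (hu0 x (hr.trans hx.le))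
    have := hd.unique hd0
    have : 0 < radMass a (fun τ => v τ ^ p) s / s ^ 2 := by positivity
    linarith
  have h1 : radPot a (fun τ => v τ ^ p) r ≤ 0 := by
    have := radPot_le ha ((h r).cont_src hp) hr le_rfl fun x hx => by
      rw [le_antisymm ((hvanti 0 x le_rfl hx.1).trans hv0) ((h r).v_mem x hx).1,
        Real.zero_rpow hp.ne']
    rwa [zero_mul] at this
  linarith [(h r).u_eq r ⟨hr, le_rfl⟩, (h r).sum]

end

section
variable {a b p q : ℝ} {u v : ℝ → ℝ}

lemma contDiffOn_radMass (ha : -2 < a) {φ : ℝ → ℝ} (hφ : Continuous φ) :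
    ContDiffOn ℝ 1 (radMass a φ) (Ioi 0) := by
  have hd : ∀ r ∈ Ioi (0 : ℝ), HasDerivAt (radMass a φ) (r ^ (2 + a) * φ r) r := fun r hr =>
    hasDerivAt_radMass ha hφ hr
  rw [show (1 : WithTop ℕ∞) = 0 + 1 by norm_num, contDiffOn_succ_iff_deriv_of_isOpen isOpen_Ioi]
  refine ⟨fun r hr => (hd r hr).differentiableAt.differentiableWithinAt, by simp, ?_⟩
  rw [contDiffOn_zero]
  refine ContinuousOn.congr ?_ fun r hr => (hd r hr).deriv
  exact (continuousOn_id.rpow_const fun x hx => Or.inl (ne_of_gt hx)).mul hφ.continuousOn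

lemma RadSol.contDiffOn (h : ∀ R, RadSol a b p q R u v) (ha : -2 < a) (hp : 0 < p) :
    ContDiffOn ℝ 2 u (Ioi 0) := by
  have hd : ∀ r ∈ Ioi (0 : ℝ), HasDerivAt u (-(radMass a (fun τ => v τ ^ p) r / r ^ 2)) r :=
    fun r hr => (h (r + 1)).hasDerivAt ha hp ⟨hr, lt_add_one r⟩
  rw [show (2 : WithTop ℕ∞) = 1 + 1 by norm_num, contDiffOn_succ_iff_deriv_of_isOpen isOpen_Ioi]
  refine ⟨fun r hr => (hd r hr).differentiableAt.differentiableWithinAt, by simp, ?_⟩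
  refine ContDiffOn.congr ?_ fun r hr => (hd r hr).deriv
  exact ((contDiffOn_radMass ha ((h 0).cont_src hp)).div (contDiffOn_id.pow 2)
    fun r hr => pow_ne_zero 2 (ne_of_gt hr)).neg

lemma RadSol.contDiffOn_norm (h : ∀ R, RadSol a b p q R u v) (ha : -2 < a) (hp : 0 < p) :
    ContDiffOn ℝ 2 (fun x : E3 => u ‖x‖) (univ \ {0}) :=
  (RadSol.contDiffOn h ha hp).comp (contDiffOn_id.norm ℝ fun _ hx => hx.2)
    fun _ hx => norm_pos_iff.2 hx.2

lemma RadSol.neg_lap_eq (h : ∀ R, RadSol a b p q R u v) (ha : -2 < a) (hp : 0 < p) {x : E3}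
    (hx : x ≠ 0) : -lap (fun x : E3 => u ‖x‖) x = ‖x‖ ^ a * v ‖x‖ ^ p := by
  set m := radMass a (fun τ => v τ ^ p) with hm
  have hsqrt : ∀ s : ℝ, 0 < s → HasDerivAt Real.sqrt (1 / (2 * √s)) s := fun s hs =>
    Real.hasDerivAt_sqrt hs.ne'
  have hr : 0 < ‖x‖ := norm_pos_iff.2 hx
  have hx2 : 0 < ‖x‖ ^ 2 := by positivity
  have hu : (fun x : E3 => u ‖x‖) = fun y => (fun s => u (√s)) (‖y - 0‖ ^ 2) := by
    funext y
    simp only [sub_zero, Real.sqrt_sq (norm_nonneg y)]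
  have h1 : ∀ s : ℝ, 0 < s →
      HasDerivAt (fun s => u (√s)) (-(m (√s) / √s ^ 2) * (1 / (2 * √s))) s := fun s hs =>
    ((h (√s + 1)).hasDerivAt ha hp ⟨Real.sqrt_pos.2 hs, lt_add_one _⟩).comp s (hsqrt s hs)
  have hrr : √(‖x‖ ^ 2) = ‖x‖ := Real.sqrt_sq hr.le
  have hg : HasDerivAt (fun r => -(m r / r ^ 2) * (1 / (2 * r)))
      (-(‖x‖ ^ (2 + a) * v ‖x‖ ^ p) / (2 * ‖x‖ ^ 3) + 3 * m ‖x‖ / (2 * ‖x‖ ^ 4)) ‖x‖ := by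
    have h0 := ((hasDerivAt_radMass ha ((h 0).cont_src hp) hr).div (hasDerivAt_pow 2 ‖x‖)
      (by positivity)).neg.mul ((hasDerivAt_const ‖x‖ (1 : ℝ)).div
        ((hasDerivAt_id ‖x‖).const_mul 2) (by simpa using hr.ne'))
    refine h0.congr_deriv ?_
    simp only [Pi.neg_apply, Pi.div_apply, id, ← hm]
    field_simp
    ring
  have h2 := HasDerivAt.comp_of_eq (‖x‖ ^ 2) hg (hsqrt _ hx2) hrr.symm
  have hl := lap_radial (x := x) (x₀ := 0) (F := fun s => u (√s))
    (F' := fun s => -(m (√s) / √s ^ 2) * (1 / (2 * √s)))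
    (by rw [sub_zero]; filter_upwards [lt_mem_nhds hx2] with s hs using h1 s hs)
    (by rw [sub_zero]; exact h2)
  rw [hu, hl, sub_zero, hrr, show (2 : ℝ) + a = a + 2 by ring, Real.rpow_add hr, Real.rpow_two]
  field_simp
  ring

theorem exists_bounded_of_subcritical (ha : -2 < a) (hb : -2 < b) (hp : 0 < p) (hq : 0 < q)
    (hc : (3 + a) / (p + 1) + (3 + b) / (q + 1) ≤ 1) :
    ∃ u v : E3 → ℝ, IsHHSol a b p q univ u v ∧ (∃ M, ∀ x, u x ≤ M) ∧ (∃ M, ∀ x, v x ≤ M) := by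
  obtain ⟨u, v, h⟩ := exists_global_radSol ha hb hp hq hc
  have h' : ∀ R, RadSol b a q p R v u := fun R => (h R).symm
  refine ⟨fun x => u ‖x‖, fun x => v ‖x‖, ⟨((h 0).hu.comp continuous_norm).continuousOn,
    ((h 0).hv.comp continuous_norm).continuousOn, RadSol.contDiffOn_norm h ha hp,
    RadSol.contDiffOn_norm h' hb hq, fun x _ => RadSol.pos h ha hb hp hq (norm_nonneg x),
    fun x _ => RadSol.pos h' hb ha hq hp (norm_nonneg x),
    fun x hx => RadSol.neg_lap_eq h ha hp hx.2, fun x hx => RadSol.neg_lap_eq h' hb hq hx.2⟩,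
    ⟨1, fun x => ((h ‖x‖).u_mem _ ⟨norm_nonneg x, le_rfl⟩).2⟩,
    ⟨1, fun x => ((h ‖x‖).v_mem _ ⟨norm_nonneg x, le_rfl⟩).2⟩⟩

end

/-- Conjecture C holds in dimension 3 for bounded solutions: the Hardy–Hénon system has
no bounded positive solution on `ℝ³` if and only if `(3+a)/(p+1) + (3+b)/(q+1) > 1`. -/
theorem no_bounded_positive_solution_dim3_iff
    (a b p q : ℝ) (ha : -2 < a) (hb : -2 < b) (hp : 0 < p) (hq : 0 < q) :
    (¬ ∃ u v : EuclideanSpace ℝ (Fin 3) → ℝ,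
        IsHHSol a b p q (univ : Set (EuclideanSpace ℝ (Fin 3))) u v ∧
        (∃ M, ∀ x, u x ≤ M) ∧ (∃ M, ∀ x, v x ≤ M)) ↔
      (3 + a) / (p + 1) + (3 + b) / (q + 1) > 1 := by
  refine ⟨fun h => ?_, not_exists_bounded_of_supercritical ha hb hp hq⟩
  by_contra hc
  exact h (exists_bounded_of_subcritical ha hb hp hq (not_lt.1 hc))
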